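/- arXiv:2411.14973 — 5 statements merged into one kernel-verified Lean document; each statement's English description precedes it below -/
import Mathlib

section
/- Let σ > 0, R > 0 and t > 0. If t < R then lim_{T→∞} (1/(2πi)) ∫_{σ−iT}^{σ+iT} t^{−s} (R^s / s) ds = 1; if t > R then this limit equals 0; and if t = R then this limit equals 1/2. -/
open Filter intervalIntegral

/-- The Riemann-Lebesgue lemma for sine transforms on a measurable set. -/
theorem tendsto_setIntegral_exp_sub_exp_neg_mul {S : Set ℝ} (hS : MeasurableSet S) {g : ℝ → ℂ}
    (hg : MeasureTheory.IntegrableOn g S) :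
    Tendsto (fun T : ℝ => ∫ x in S,
        (Complex.exp (T * x * Complex.I) - Complex.exp (-(T * x * Complex.I))) * g x)
      atTop (nhds 0) := by
  have hint (T : ℝ) :
      MeasureTheory.IntegrableOn (fun x : ℝ => Complex.exp (T * x * Complex.I) * g x) S := by
    refine hg.bdd_mul (c := 1) (by fun_prop) (MeasureTheory.ae_of_all _ fun x => ?_)
    rw [← Complex.ofReal_mul, Complex.norm_exp_ofReal_mul_I]
  have hRL : Tendsto (fun T : ℝ => ∫ x in S, Complex.exp (T * x * Complex.I) * g x)
      (cocompact ℝ) (nhds 0) := by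
    have h := Real.tendsto_integral_exp_smul_cocompact (S.indicator g)
    have hscale : Tendsto (fun T : ℝ => T * (-(2 * Real.pi)⁻¹)) (cocompact ℝ) (cocompact ℝ) :=
      Filter.tendsto_cocompact_mul_right₀ (neg_ne_zero.mpr (by positivity))
    refine (h.comp hscale).congr fun T => ?_
    rw [← MeasureTheory.integral_indicator hS]
    refine MeasureTheory.integral_congr_ae (MeasureTheory.ae_of_all _ fun x => ?_)
    by_cases hx : x ∈ S
    · simp only [hx, Set.indicator_of_mem, Circle.smul_def, Real.fourierChar_apply, smul_eq_mul]
      congr 3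
      norm_cast
      field_simp
    · simp [hx]
  have hneg := hRL.comp (tendsto_neg_atTop_atBot.mono_right atBot_le_cocompact)
  have hpos := hRL.mono_left atTop_le_cocompact
  rw [← sub_zero (0 : ℂ)]
  refine (hpos.sub hneg).congr fun T => ?_
  rw [Function.comp_apply, ← MeasureTheory.integral_sub (hint T) (hint (-T))]
  refine MeasureTheory.integral_congr_ae (MeasureTheory.ae_of_all _ fun x => ?_)
  simp only [Complex.ofReal_neg, neg_mul, sub_mul]

theorem integral_exp_mul_add_mul_I (σ T : ℝ) {x : ℝ} (hx : x ≠ 0) :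
    ∫ u in (-T)..T, Complex.exp (((σ : ℂ) + u * Complex.I) * x) =
      (Complex.exp (T * x * Complex.I) - Complex.exp (-(T * x * Complex.I))) *
        (Complex.exp (σ * x) / (x * Complex.I)) := by
  have hc : (x : ℂ) * Complex.I ≠ 0 :=
    mul_ne_zero (Complex.ofReal_ne_zero.mpr hx) Complex.I_ne_zero
  have h (u : ℝ) : Complex.exp (((σ : ℂ) + u * Complex.I) * x) =
      Complex.exp (σ * x) * Complex.exp (x * Complex.I * u) := by
    rw [← Complex.exp_add]; ring_nf
  simp_rw [h]
  rw [intervalIntegral.integral_const_mul, integral_exp_mul_complex hc]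
  push_cast
  rw [show (x : ℂ) * Complex.I * T = T * x * Complex.I by ring,
    show (x : ℂ) * Complex.I * -T = -(T * x * Complex.I) by ring]
  ring

theorem integrable_exp_mul_prod {σ : ℝ} (hσ : 0 < σ) (a T : ℝ) :
    MeasureTheory.Integrable
      (Function.uncurry fun u x : ℝ => Complex.exp (((σ : ℂ) + u * Complex.I) * x))
      ((MeasureTheory.volume.restrict (Set.Ioc (-T) T)).prod
        (MeasureTheory.volume.restrict (Set.Iic a))) := by
  have h1 : MeasureTheory.Integrable (fun _ : ℝ => (1 : ℂ))
      (MeasureTheory.volume.restrict (Set.Ioc (-T) T)) := MeasureTheory.integrable_const _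
  have h2 := integrableOn_exp_mul_complex_Iic (a := (σ : ℂ)) (by simpa using hσ) a
  refine (h1.mul_prod h2).mono (by fun_prop) (MeasureTheory.ae_of_all _ fun p => ?_)
  simp [Function.uncurry, Complex.norm_exp]

theorem integrableOn_integral_exp_mul {σ : ℝ} (hσ : 0 < σ) (a T : ℝ) (hT : 0 ≤ T) :
    MeasureTheory.IntegrableOn
      (fun x : ℝ => ∫ u in (-T)..T, Complex.exp (((σ : ℂ) + u * Complex.I) * x)) (Set.Iic a) := by
  simp_rw [intervalIntegral.integral_of_le (neg_le_self hT)]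
  exact (integrable_exp_mul_prod hσ a T).integral_prod_right

theorem integral_exp_mul_div_eq {σ : ℝ} (hσ : 0 < σ) (a T : ℝ) (hT : 0 ≤ T) :
    ∫ u in (-T)..T, Complex.exp (((σ : ℂ) + u * Complex.I) * a) / ((σ : ℂ) + u * Complex.I) =
      ∫ x in Set.Iic a, ∫ u in (-T)..T, Complex.exp (((σ : ℂ) + u * Complex.I) * x) := by
  simp_rw [intervalIntegral.integral_of_le (neg_le_self hT)]
  rw [← MeasureTheory.integral_integral_swap (integrable_exp_mul_prod hσ a T)]
  refine MeasureTheory.integral_congr_ae (MeasureTheory.ae_of_all _ fun u => ?_)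
  exact (integral_exp_mul_complex_Iic (by simpa using hσ) a).symm

theorem tendsto_integral_exp_mul_div_of_neg {σ : ℝ} (hσ : 0 < σ) {a : ℝ} (ha : a < 0) :
    Tendsto (fun T : ℝ => ∫ u in (-T)..T,
        Complex.exp (((σ : ℂ) + u * Complex.I) * a) / ((σ : ℂ) + u * Complex.I))
      atTop (nhds 0) := by
  have hg : MeasureTheory.IntegrableOn
      (fun x : ℝ => Complex.exp (σ * x) / (x * Complex.I)) (Set.Iic a) := by
    have h := integrableOn_exp_mul_complex_Iic (a := (σ : ℂ)) (by simpa using hσ) a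
    refine h.mul_bdd (c := (-a)⁻¹) (g := fun x : ℝ => ((x : ℂ) * Complex.I)⁻¹)
      (by fun_prop) ?_
    filter_upwards [MeasureTheory.ae_restrict_mem measurableSet_Iic] with x hx
    have hx : x ≤ a := hx
    simp only [norm_inv, norm_mul, Complex.norm_I, Complex.norm_real, mul_one, Real.norm_eq_abs]
    rw [abs_of_neg (by linarith)]
    exact inv_anti₀ (by linarith) (by linarith)
  refine (tendsto_setIntegral_exp_sub_exp_neg_mul measurableSet_Iic hg).congr' ?_
  filter_upwards [eventually_ge_atTop 0] with T hT
  rw [integral_exp_mul_div_eq hσ a T hT]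
  refine MeasureTheory.setIntegral_congr_fun measurableSet_Iic fun x hx => ?_
  have hx : x ≤ a := hx
  exact (integral_exp_mul_add_mul_I σ T (by linarith)).symm

theorem integral_inv_add_mul_I {σ : ℝ} (hσ : 0 < σ) (T : ℝ) :
    ∫ u in (-T)..T, 1 / ((σ : ℂ) + u * Complex.I) = ((2 * Real.arctan (T / σ) : ℝ) : ℂ) := by
  have hne (u : ℝ) : (σ : ℂ) + u * Complex.I ≠ 0 := fun h => by
    have := congrArg Complex.re h
    simp at this
    linarith
  have hd (u : ℝ) : HasDerivAt
      (fun u : ℝ => ((Real.arctan (u / σ) : ℝ) : ℂ) -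
        ((Real.log (σ ^ 2 + u ^ 2) / 2 : ℝ) : ℂ) * Complex.I)
      (1 / ((σ : ℂ) + u * Complex.I)) u := by
    have h0 : σ ^ 2 + u ^ 2 ≠ 0 := by positivity
    have h1 := (((hasDerivAt_id u).div_const σ).arctan).ofReal_comp
    have h2 := (((((hasDerivAt_id u).pow 2).const_add (σ ^ 2)).log h0).div_const 2).ofReal_comp
    convert! h1.sub (h2.mul_const Complex.I) using 1
    have h0' : (σ : ℂ) ^ 2 + (u : ℂ) ^ 2 ≠ 0 := by exact_mod_cast h0
    have hσ' : (σ : ℂ) ≠ 0 := by exact_mod_cast hσ.ne'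
    have hI : 1 / ((σ : ℂ) + u * Complex.I) =
        (σ - u * Complex.I) / ((σ : ℂ) ^ 2 + (u : ℂ) ^ 2) := by
      rw [div_eq_div_iff (hne u) h0']
      linear_combination (u : ℂ) ^ 2 * Complex.I_sq
    rw [hI]
    simp only [id, Pi.pow_apply]
    push_cast
    field_simp
  have hcont : Continuous fun u : ℝ => 1 / ((σ : ℂ) + u * Complex.I) :=
    Continuous.div (by fun_prop) (by fun_prop) hne
  rw [intervalIntegral.integral_eq_sub_of_hasDerivAt (fun u _ => hd u)
    (hcont.intervalIntegrable _ _)]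
  simp only [neg_div, Real.arctan_neg, even_two.neg_pow]
  push_cast
  ring

theorem tendsto_integral_inv_add_mul_I {σ : ℝ} (hσ : 0 < σ) :
    Tendsto (fun T : ℝ => ∫ u in (-T)..T, 1 / ((σ : ℂ) + u * Complex.I))
      atTop (nhds (Real.pi : ℂ)) := by
  simp_rw [integral_inv_add_mul_I hσ]
  refine (Complex.continuous_ofReal.tendsto _).comp ?_
  have h := (Real.tendsto_arctan_atTop.mono_right nhdsWithin_le_nhds).comp
    (tendsto_id.atTop_div_const hσ)
  simpa [mul_div_cancel₀] using h.const_mul 2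

theorem integrableOn_exp_sub_exp_neg_div (σ a : ℝ) :
    MeasureTheory.IntegrableOn
      (fun x : ℝ => (Complex.exp (σ * x) - Complex.exp (-(σ * x))) / (x * Complex.I))
      (Set.Ioc 0 a) := by
  let f : ℝ → ℂ := fun x => (Complex.exp (σ * x) - Complex.exp (-(σ * x))) / Complex.I
  have hdiff : Differentiable ℝ f := by
    have : Differentiable ℝ (fun x : ℝ => (x : ℂ)) := Complex.ofRealCLM.differentiable
    fun_prop
  have hcont : Continuous (dslope f 0) := by
    rw [← continuousOn_univ, continuousOn_dslope univ_mem]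
    exact ⟨hdiff.continuous.continuousOn, hdiff 0⟩
  refine (hcont.continuousOn.integrableOn_compact (isCompact_Icc (a := 0) (b := a))).mono_set
    Set.Ioc_subset_Icc_self |>.congr_fun (fun x hx => ?_) measurableSet_Ioc
  rw [dslope_of_ne _ hx.1.ne', slope_def_module]
  simp [f, div_eq_mul_inv]
  ring

theorem tendsto_integral_exp_mul_div_of_pos {σ : ℝ} (hσ : 0 < σ) {a : ℝ} (ha : 0 < a) :
    Tendsto (fun T : ℝ => ∫ u in (-T)..T,
        Complex.exp (((σ : ℂ) + u * Complex.I) * a) / ((σ : ℂ) + u * Complex.I))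
      atTop (nhds (2 * Real.pi : ℂ)) := by
  have h1 := tendsto_setIntegral_exp_sub_exp_neg_mul measurableSet_Ioc
    (integrableOn_exp_sub_exp_neg_div σ a)
  have h2 := tendsto_integral_exp_mul_div_of_neg hσ (neg_neg_of_pos ha)
  have h3 := (tendsto_integral_inv_add_mul_I hσ).const_mul 2
  have h := (h1.add h3).sub h2
  rw [zero_add, sub_zero] at h
  refine h.congr' ?_
  filter_upwards [eventually_ge_atTop 0] with T hT
  let W : ℝ → ℂ := fun x => ∫ u in (-T)..T, Complex.exp (((σ : ℂ) + u * Complex.I) * x)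
  have hW (b : ℝ) : MeasureTheory.IntegrableOn W (Set.Iic b) :=
    integrableOn_integral_exp_mul hσ b T hT
  have hWi (b c : ℝ) : IntervalIntegrable W MeasureTheory.volume b c :=
    ⟨(hW c).mono_set fun x hx => hx.2, (hW b).mono_set fun x hx => hx.2⟩
  have e0 : ∫ u in (-T)..T, 1 / ((σ : ℂ) + u * Complex.I) = ∫ x in Set.Iic 0, W x := by
    rw [← integral_exp_mul_div_eq hσ 0 T hT]
    simp
  have e1 := intervalIntegral.integral_Iic_sub_Iic (hW 0) (hW a)
  have e2 := intervalIntegral.integral_Iic_sub_Iic (hW (-a)) (hW 0)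
  have e3 : ∫ x in (-a)..0, W x = ∫ x in (0 : ℝ)..a, W (-x) := by
    rw [intervalIntegral.integral_comp_neg, neg_zero]
  have e4 : ∫ x in Set.Ioc 0 a,
      (Complex.exp (T * x * Complex.I) - Complex.exp (-(T * x * Complex.I))) *
        ((Complex.exp (σ * x) - Complex.exp (-(σ * x))) / (x * Complex.I)) =
      (∫ x in (0 : ℝ)..a, W x) - ∫ x in (0 : ℝ)..a, W (-x) := by
    rw [← intervalIntegral.integral_sub (hWi 0 a)
      (by simpa using (hWi 0 (-a)).comp_sub_left 0), intervalIntegral.integral_of_le ha.le]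
    refine MeasureTheory.setIntegral_congr_fun measurableSet_Ioc fun x hx => ?_
    have hx0 : x ≠ 0 := hx.1.ne'
    simp only [W]
    rw [integral_exp_mul_add_mul_I σ T hx0, integral_exp_mul_add_mul_I σ T (neg_ne_zero.mpr hx0)]
    push_cast
    simp only [mul_neg, neg_mul, neg_neg, div_neg]
    ring
  rw [e4, e0, integral_exp_mul_div_eq hσ a T hT, integral_exp_mul_div_eq hσ (-a) T hT,
    ← e3, ← e1, ← e2]
  simp only [W]
  ring

/-- Perron's formula: for `σ, R, t > 0`, the truncated vertical contour integral
`(1/(2πi)) ∫_{σ-iT}^{σ+iT} t^{-s} R^s / s ds`, written as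
`(1/(2π)) ∫_{-T}^{T} t^{-(σ+iu)} R^{σ+iu} / (σ+iu) du`, tends to `1` if `t < R`,
to `0` if `t > R`, and to `1/2` if `t = R`, as `T → ∞`. -/
theorem stmt3 (σ R t : ℝ) (hσ : 0 < σ) (hR : 0 < R) (ht : 0 < t) :
    Tendsto (fun T : ℝ =>
        ((1 / (2 * Real.pi) : ℝ) : ℂ) *
          ∫ u in (-T)..T,
            (t : ℂ) ^ (-((σ : ℂ) + u * Complex.I)) * (R : ℂ) ^ ((σ : ℂ) + u * Complex.I)
              / ((σ : ℂ) + u * Complex.I))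
      atTop
      (nhds (if t < R then (1 : ℂ) else if R < t then 0 else 1 / 2)) := by
  have hRt : 0 < R / t := div_pos hR ht
  have key (u : ℝ) : (t : ℂ) ^ (-((σ : ℂ) + u * Complex.I)) * (R : ℂ) ^ ((σ : ℂ) + u * Complex.I) =
      Complex.exp (((σ : ℂ) + u * Complex.I) * (Real.log (R / t) : ℝ)) := by
    rw [Complex.cpow_def_of_ne_zero (by exact_mod_cast ht.ne'),
      Complex.cpow_def_of_ne_zero (by exact_mod_cast hR.ne'), ← Complex.exp_add,
      Real.log_div hR.ne' ht.ne', ← Complex.ofReal_log ht.le, ← Complex.ofReal_log hR.le]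
    push_cast
    ring_nf
  have hpi : (Real.pi : ℂ) ≠ 0 := by exact_mod_cast Real.pi_ne_zero
  simp_rw [key]
  rcases lt_trichotomy t R with h | h | h
  · rw [if_pos h]
    have hlog : 0 < Real.log (R / t) := Real.log_pos ((one_lt_div ht).mpr h)
    convert (tendsto_integral_exp_mul_div_of_pos hσ hlog).const_mul
      ((1 / (2 * Real.pi) : ℝ) : ℂ) using 2
    push_cast
    field_simp
  · subst h
    rw [if_neg (lt_irrefl _), if_neg (lt_irrefl _), div_self ht.ne', Real.log_one]
    simp only [Complex.ofReal_zero, mul_zero, Complex.exp_zero]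
    convert (tendsto_integral_inv_add_mul_I hσ).const_mul ((1 / (2 * Real.pi) : ℝ) : ℂ) using 2
    push_cast
    field_simp
  · rw [if_neg h.not_gt, if_pos h]
    have hlog : Real.log (R / t) < 0 := Real.log_neg hRt ((div_lt_one ht).mpr h)
    simpa using (tendsto_integral_exp_mul_div_of_neg hσ hlog).const_mul
      ((1 / (2 * Real.pi) : ℝ) : ℂ)
end

section
/- Let Λ ⊆ ℝ^d be a full-rank lattice of covolume 1, let f_rad : ℝ_{>0} → ℝ be a smooth function with compact support contained in ℝ_{>0}, and set f(x) = f_rad(‖x‖) for x ∈ ℝ^d \ {0}. Then for every σ > 1, Σ_{v ∈ Λ \ {0}} f(v) = (d/(2π)) ∫_{−∞}^{∞} E(Λ, (σ+it)d) · Mf_rad((σ+it)d) dt, where E(Λ, s) = Σ_{v ∈ Λ \ {0}} ‖v‖^{−s} and Mf_rad(s) = ∫₀^∞ f_rad(u) u^{s−1} du. -/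
open MeasureTheory

open scoped FourierTransform in
/-- The Mellin transform of a smooth function with compact support in `ℝ_{>0}` is integrable along
every vertical line. -/
theorem verticalIntegrable_mellin_of_contDiff {f : ℝ → ℂ} (hf : ContDiff ℝ (⊤ : ℕ∞) f)
    (hc : HasCompactSupport f) (hs : tsupport f ⊆ Set.Ioi 0) (c : ℝ) :
    Complex.VerticalIntegrable (mellin f) c := by
  let g : ℝ → ℂ := fun u ↦ Real.exp (-c * u) • f (Real.exp (-u))
  have hg : ContDiff ℝ (⊤ : ℕ∞) g :=
    (Real.contDiff_exp.comp (contDiff_const.mul contDiff_id)).smul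
      (hf.comp (Real.contDiff_exp.comp contDiff_neg))
  have hgc : HasCompactSupport g := by
    have hK : IsCompact ((fun x ↦ -Real.log x) '' tsupport f) :=
      hc.isCompact.image_of_continuousOn
        ((Real.continuousOn_log.mono fun x hx ↦ (hs hx).ne').neg)
    refine HasCompactSupport.intro hK fun u hu ↦ ?_
    have : Real.exp (-u) ∉ tsupport f := fun h ↦ hu ⟨_, h, by simp⟩
    simp [g, image_eq_zero_of_notMem_tsupport this]
  have hint : Integrable (𝓕 g) := (𝓕 (hgc.toSchwartzMap hg)).integrable
  have h2π : (2 * Real.pi)⁻¹ ≠ 0 := by simp [Real.pi_ne_zero]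
  have := hint.comp_mul_right' h2π
  refine this.congr (Filter.Eventually.of_forall fun y ↦ ?_)
  simp [mellin_eq_fourier, g, div_eq_mul_inv]

/-- Mellin inversion for smooth functions with compact support in `ℝ_{>0}`. -/
theorem mellinInv_mellin_of_contDiff {f : ℝ → ℂ} (hf : ContDiff ℝ (⊤ : ℕ∞) f)
    (hc : HasCompactSupport f) (hs : tsupport f ⊆ Set.Ioi 0) (c : ℝ) {x : ℝ} (hx : 0 < x) :
    mellinInv c (mellin f) x = f x := by
  refine mellinInv_mellin_eq c f hx ?_ (verticalIntegrable_mellin_of_contDiff hf hc hs c)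
    hf.continuous.continuousAt
  rw [MellinConvergent]
  have hcont : ContinuousOn (fun t : ℝ ↦ (t : ℂ) ^ ((c : ℂ) - 1) • f t) (tsupport f) := by
    refine ContinuousOn.smul (f := fun t : ℝ ↦ (t : ℂ) ^ ((c : ℂ) - 1)) (fun t ht ↦ ?_)
      hf.continuous.continuousOn
    exact (Complex.continuousAt_ofReal_cpow_const t _ (Or.inr (hs ht).ne')).continuousWithinAt
  refine (integrableOn_iff_integrable_of_support_subset ?_).1
    (hcont.integrableOn_compact hc.isCompact) |>.integrableOn
  exact (Function.support_smul_subset_right (fun t : ℝ ↦ (t : ℂ) ^ ((c : ℂ) - 1)) f).trans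
    (subset_tsupport f)

/-- For a unit-covolume full-rank lattice `Λ ⊆ ℝ^d` and a smooth compactly supported
radial profile `f_rad` (supported in `ℝ_{>0}`), with `f(x) = f_rad(‖x‖)`, one has for `σ > 1`:
`Σ_{v ∈ Λ \ {0}} f(v) = (d/(2π)) ∫_{-∞}^{∞} E(Λ,(σ+it)d) · Mf_rad((σ+it)d) dt`, where
`E(Λ,s) = Σ_{v ∈ Λ \ {0}} ‖v‖^{-s}` and `Mf_rad(s) = ∫₀^∞ f_rad(u) u^{s-1} du`. -/
theorem stmt6 (d : ℕ) (hd : 0 < d) (Λ : Submodule ℤ (EuclideanSpace ℝ (Fin d)))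
    [DiscreteTopology Λ] [IsZLattice ℝ Λ] (hcov : ZLattice.covolume Λ = 1)
    (f_rad : ℝ → ℝ) (hsmooth : ContDiff ℝ (⊤ : ℕ∞) f_rad) (hcomp : HasCompactSupport f_rad)
    (hsupp : tsupport f_rad ⊆ Set.Ioi 0) (σ : ℝ) (hσ : 1 < σ) :
    ((∑' v : {v : Λ // v ≠ 0}, f_rad ‖(v.1 : EuclideanSpace ℝ (Fin d))‖ : ℝ) : ℂ)
      = ((d : ℂ) / (2 * (Real.pi : ℂ))) *
        ∫ t : ℝ,
          (∑' v : {v : Λ // v ≠ 0},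
            (‖(v.1 : EuclideanSpace ℝ (Fin d))‖ : ℂ) ^ (-(((σ : ℂ) + t * Complex.I) * d)))
          * ∫ u in Set.Ioi (0 : ℝ), (f_rad u : ℂ) * (u : ℂ) ^ (((σ : ℂ) + t * Complex.I) * d - 1) := by
  let f : ℝ → ℂ := fun u ↦ (f_rad u : ℂ)
  have hf : ContDiff ℝ (⊤ : ℕ∞) f := Complex.ofRealCLM.contDiff.comp hsmooth
  have hts : tsupport f = tsupport f_rad := by
    simp [tsupport, Function.support, f]
  have hfc : HasCompactSupport f := by rw [HasCompactSupport, hts]; exact hcomp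
  have hfs : tsupport f ⊆ Set.Ioi 0 := hts ▸ hsupp
  have hd' : (0 : ℝ) < d := by exact_mod_cast hd
  have hdC : (d : ℂ) ≠ 0 := by exact_mod_cast hd.ne'
  have hπ : (Real.pi : ℂ) ≠ 0 := by exact_mod_cast Real.pi_ne_zero
  have hM : ∀ s : ℂ, ∫ u in Set.Ioi (0 : ℝ), (f_rad u : ℂ) * (u : ℂ) ^ (s - 1) = mellin f s :=
    fun s ↦ by simp only [mellin, f, smul_eq_mul, mul_comm]
  have hline : ∀ t : ℝ, ((σ : ℂ) + t * Complex.I) * d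
      = ((σ * d : ℝ) : ℂ) + ((t * d : ℝ) : ℂ) * Complex.I := fun t ↦ by push_cast; ring
  have hpos : ∀ v : {v : Λ // v ≠ 0}, 0 < ‖(v.1 : EuclideanSpace ℝ (Fin d))‖ :=
    fun v ↦ norm_pos_iff.2 fun h ↦ v.2 (Subtype.ext h)
  simp only [hM, hline]
  set c : ℝ := σ * d
  have hVI : Integrable fun y : ℝ ↦ mellin f (c + y * Complex.I) :=
    verticalIntegrable_mellin_of_contDiff hf hfc hfs c
  have hVI' : Integrable fun t : ℝ ↦ mellin f (c + (t * d : ℝ) * Complex.I) :=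
    hVI.comp_mul_right' hd'.ne'
  let F : {v : Λ // v ≠ 0} → ℝ → ℂ := fun v t ↦
    (‖(v.1 : EuclideanSpace ℝ (Fin d))‖ : ℂ) ^ (-(c + (t * d : ℝ) * Complex.I)) *
      mellin f (c + (t * d : ℝ) * Complex.I)
  have hnorm : ∀ v t, ‖F v t‖ = ‖(v.1 : EuclideanSpace ℝ (Fin d))‖ ^ (-c) *
      ‖mellin f (c + (t * d : ℝ) * Complex.I)‖ := fun v t ↦ by
    rw [norm_mul, Complex.norm_cpow_eq_rpow_re_of_pos (hpos v)]
    simp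
  have hFint : ∀ v, Integrable (F v) := fun v ↦ by
    have hcont : Continuous fun t : ℝ ↦
        (‖(v.1 : EuclideanSpace ℝ (Fin d))‖ : ℂ) ^ (-(c + (t * d : ℝ) * Complex.I)) :=
      Continuous.const_cpow (by fun_prop) (Or.inl (by exact_mod_cast (hpos v).ne'))
    refine (hVI'.norm.const_mul (‖(v.1 : EuclideanSpace ℝ (Fin d))‖ ^ (-c))).mono'
      (hcont.aestronglyMeasurable.mul hVI'.aestronglyMeasurable)
      (Filter.Eventually.of_forall fun t ↦ (hnorm v t).le)
  have hsum : Summable fun v : {v : Λ // v ≠ 0} ↦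
      ‖(v.1 : EuclideanSpace ℝ (Fin d))‖ ^ (-c) := by
    refine (ZLattice.summable_norm_rpow Λ (-c) ?_).subtype _
    rw [ZLattice.rank ℝ Λ, finrank_euclideanSpace_fin]
    exact neg_lt_neg (lt_mul_of_one_lt_left hd' hσ)
  have hFsum : Summable fun v ↦ ∫ t, ‖F v t‖ := by
    simp only [hnorm, integral_const_mul]
    exact hsum.mul_right _
  have hFval : ∀ v, ∫ t, F v t = (2 * Real.pi / d : ℂ) *
      f_rad ‖(v.1 : EuclideanSpace ℝ (Fin d))‖ := fun v ↦ by
    have h1 : ∫ t, F v t = |(d : ℝ)⁻¹| •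
        ∫ y : ℝ, (‖(v.1 : EuclideanSpace ℝ (Fin d))‖ : ℂ) ^ (-(c + y * Complex.I)) •
          mellin f (c + y * Complex.I) := by
      rw [← Measure.integral_comp_mul_right]
      rfl
    have h2 := mellinInv_mellin_of_contDiff hf hfc hfs c (hpos v)
    rw [mellinInv] at h2
    rw [h1, abs_of_pos (inv_pos.2 hd')]
    change _ = _ * f _
    rw [← h2]
    simp only [Complex.real_smul]
    generalize ∫ y : ℝ, (‖(v.1 : EuclideanSpace ℝ (Fin d))‖ : ℂ) ^ (-(c + y * Complex.I)) •
      mellin f (c + y * Complex.I) = J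
    push_cast
    field_simp
  have key := integral_tsum_of_summable_integral_norm hFint hFsum
  simp only [F, tsum_mul_right] at key
  rw [← key]
  change _ = _ * ∑' v, ∫ t, F v t
  simp only [hFval, tsum_mul_left]
  push_cast
  field_simp
end

section
/- For every integer n ≥ 1, log n − Σ_{p ∣ n} (log p)/(p − 1) = Σ_{p ∣ n} (ν_p(n) − 1/(p − 1)) log p ≥ (1/2) log n − log 2, where both sums range over the primes p dividing n and ν_p(n) denotes the p-adic valuation of n. -/
/-- For every integer `n ≥ 1`,
`log n - Σ_{p ∣ n} (log p)/(p-1) = Σ_{p ∣ n} (ν_p(n) - 1/(p-1)) log p ≥ (1/2) log n - log 2`,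
the sums being over the prime divisors of `n`, with `ν_p(n)` the `p`-adic valuation of `n`. -/
theorem stmt16 (n : ℕ) (hn : 1 ≤ n) :
    Real.log n - ∑ p ∈ n.primeFactors, Real.log p / ((p : ℝ) - 1)
        = ∑ p ∈ n.primeFactors, ((n.factorization p : ℝ) - 1 / ((p : ℝ) - 1)) * Real.log p ∧
    (1 / 2) * Real.log n - Real.log 2
        ≤ ∑ p ∈ n.primeFactors, ((n.factorization p : ℝ) - 1 / ((p : ℝ) - 1)) * Real.log p := by
  have hlog : Real.log n = ∑ p ∈ n.primeFactors, (n.factorization p : ℝ) * Real.log p := by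
    rw [Real.log_nat_eq_sum_factorization, Finsupp.sum, Nat.support_factorization]
  refine ⟨?_, ?_⟩
  · rw [hlog, ← Finset.sum_sub_distrib]
    exact Finset.sum_congr rfl fun p _ => by ring
  have hterm : ∀ p ∈ n.primeFactors,
      1 / 2 * ((n.factorization p : ℝ) * Real.log p) - (if p = 2 then Real.log 2 else 0)
        ≤ ((n.factorization p : ℝ) - 1 / ((p : ℝ) - 1)) * Real.log p := by
    intro p hp
    have hprime := Nat.prime_of_mem_primeFactors hp
    have hν : (1 : ℝ) ≤ n.factorization p := by
      exact_mod_cast hprime.factorization_pos_of_dvd (by omega) (Nat.dvd_of_mem_primeFactors hp)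
    have hlogp : 0 ≤ Real.log p := Real.log_natCast_nonneg p
    split_ifs with h2
    · subst h2
      norm_num at hlogp ⊢
      nlinarith
    · have hp3 : (3 : ℝ) ≤ p := by
        have := hprime.two_le
        exact_mod_cast (by omega : 3 ≤ p)
      have hinv : 1 / ((p : ℝ) - 1) ≤ 1 / 2 :=
        one_div_le_one_div_of_le (by norm_num) (by linarith)
      nlinarith
  have hsum : ∑ p ∈ n.primeFactors, (if p = 2 then Real.log 2 else 0) ≤ Real.log 2 := by
    rw [Finset.sum_ite_eq']
    split_ifs
    · exact le_rfl
    · exact Real.log_nonneg (by norm_num)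
  calc 1 / 2 * Real.log n - Real.log 2
      ≤ ∑ p ∈ n.primeFactors, (1 / 2 * ((n.factorization p : ℝ) * Real.log p)
          - (if p = 2 then Real.log 2 else 0)) := by
        rw [Finset.sum_sub_distrib, ← Finset.mul_sum, ← hlog]
        linarith
    _ ≤ _ := Finset.sum_le_sum hterm
end

section
/- There exists a constant c > 0 such that for all sufficiently large integers n there is a full-rank lattice Λ ⊆ ℝ^{φ(n)} of covolume 1 and an origin-centered Euclidean ball B ⊆ ℝ^{φ(n)} of volume at least n − e^{−c · φ(n) · log n} with Λ ∩ B = {0}. In particular, the lattice packing quantity c_d = sup{ vol(B) : B an origin-centered ball in ℝ^d such that gℤ^d ∩ B = {0} for some g ∈ SL_d(ℝ) } satisfies c_{φ(n)} ≥ n − e^{−c φ(n) log n} for all sufficiently large n. -/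
open MeasureTheory

/-- The lattice packing quantity `c_d`: the supremum of volumes of origin-centered balls
`B ⊆ ℝ^d` meeting some full-rank covolume-one lattice only in `0`. -/
noncomputable def latticePackingSup (d : ℕ) : ℝ :=
  sSup {V : ℝ | ∃ (Λ : Submodule ℤ (EuclideanSpace ℝ (Fin d))) (_ : DiscreteTopology Λ)
      (_ : IsZLattice ℝ Λ) (R : ℝ), 0 ≤ R ∧ ZLattice.covolume Λ = 1 ∧
      V = (volume (Metric.closedBall (0 : EuclideanSpace ℝ (Fin d)) R)).toReal ∧
      ∀ v ∈ Λ, v ∈ Metric.closedBall (0 : EuclideanSpace ℝ (Fin d)) R → v = 0}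

namespace LatticePacking

open Matrix

theorem card_strict_pairs (d : ℕ) :
    (Finset.univ.sigma fun j : Fin d => Finset.Iio j).card = d * (d - 1) / 2 := by
  rw [Finset.card_sigma]
  simp only [Fin.card_Iio]
  rw [Fin.sum_univ_eq_sum_range (fun i => i) d, Finset.sum_range_id]

/-- Bessel averaging over the symmetric matrices `C` whose quadratic form vanishes at finitely many
given vectors: one of them, of Frobenius norm one, has small weighted mean square. -/
theorem exists_symm_direction {d m : ℕ} {κ : Type*} (y : κ → Fin d → ℝ) (hy : ∀ k, y k ≠ 0)
    (w : κ → ℝ) (hw : ∀ k, 0 ≤ w k) (hs : Summable w) (K : Finset κ) (hm : 0 < m)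
    (hcard : m + K.card + d * (d - 1) / 2 ≤ d * d) :
    ∃ C : Matrix (Fin d) (Fin d) ℝ, Cᵀ = C ∧ ∑ i, ∑ j, C i j ^ 2 = 1 ∧
      (∀ k ∈ K, y k ⬝ᵥ C *ᵥ y k = 0) ∧
      ∑' k, w k * ((y k ⬝ᵥ C *ᵥ y k) / (y k ⬝ᵥ y k)) ^ 2 ≤ (∑' k, w k) / m := by
  classical
  let v : κ → EuclideanSpace ℝ (Fin d × Fin d) := fun k => WithLp.toLp 2 fun p => y k p.1 * y k p.2
  let anti : (Σ _ : Fin d, Fin d) →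
      EuclideanSpace ℝ (Fin d × Fin d) := fun p =>
    EuclideanSpace.single (p.1, p.2) 1 - EuclideanSpace.single (p.2, p.1) 1
  let S : Finset (EuclideanSpace ℝ (Fin d × Fin d)) := K.image v ∪
    (Finset.univ.sigma fun j : Fin d => Finset.Iio j).image anti
  let W : Submodule ℝ (EuclideanSpace ℝ (Fin d × Fin d)) := 
    (Submodule.span ℝ (SetLike.coe S))ᗮ
  have hS : S.card ≤ K.card + d * (d - 1) / 2 := by
    refine (Finset.card_union_le _ _).trans (add_le_add Finset.card_image_le ?_)
    exact Finset.card_image_le.trans (card_strict_pairs d).le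
  have hWm : m ≤ Module.finrank ℝ W := by
    have h1 := Submodule.finrank_add_finrank_orthogonal (Submodule.span ℝ (SetLike.coe S))
    have h2 : Module.finrank ℝ (Submodule.span ℝ (SetLike.coe S)) ≤ S.card :=
      finrank_span_finset_le_card S
    have h3 : Module.finrank ℝ (EuclideanSpace ℝ (Fin d × Fin d)) = d * d := by simp
    change _ + Module.finrank ℝ W = _ at h1
    omega
  let n := Module.finrank ℝ W
  let b : Fin n → EuclideanSpace ℝ (Fin d × Fin d) := fun i =>
    (stdOrthonormalBasis ℝ W i : EuclideanSpace ℝ (Fin d × Fin d))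
  have hb : Orthonormal ℝ b :=
    (stdOrthonormalBasis ℝ W).orthonormal.comp_linearIsometry W.subtypeₗᵢ
  have hbW : ∀ i, b i ∈ W := fun i => (stdOrthonormalBasis ℝ W i).2
  let C : Fin n → Matrix (Fin d) (Fin d) ℝ := fun i => Matrix.of fun r s => b i (r, s)
  have hinner : ∀ i k, y k ⬝ᵥ C i *ᵥ y k = inner ℝ (b i) (v k) := by
    intro i k
    simp only [dotProduct, mulVec, PiLp.inner_apply, Fintype.sum_prod_type, C, v, Finset.mul_sum,
      Matrix.of_apply]
    refine Finset.sum_congr rfl fun r _ => Finset.sum_congr rfl fun s _ => ?_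
    simp
    ring
  have hnorm : ∀ k, ‖v k‖ ^ 2 = (y k ⬝ᵥ y k) ^ 2 := by
    intro k
    rw [EuclideanSpace.norm_sq_eq]
    simp only [dotProduct, Fintype.sum_prod_type, v, sq, Finset.sum_mul_sum, Real.norm_eq_abs,
      abs_mul_abs_self]
    refine Finset.sum_congr rfl fun r _ => Finset.sum_congr rfl fun s _ => ?_
    ring
  have hypos : ∀ k, 0 < y k ⬝ᵥ y k := fun k => by
    have := dotProduct_star_self_pos_iff.2 (hy k)
    simpa using this
  have hbessel : ∀ k, ∑ i, ((y k ⬝ᵥ C i *ᵥ y k) / (y k ⬝ᵥ y k)) ^ 2 ≤ 1 := by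
    intro k
    have h := hb.sum_inner_products_le (v k) (s := Finset.univ)
    simp only [div_pow, ← Finset.sum_div]
    rw [div_le_one (pow_pos (hypos k) 2), ← hnorm]
    simpa [hinner] using h
  have hone : ∀ i k, ((y k ⬝ᵥ C i *ᵥ y k) / (y k ⬝ᵥ y k)) ^ 2 ≤ 1 := fun i k =>
    (Finset.single_le_sum (f := fun i => ((y k ⬝ᵥ C i *ᵥ y k) / (y k ⬝ᵥ y k)) ^ 2)
      (fun _ _ => sq_nonneg _) (Finset.mem_univ i)).trans (hbessel k)
  have hsum : ∀ i, Summable fun k => w k * ((y k ⬝ᵥ C i *ᵥ y k) / (y k ⬝ᵥ y k)) ^ 2 := fun i =>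
    Summable.of_nonneg_of_le (fun k => mul_nonneg (hw k) (sq_nonneg _))
      (fun k => mul_le_of_le_one_right (hw k) (hone i k)) hs
  have htot : ∑ i, ∑' k, w k * ((y k ⬝ᵥ C i *ᵥ y k) / (y k ⬝ᵥ y k)) ^ 2 ≤ ∑' k, w k := by
    rw [← Summable.tsum_finsetSum fun i _ => hsum i]
    refine Summable.tsum_le_tsum (fun k => ?_) (summable_sum fun i _ => hsum i) hs
    rw [← Finset.mul_sum]
    exact mul_le_of_le_one_right (hw k) (hbessel k)
  have hn : 0 < n := hm.trans_le hWm
  have : Nonempty (Fin n) := ⟨⟨0, hn⟩⟩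
  obtain ⟨i, -, hi⟩ := Finset.exists_le_of_sum_le (s := (Finset.univ : Finset (Fin n)))
    (f := fun i => ∑' k, w k * ((y k ⬝ᵥ C i *ᵥ y k) / (y k ⬝ᵥ y k)) ^ 2)
    (g := fun _ => (∑' k, w k) / n) Finset.univ_nonempty (by
      rw [Finset.sum_const, Finset.card_univ, Fintype.card_fin, nsmul_eq_mul, mul_div_cancel₀]
      · exact htot
      · positivity)
  have hW : ∀ x ∈ S, inner ℝ x (b i) = (0 : ℝ) := fun x hx =>
    (Submodule.mem_orthogonal _ _).1 (hbW i) x (Submodule.subset_span hx)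
  refine ⟨C i, ?_, ?_, ?_, hi.trans ?_⟩
  · have key : ∀ r s : Fin d, r < s → b i (r, s) = b i (s, r) := by
      intro r s hrs
      have := hW (anti ⟨s, r⟩) (Finset.mem_union_right _ (Finset.mem_image_of_mem _ (by simpa)))
      simp only [anti, inner_sub_left, EuclideanSpace.inner_single_left] at this
      simp at this
      linarith
    ext r s
    simp only [C, transpose_apply, of_apply]
    rcases lt_trichotomy r s with h | h | h
    · exact (key r s h).symm
    · rw [h]
    · exact key s r h
  · have h1 := hb.1 i
    have h2 := EuclideanSpace.norm_sq_eq (b i)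
    rw [h1, Fintype.sum_prod_type] at h2
    simpa [C] using h2.symm
  · intro k hk
    rw [hinner i k, real_inner_comm]
    exact hW _ (Finset.mem_union_left _ (Finset.mem_image_of_mem _ hk))
  · have : (m : ℝ) ≤ n := by exact_mod_cast hWm
    have hm' : (0 : ℝ) < m := by exact_mod_cast hm
    exact div_le_div_of_nonneg_left (tsum_nonneg hw) hm' this

theorem abs_quadForm_le {d : ℕ} {C : Matrix (Fin d) (Fin d) ℝ} (hC : ∑ i, ∑ j, C i j ^ 2 = 1)
    (y : Fin d → ℝ) : |y ⬝ᵥ C *ᵥ y| ≤ y ⬝ᵥ y := by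
  have h0 : 0 ≤ y ⬝ᵥ y := by simpa using dotProduct_star_self_nonneg y
  refine abs_le_of_sq_le_sq ?_ h0
  have h := Finset.sum_mul_sq_le_sq_mul_sq (Finset.univ : Finset (Fin d × Fin d))
    (fun p => C p.1 p.2) (fun p => y p.1 * y p.2)
  simp only [Fintype.sum_prod_type] at h
  rw [hC, one_mul] at h
  calc (y ⬝ᵥ C *ᵥ y) ^ 2 = (∑ i, ∑ j, C i j * (y i * y j)) ^ 2 := by
        simp only [dotProduct, mulVec, Finset.mul_sum]
        congr 1
        refine Finset.sum_congr rfl fun r _ => Finset.sum_congr rfl fun s _ => ?_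
        ring
    _ ≤ _ := h
    _ = (y ⬝ᵥ y) ^ 2 := by
        simp only [dotProduct, sq, Finset.sum_mul_sum]
        refine Finset.sum_congr rfl fun r _ => Finset.sum_congr rfl fun s _ => ?_
        ring

theorem det_le_exp_trace_sub {d : ℕ} {X : Matrix (Fin d) (Fin d) ℝ} (hX : X.PosSemidef) :
    X.det ≤ Real.exp (X.trace - d) := by
  rw [hX.1.det_eq_prod_eigenvalues, hX.1.trace_eq_sum_eigenvalues]
  simp only [RCLike.ofReal_real_eq_id, id_eq]
  calc ∏ i, hX.1.eigenvalues i ≤ ∏ i, Real.exp (hX.1.eigenvalues i - 1) :=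
        Finset.prod_le_prod (fun i _ => hX.eigenvalues_nonneg i) fun i _ => by
          have := Real.add_one_le_exp (hX.1.eigenvalues i - 1)
          linarith
    _ = _ := by rw [← Real.exp_sum]; simp

theorem det_one_add_mul_det_one_sub_le {d : ℕ} {C : Matrix (Fin d) (Fin d) ℝ} (hsymm : Cᵀ = C)
    (hC : ∑ i, ∑ j, C i j ^ 2 = 1) {t : ℝ} (ht : t ^ 2 ≤ 1) :
    (1 + t • C).det * (1 - t • C).det ≤ Real.exp (-t ^ 2) := by
  have hprod : (1 + t • C) * (1 - t • C) = 1 - t ^ 2 • (Cᵀ * C) := by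
    rw [hsymm]
    simp only [mul_sub, add_mul, one_mul, mul_one, smul_mul_smul_comm, sq]
    abel
  have hpsd : (1 - t ^ 2 • (Cᵀ * C)).PosSemidef := by
    refine PosSemidef.of_dotProduct_mulVec_nonneg ?_ fun x => ?_
    · rw [IsHermitian, conjTranspose_eq_transpose_of_trivial]
      simp [transpose_mul]
    · have h1 : star x ⬝ᵥ (1 - t ^ 2 • (Cᵀ * C)) *ᵥ x =
          x ⬝ᵥ x - t ^ 2 * ((C *ᵥ x) ⬝ᵥ (C *ᵥ x)) := by
        rw [sub_mulVec, one_mulVec, smul_mulVec, dotProduct_sub, dotProduct_smul, ← mulVec_mulVec,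
          dotProduct_mulVec, vecMul_transpose]
        simp
      have h2 : (C *ᵥ x) ⬝ᵥ (C *ᵥ x) ≤ x ⬝ᵥ x := by
        calc (C *ᵥ x) ⬝ᵥ (C *ᵥ x) = ∑ i, (∑ j, C i j * x j) ^ 2 := by
              simp [dotProduct, mulVec, sq]
          _ ≤ ∑ i, (∑ j, C i j ^ 2) * (∑ j, x j ^ 2) :=
              Finset.sum_le_sum fun i _ => Finset.sum_mul_sq_le_sq_mul_sq _ _ _
          _ = x ⬝ᵥ x := by
              rw [← Finset.sum_mul, hC, one_mul]
              simp [dotProduct, sq]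
      have h3 : 0 ≤ (C *ᵥ x) ⬝ᵥ (C *ᵥ x) := by simpa using dotProduct_star_self_nonneg (C *ᵥ x)
      rw [h1]
      nlinarith
  have htr : (1 - t ^ 2 • (Cᵀ * C)).trace = d - t ^ 2 := by
    have : (Cᵀ * C).trace = 1 := by
      rw [← hC, Finset.sum_comm]
      simp [trace, mul_apply, sq]
    rw [trace_sub, trace_smul, this, trace_one]
    simp
  calc _ = (1 - t ^ 2 • (Cᵀ * C)).det := by rw [← det_mul, hprod]
    _ ≤ _ := det_le_exp_trace_sub hpsd
    _ = _ := by rw [htr]; congr 1; ring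

theorem exists_transpose_mul_self {d : ℕ} {X : Matrix (Fin d) (Fin d) ℝ} (hX : X.PosSemidef) :
    ∃ N : Matrix (Fin d) (Fin d) ℝ, Nᵀ * N = X := by
  open scoped MatrixOrder in
  obtain ⟨N, hN⟩ := CStarAlgebra.nonneg_iff_eq_star_mul_self.1 hX.nonneg
  exact ⟨N, by rw [hN, star_eq_conjTranspose, conjTranspose_eq_transpose_of_trivial]⟩

/-- The squared length of the point of the lattice `M ℤ^d` with integer coordinates `z`. -/
noncomputable def sqLen {d : ℕ} (M : Matrix (Fin d) (Fin d) ℝ) (z : Fin d → ℤ) : ℝ :=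
  (M *ᵥ fun i => (z i : ℝ)) ⬝ᵥ (M *ᵥ fun i => (z i : ℝ))

/-- The Epstein zeta value `∑_{z ≠ 0} |M z|^{-2p}` of the lattice `M ℤ^d`. -/
noncomputable def epstein {d : ℕ} (p : ℕ) (M : Matrix (Fin d) (Fin d) ℝ) : ℝ :=
  ∑' z : {z : Fin d → ℤ // z ≠ 0}, (sqLen M z)⁻¹ ^ p

/-- `M ℤ^d` is a full-rank lattice with nonzero vectors of length at least one and convergent
Epstein zeta series at `p`. -/
structure IsAdmissible {d : ℕ} (p : ℕ) (M : Matrix (Fin d) (Fin d) ℝ) : Prop where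
  det_ne_zero : M.det ≠ 0
  one_le : ∀ z : {z : Fin d → ℤ // z ≠ 0}, 1 ≤ sqLen M z
  summable : Summable fun z : {z : Fin d → ℤ // z ≠ 0} => (sqLen M z)⁻¹ ^ p

namespace IsAdmissible

variable {d p : ℕ} {M : Matrix (Fin d) (Fin d) ℝ}

theorem sqLen_pos (h : IsAdmissible p M) (z : {z : Fin d → ℤ // z ≠ 0}) : 0 < sqLen M z :=
  one_pos.trans_le (h.one_le z)

theorem mulVec_ne_zero (h : IsAdmissible p M) (z : {z : Fin d → ℤ // z ≠ 0}) :
    (M *ᵥ fun i => ((z : Fin d → ℤ) i : ℝ)) ≠ 0 := by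
  intro h0
  have := h.sqLen_pos z
  simp [sqLen, h0] at this

theorem le_epstein (h : IsAdmissible p M) (z : {z : Fin d → ℤ // z ≠ 0}) :
    (sqLen M z)⁻¹ ^ p ≤ epstein p M :=
  h.summable.le_tsum z fun z' _ => pow_nonneg (inv_nonneg.2 (h.sqLen_pos z').le) _

theorem epstein_pos (h : IsAdmissible p M) (hd : 0 < d) : 0 < epstein p M := by
  have hz : (fun _ : Fin d => (1 : ℤ)) ≠ 0 := fun h0 => by
    have := congrFun h0 ⟨0, hd⟩
    simp at this
  exact (pow_pos (inv_pos.2 (h.sqLen_pos ⟨_, hz⟩)) p).trans_le (h.le_epstein _)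

theorem log_det_sq_smul_le (h : IsAdmissible p M) (hd : 0 < d) (hp : 0 < p) {D : ℝ}
    (hD : ∀ M' : Matrix (Fin d) (Fin d) ℝ, IsAdmissible p M' → D < Real.log (M'.det ^ 2)) :
    D < Real.log (M.det ^ 2) + d / p * Real.log (epstein p M) := by
  have hH := h.epstein_pos hd
  set H := epstein p M
  set s : ℝ := H ^ (1 / (2 * p : ℝ)) with hs
  have hs0 : 0 < s := Real.rpow_pos_of_pos hH _
  have hp' : (0 : ℝ) < p := by exact_mod_cast hp
  have hs2 : (s ^ 2) ^ p = H := by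
    rw [← pow_mul, hs, ← Real.rpow_natCast, ← Real.rpow_mul hH.le]
    push_cast
    rw [one_div_mul_cancel (by positivity), Real.rpow_one]
  have hlen : ∀ z, sqLen (s • M) z = s ^ 2 * sqLen M z := by
    intro z
    simp only [sqLen, smul_mulVec, dotProduct_smul, smul_dotProduct, smul_eq_mul]
    ring
  have hadm : IsAdmissible p (s • M) := by
    refine ⟨?_, fun z => ?_, ?_⟩
    · rw [det_smul]
      exact mul_ne_zero (pow_ne_zero _ hs0.ne') h.det_ne_zero
    · rw [hlen]
      have h1 := h.le_epstein z
      have h2 := h.sqLen_pos z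
      have h3 : 1 ≤ (s ^ 2 * sqLen M z) ^ p := by
        rw [mul_pow, hs2]
        rw [inv_pow, inv_le_iff_one_le_mul₀ (by positivity)] at h1
        exact h1
      by_contra! hlt
      exact absurd h3 (not_le.2 (pow_lt_one₀ (by positivity) hlt hp.ne'))
    · simp only [hlen, mul_inv, mul_pow]
      exact h.summable.mul_left _
  have := hD _ hadm
  rw [det_smul, Fintype.card_fin, mul_pow, Real.log_mul (by positivity)
    (pow_ne_zero 2 h.det_ne_zero), ← pow_mul, Real.log_pow, hs, Real.log_rpow hH] at this
  have e : ((d * 2 : ℕ) : ℝ) * (1 / (2 * p) * Real.log H) = d / p * Real.log H := by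
    push_cast
    field_simp
  rw [e] at this
  linarith

theorem exists_perturb (h : IsAdmissible p M) {C : Matrix (Fin d) (Fin d) ℝ} (hsymm : Cᵀ = C)
    (hC : ∑ i, ∑ j, C i j ^ 2 = 1) {s t : ℝ} (hst : |s| ≤ t) (ht : t ≤ 1 / 2)
    {β : {z : Fin d → ℤ // z ≠ 0} → ℝ}
    (hβ : ∀ z : {z : Fin d → ℤ // z ≠ 0}, β z =
      ((M *ᵥ fun i => ((z : Fin d → ℤ) i : ℝ)) ⬝ᵥ C *ᵥ (M *ᵥ fun i => ((z : Fin d → ℤ) i : ℝ))) /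
        sqLen M z)
    (hK : ∀ z : {z : Fin d → ℤ // z ≠ 0}, β z = 0 ∨ 1 ≤ (1 - t) * sqLen M z) :
    0 < (1 + s • C).det ∧ ∃ M' : Matrix (Fin d) (Fin d) ℝ, IsAdmissible p M' ∧
      (∀ z : {z : Fin d → ℤ // z ≠ 0}, sqLen M' z = sqLen M z * (1 + s * β z)) ∧
      M'.det ^ 2 = (1 + s • C).det * M.det ^ 2 := by
  have hquad : ∀ x : Fin d → ℝ, x ⬝ᵥ (1 + s • C) *ᵥ x = x ⬝ᵥ x + s * (x ⬝ᵥ C *ᵥ x) := by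
    intro x
    rw [add_mulVec, one_mulVec, smul_mulVec, dotProduct_add, dotProduct_smul, smul_eq_mul]
  have hbd : ∀ x : Fin d → ℝ, |s * (x ⬝ᵥ C *ᵥ x)| ≤ t * (x ⬝ᵥ x) := fun x => by
    rw [abs_mul]
    exact mul_le_mul hst (abs_quadForm_le hC x) (abs_nonneg _) ((abs_nonneg _).trans hst)
  have hpd : (1 + s • C).PosDef := by
    refine PosDef.of_dotProduct_mulVec_pos ?_ fun x hx => ?_
    · rw [IsHermitian, conjTranspose_eq_transpose_of_trivial]
      simp [hsymm]
    · have hx0 : 0 < x ⬝ᵥ x := by simpa using dotProduct_star_self_pos_iff.2 hx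
      rw [star_trivial, hquad]
      have := (abs_le.1 (hbd x)).1
      nlinarith
  obtain ⟨N, hN⟩ := exists_transpose_mul_self hpd.posSemidef
  have hlen : ∀ z : {z : Fin d → ℤ // z ≠ 0}, sqLen (N * M) z = sqLen M z * (1 + s * β z) := by
    intro z
    have hz := (h.sqLen_pos z).ne'
    have : sqLen M z * (1 + s * β z) = sqLen M z + s * (sqLen M z * β z) := by ring
    rw [this, hβ z, mul_div_cancel₀ _ hz]
    unfold sqLen
    rw [← hquad, ← hN, ← mulVec_mulVec, ← mulVec_mulVec, dotProduct_mulVec,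
      dotProduct_mulVec _ Nᵀ, vecMul_transpose, ← dotProduct_mulVec]
  have hβ1 : ∀ z, |β z| ≤ 1 := fun z => by
    rw [hβ, abs_div, abs_of_pos (h.sqLen_pos z), div_le_one (h.sqLen_pos z)]
    exact abs_quadForm_le hC _
  have hsβ : ∀ z, -t ≤ s * β z := fun z => by
    refine (abs_le.1 ?_).1
    rw [abs_mul]
    exact (mul_le_of_le_one_right (abs_nonneg _) (hβ1 z)).trans hst
  have hdet : (N * M).det ^ 2 = (1 + s • C).det * M.det ^ 2 := by
    rw [← hN, det_mul, det_mul, det_transpose]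
    ring
  have hone : ∀ z : {z : Fin d → ℤ // z ≠ 0}, 1 ≤ sqLen (N * M) z := fun z => by
    rw [hlen]
    rcases hK z with h0 | h1
    · rw [h0, mul_zero, add_zero, mul_one]
      exact h.one_le z
    · have := hsβ z
      nlinarith [h.sqLen_pos z]
  refine ⟨hpd.det_pos, N * M, ⟨fun h0 => ?_, hone, ?_⟩, hlen, hdet⟩
  · rw [h0] at hdet
    have := mul_pos hpd.det_pos (pow_pos (abs_pos.2 h.det_ne_zero) 2)
    rw [sq_abs, ← hdet] at this
    simp at this
  · refine Summable.of_nonneg_of_le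
      (fun z => pow_nonneg (inv_nonneg.2 (one_pos.le.trans (hone z))) _)
      (fun z => ?_) (h.summable.mul_left (2 ^ p))
    rw [← mul_pow]
    refine pow_le_pow_left₀ (inv_nonneg.2 (one_pos.le.trans (hone z))) ?_ p
    have h1 : sqLen M z / 2 ≤ sqLen (N * M) z := by
      rw [hlen]
      have := hsβ z
      nlinarith [h.sqLen_pos z]
    calc (sqLen (N * M) z)⁻¹ ≤ (sqLen M z / 2)⁻¹ :=
          inv_anti₀ (half_pos (h.sqLen_pos z)) h1
      _ = _ := by rw [inv_div]; rfl

end IsAdmissible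

theorem inv_pow_add_inv_pow_le {p : ℕ} {x w : ℝ} (hx : x ^ 2 ≤ 1 / 2)
    (hw : (p ^ 2 + 4 * p : ℝ) * w ≤ 1 / 10) (hxw : x ^ 2 ≤ w) :
    (1 + x)⁻¹ ^ p + (1 - x)⁻¹ ^ p ≤ 2 + 21 / 20 * (p ^ 2 + 4 * p) * x ^ 2 := by
  have hx1 : 0 < 1 + x := by nlinarith
  have hx2 : 0 < 1 - x := by nlinarith
  have hprod : 0 < 1 - x ^ 2 := by nlinarith
  have hp0 : (0 : ℝ) ≤ p := Nat.cast_nonneg p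
  set v := x ^ 2 * ((p ^ 2 + 4 * p) / 2) with hv
  have hv0 : 0 ≤ v := by positivity
  have hv1 : v ≤ 1 / 20 := by
    nlinarith [mul_le_mul_of_nonneg_left hxw (by positivity : (0 : ℝ) ≤ p ^ 2 + 4 * p)]
  have hnum : (1 - x) ^ p + (1 + x) ^ p ≤ 2 * Real.exp (p ^ 2 * x ^ 2 / 2) := by
    have h1 : (1 - x) ^ p ≤ Real.exp (-(p * x)) := by
      have := pow_le_pow_left₀ hx2.le (Real.one_sub_le_exp_neg x) p
      rwa [← Real.exp_nat_mul, mul_neg] at this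
    have h2 : (1 + x) ^ p ≤ Real.exp (p * x) := by
      have := pow_le_pow_left₀ hx1.le (add_comm x 1 ▸ Real.add_one_le_exp x) p
      rwa [← Real.exp_nat_mul] at this
    have h3 := Real.cosh_le_exp_half_sq (p * x)
    rw [Real.cosh_eq, mul_pow] at h3
    linarith
  have hden : (1 - x ^ 2)⁻¹ ^ p ≤ Real.exp (2 * p * x ^ 2) := by
    have h1 : (1 - x ^ 2)⁻¹ ≤ Real.exp (2 * x ^ 2) := by
      rw [inv_le_comm₀ hprod (Real.exp_pos _), ← Real.exp_neg]
      have h4 : Real.exp (-(2 * x ^ 2)) ≤ (1 + 2 * x ^ 2)⁻¹ := by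
        rw [Real.exp_neg]
        exact inv_anti₀ (by positivity) (by linarith [Real.add_one_le_exp (2 * x ^ 2)])
      refine h4.trans ?_
      rw [inv_le_iff_one_le_mul₀ (by positivity)]
      nlinarith [sq_nonneg x]
    have := pow_le_pow_left₀ (inv_nonneg.2 hprod.le) h1 p
    rw [← Real.exp_nat_mul] at this
    refine this.trans_eq ?_
    congr 1
    ring
  calc (1 + x)⁻¹ ^ p + (1 - x)⁻¹ ^ p
        = ((1 - x) ^ p + (1 + x) ^ p) * (1 - x ^ 2)⁻¹ ^ p := by
        have e : 1 - x ^ 2 = (1 + x) * (1 - x) := by ring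
        have i₁ : (1 + x) ^ p * (1 + x)⁻¹ ^ p = 1 := by
          rw [← mul_pow, mul_inv_cancel₀ hx1.ne', one_pow]
        have i₂ : (1 - x) ^ p * (1 - x)⁻¹ ^ p = 1 := by
          rw [← mul_pow, mul_inv_cancel₀ hx2.ne', one_pow]
        rw [e, mul_inv, mul_pow]
        linear_combination -(1 + x)⁻¹ ^ p * i₂ - (1 - x)⁻¹ ^ p * i₁
    _ ≤ (2 * Real.exp (p ^ 2 * x ^ 2 / 2)) * Real.exp (2 * p * x ^ 2) :=
        mul_le_mul hnum hden (by positivity) (by positivity)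
    _ = 2 * Real.exp v := by
        rw [mul_assoc, ← Real.exp_add, hv]
        congr 2
        ring
    _ ≤ 2 + 21 / 20 * (p ^ 2 + 4 * p) * x ^ 2 := by
        have := (abs_le.1 (Real.abs_exp_sub_one_sub_id_le (x := v)
          (by rw [abs_of_nonneg hv0]; linarith))).2
        nlinarith

/-- The functional decreased by the descent. -/
noncomputable def descentFun {d : ℕ} (p : ℕ) (l : ℝ) (M : Matrix (Fin d) (Fin d) ℝ) : ℝ :=
  Real.log (M.det ^ 2) + l * Real.log (epstein p M)

namespace IsAdmissible

variable {d p : ℕ} {M : Matrix (Fin d) (Fin d) ℝ}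

theorem exists_descentFun_le (h : IsAdmissible p M) (hd : 0 < d) {m : ℕ} (hm : 0 < m) {l t : ℝ}
    (hl : 0 ≤ l) (ht : 0 < t) (ht2 : t ≤ 1 / 2) (hpt : (p ^ 2 + 4 * p : ℝ) * t ^ 2 ≤ 1 / 10)
    (K : Finset {z : Fin d → ℤ // z ≠ 0}) (hK : ∀ z, z ∈ K ∨ 1 ≤ (1 - t) * sqLen M z)
    (hcard : m + K.card + d * (d - 1) / 2 ≤ d * d) :
    ∃ M' : Matrix (Fin d) (Fin d) ℝ, IsAdmissible p M' ∧ descentFun p l M' ≤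
      descentFun p l M - t ^ 2 * (1 - l * (21 / 20 * (p ^ 2 + 4 * p)) / m) / 2 := by
  have hw0 : ∀ z : {z : Fin d → ℤ // z ≠ 0}, 0 ≤ (sqLen M z)⁻¹ ^ p := fun z =>
    pow_nonneg (inv_nonneg.2 (h.sqLen_pos z).le) p
  obtain ⟨C, hsymm, hC, hCK, hCsum⟩ := exists_symm_direction
    (fun z : {z : Fin d → ℤ // z ≠ 0} => M *ᵥ fun i => ((z : Fin d → ℤ) i : ℝ)) h.mulVec_ne_zero
    (fun z => (sqLen M z)⁻¹ ^ p) hw0 h.summable K hm hcard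
  set β : {z : Fin d → ℤ // z ≠ 0} → ℝ := fun z =>
      ((M *ᵥ fun i => ((z : Fin d → ℤ) i : ℝ)) ⬝ᵥ C *ᵥ (M *ᵥ fun i => ((z : Fin d → ℤ) i : ℝ))) /
        sqLen M z with hβ
  have hβK : ∀ z, β z = 0 ∨ 1 ≤ (1 - t) * sqLen M z := fun z => (hK z).imp_left fun hz => by
    simp only [hβ]
    rw [hCK z hz, zero_div]
  have hβ1 : ∀ z, β z ^ 2 ≤ 1 := fun z => by
    rw [sq_le_one_iff_abs_le_one, hβ, abs_div, abs_of_pos (h.sqLen_pos z),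
      div_le_one (h.sqLen_pos z)]
    exact abs_quadForm_le hC _
  change ∑' z : {z : Fin d → ℤ // z ≠ 0}, (sqLen M z)⁻¹ ^ p * β z ^ 2 ≤ epstein p M / m at hCsum
  obtain ⟨hpos₁, M₁, h₁, hlen₁, hdet₁⟩ := h.exists_perturb hsymm hC (β := β) (s := t)
    (abs_of_pos ht).le ht2
    (fun _ => rfl) hβK
  obtain ⟨hpos₂, M₂, h₂, hlen₂, hdet₂⟩ := h.exists_perturb hsymm hC (β := β) (s := -t)
    (by rw [abs_neg, abs_of_pos ht]) ht2 (fun _ => rfl) hβK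
  set Q : ℝ := 21 / 20 * (p ^ 2 + 4 * p) with hQ
  have hQ0 : 0 ≤ Q := by positivity
  have hH := h.epstein_pos hd
  have hH₁ := h₁.epstein_pos hd
  have hH₂ := h₂.epstein_pos hd
  have hβsum : Summable fun z : {z : Fin d → ℤ // z ≠ 0} => (sqLen M z)⁻¹ ^ p * β z ^ 2 :=
    Summable.of_nonneg_of_le (fun z => mul_nonneg (hw0 z) (sq_nonneg _))
      (fun z => mul_le_of_le_one_right (hw0 z) (hβ1 z)) h.summable
  have hHsum : epstein p M₁ + epstein p M₂ ≤ 2 * epstein p M + Q * t ^ 2 * (epstein p M / m) := by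
    calc epstein p M₁ + epstein p M₂
        = ∑' z : {z : Fin d → ℤ // z ≠ 0}, ((sqLen M₁ z)⁻¹ ^ p + (sqLen M₂ z)⁻¹ ^ p) :=
          (h₁.summable.tsum_add h₂.summable).symm
      _ ≤ ∑' z : {z : Fin d → ℤ // z ≠ 0},
          (2 * (sqLen M z)⁻¹ ^ p + Q * t ^ 2 * ((sqLen M z)⁻¹ ^ p * β z ^ 2)) := by
          refine Summable.tsum_le_tsum (fun z => ?_) (h₁.summable.add h₂.summable)
            ((h.summable.mul_left _).add (hβsum.mul_left _))
          have hx : (t * β z) ^ 2 ≤ t ^ 2 := by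
            rw [mul_pow]
            exact mul_le_of_le_one_right (sq_nonneg _) (hβ1 z)
          have := inv_pow_add_inv_pow_le (p := p) (x := t * β z) (w := t ^ 2) (by nlinarith) hpt hx
          rw [hlen₁, hlen₂, mul_inv, mul_inv, mul_pow, mul_pow, ← mul_add, neg_mul,
            ← sub_eq_add_neg]
          calc _ ≤ (sqLen M z)⁻¹ ^ p * (2 + Q * (t * β z) ^ 2) :=
                mul_le_mul_of_nonneg_left this (hw0 z)
            _ = _ := by ring
      _ = 2 * epstein p M +
          Q * t ^ 2 * ∑' z : {z : Fin d → ℤ // z ≠ 0}, (sqLen M z)⁻¹ ^ p * β z ^ 2 := by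
          rw [(h.summable.mul_left 2).tsum_add (hβsum.mul_left _), tsum_mul_left, tsum_mul_left]
          rfl
      _ ≤ _ := by gcongr
  have hlog : Real.log (epstein p M₁) + Real.log (epstein p M₂) ≤
      2 * Real.log (epstein p M) + Q * t ^ 2 / m := by
    have l₁ := Real.log_le_sub_one_of_pos (div_pos hH₁ hH)
    have l₂ := Real.log_le_sub_one_of_pos (div_pos hH₂ hH)
    rw [Real.log_div hH₁.ne' hH.ne'] at l₁
    rw [Real.log_div hH₂.ne' hH.ne'] at l₂
    have : epstein p M₁ / epstein p M + epstein p M₂ / epstein p M ≤ 2 + Q * t ^ 2 / m := by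
      rw [← add_div, div_le_iff₀ hH]
      refine hHsum.trans_eq ?_
      ring
    linarith
  have hdet : Real.log (M₁.det ^ 2) + Real.log (M₂.det ^ 2) ≤
      2 * Real.log (M.det ^ 2) - t ^ 2 := by
    have hM : M.det ^ 2 ≠ 0 := pow_ne_zero 2 h.det_ne_zero
    have h3 := det_one_add_mul_det_one_sub_le hsymm hC (t := t) (by nlinarith)
    have e : (1 : Matrix (Fin d) (Fin d) ℝ) - t • C = 1 + (-t) • C := by
      rw [neg_smul, sub_eq_add_neg]
    rw [e] at h3
    have h4 := Real.log_le_log (mul_pos hpos₁ hpos₂) h3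
    rw [Real.log_exp, Real.log_mul hpos₁.ne' hpos₂.ne'] at h4
    rw [hdet₁, hdet₂, Real.log_mul hpos₁.ne' hM, Real.log_mul hpos₂.ne' hM]
    linarith
  have hfin : descentFun p l M₁ + descentFun p l M₂ ≤
      2 * (descentFun p l M - t ^ 2 * (1 - l * Q / m) / 2) := by
    have := mul_le_mul_of_nonneg_left hlog hl
    have e : t ^ 2 * (1 - l * Q / m) = t ^ 2 - l * (Q * t ^ 2 / m) := by ring
    unfold descentFun
    rw [mul_sub, mul_div_cancel₀ _ two_ne_zero, e]
    linarith
  by_cases hc : descentFun p l M₁ ≤ descentFun p l M - t ^ 2 * (1 - l * Q / m) / 2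
  · exact ⟨M₁, h₁, hc⟩
  · exact ⟨M₂, h₂, by linarith⟩

/-- Starting from a lattice with Epstein zeta value at most one, the determinant can be lowered by
a power of the number `k` of constraints. -/
theorem exists_log_det_sq_le (h : IsAdmissible p M) (hd : 0 < d) (hp : 0 < p)
    (hM : epstein p M ≤ 1) {m k : ℕ} (hm : 0 < m) (hk : 0 < k)
    (hcard : m + k + d * (d - 1) / 2 ≤ d * d)
    {l : ℝ} (hl : 0 ≤ l) (hlp : l * p ≤ d) (hlm : l * (21 / 20 * (p ^ 2 + 4 * p)) < m) :
    ∃ M' : Matrix (Fin d) (Fin d) ℝ, IsAdmissible p M' ∧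
      Real.log (M'.det ^ 2) ≤ Real.log (M.det ^ 2) - l * Real.log (k / 2) := by
  by_contra! hD
  set D := Real.log (M.det ^ 2) - l * Real.log (k / 2) with hDdef
  have hp1 : (1 : ℝ) ≤ p := by exact_mod_cast hp
  have hm' : (0 : ℝ) < m := by exact_mod_cast hm
  have hk' : (0 : ℝ) < k := by exact_mod_cast hk
  set t : ℝ := 1 / (10 * p) with htdef
  have ht : 0 < t := by positivity
  have hpt : p * t = 1 / 10 := by rw [htdef]; field_simp
  have ht2 : t ≤ 1 / 10 := by nlinarith
  set c : ℝ := t ^ 2 * (1 - l * (21 / 20 * (p ^ 2 + 4 * p)) / m) / 2 with hc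
  have hc0 : 0 < c := by
    have : l * (21 / 20 * (p ^ 2 + 4 * p)) / m < 1 := (div_lt_one hm').2 hlm
    have : 0 < 1 - l * (21 / 20 * (p ^ 2 + 4 * p)) / m := by linarith
    positivity
  have hbelow : ∀ M' : Matrix (Fin d) (Fin d) ℝ, IsAdmissible p M' → D < descentFun p l M' := by
    intro M' h'
    have h1 := hD M' h'
    have h2 := h'.log_det_sq_smul_le hd hp hD
    have hd' : (0 : ℝ) < d := by exact_mod_cast hd
    have hθ0 : 0 ≤ l * p / d := by positivity
    have hθ1 : l * p / d ≤ 1 := (div_le_one hd').2 hlp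
    have e : descentFun p l M' = (1 - l * p / d) * Real.log (M'.det ^ 2) +
        l * p / d * (Real.log (M'.det ^ 2) + d / p * Real.log (epstein p M')) := by
      unfold descentFun
      field_simp
      ring
    rw [e]
    rcases hθ0.eq_or_lt with h0 | h0
    · rw [← h0]
      linarith
    · nlinarith [mul_lt_mul_of_pos_left h2 h0, mul_le_mul_of_nonneg_left h1.le (sub_nonneg.2 hθ1)]
  have hstart : descentFun p l M ≤ Real.log (M.det ^ 2) := by
    have := mul_nonpos_of_nonneg_of_nonpos hl (Real.log_nonpos (h.epstein_pos hd).le hM)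
    unfold descentFun
    linarith
  have hiter : ∀ n : ℕ, ∃ M' : Matrix (Fin d) (Fin d) ℝ, IsAdmissible p M' ∧
      descentFun p l M' ≤ descentFun p l M - n * c := by
    intro n
    induction n with
    | zero => exact ⟨M, h, by simp⟩
    | succ n ih =>
      obtain ⟨M', h', hle⟩ := ih
      have hbig : ∀ z : {z : Fin d → ℤ // z ≠ 0}, (1 - t) * sqLen M' z < 1 →
          1 / 2 ≤ (sqLen M' z)⁻¹ ^ p := by
        intro z hz
        have hpos := h'.sqLen_pos z
        have h1 : 1 - t ≤ (sqLen M' z)⁻¹ := by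
          rw [le_inv_comm₀ (by linarith) hpos, ← one_div, le_div_iff₀ (by linarith), mul_comm]
          exact hz.le
        refine le_trans ?_ (pow_le_pow_left₀ (by linarith) h1 p)
        have := one_add_mul_le_pow (a := -t) (by linarith) p
        rw [← sub_eq_add_neg] at this
        linarith
      have hfin : {z : {z : Fin d → ℤ // z ≠ 0} | (1 - t) * sqLen M' z < 1}.Finite := by
        have := h'.summable.tendsto_cofinite_zero.eventually (gt_mem_nhds (half_pos one_pos))
        rw [Filter.eventually_cofinite] at this
        exact this.subset fun z hz => not_lt.2 (hbig z hz)
      have hcardle : hfin.toFinset.card ≤ k := by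
        by_contra! hlt
        have h1 : (k / 2 : ℝ) ≤ epstein p M' := by
          have h2 := h'.summable.sum_le_tsum hfin.toFinset
            (fun z _ => pow_nonneg (inv_nonneg.2 (h'.sqLen_pos z).le) p)
          have h3 := Finset.card_nsmul_le_sum hfin.toFinset (fun z => (sqLen M' z)⁻¹ ^ p) (1 / 2)
            (fun z hz => hbig z (by simpa using hz))
          rw [nsmul_eq_mul] at h3
          have h4 : (k : ℝ) ≤ hfin.toFinset.card := by exact_mod_cast hlt.le
          have h5 : ∑ z ∈ hfin.toFinset, (sqLen M' z)⁻¹ ^ p ≤ epstein p M' := h2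
          linarith
        have h6 := mul_le_mul_of_nonneg_left (Real.log_le_log (by positivity) h1) hl
        have h7 := hD M' h'
        have h8 : 0 ≤ n * c := by positivity
        have h9 : Real.log (M'.det ^ 2) + l * Real.log (epstein p M') ≤ _ := hle
        linarith
      obtain ⟨M'', h'', hle'⟩ := h'.exists_descentFun_le hd hm hl ht (by linarith)
        (by nlinarith) hfin.toFinset (fun z => by
          by_cases hz : (1 - t) * sqLen M' z < 1
          · exact Or.inl (by simpa using hz)
          · exact Or.inr (not_lt.1 hz)) (by omega)
      refine ⟨M'', h'', hle'.trans ?_⟩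
      push_cast
      linarith
  obtain ⟨n, hn⟩ := exists_nat_gt ((descentFun p l M - D) / c)
  rw [div_lt_iff₀ hc0] at hn
  obtain ⟨M', h', hle⟩ := hiter n
  have := hbelow M' h'
  linarith

end IsAdmissible

/-- The radial profile `min(1, a^{-2p})`. -/
noncomputable def radialProfile (p : ℕ) (a : ℝ) : ℝ := (max 1 a)⁻¹ ^ (2 * p)

theorem radialProfile_nonneg (p : ℕ) (a : ℝ) : 0 ≤ radialProfile p a :=
  pow_nonneg (inv_nonneg.2 (zero_le_one.trans (le_max_left 1 a))) _

theorem radialProfile_le_of_le_add {p : ℕ} {a b η : ℝ} (hη : 0 ≤ η) (hη1 : η < 1)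
    (h : b ≤ a + η) :
    radialProfile p a ≤ (1 - η)⁻¹ ^ (2 * p) * radialProfile p b := by
  unfold radialProfile
  rw [← mul_pow, ← mul_inv]
  have hb : 0 < (1 - η) * max 1 b := mul_pos (by linarith) (one_pos.trans_le (le_max_left 1 b))
  refine pow_le_pow_left₀ (inv_nonneg.2 (zero_le_one.trans (le_max_left 1 a))) (inv_anti₀ hb ?_) _
  rcases le_total b 1 with h1 | h1
  · rw [max_eq_left h1, mul_one]
    exact le_trans (by linarith) (le_max_left 1 a)
  · rw [max_eq_right h1]
    exact le_trans (by nlinarith) (le_max_right 1 a)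

theorem radialProfile_mul_le {p : ℕ} {a s R : ℝ} (ha : 1 ≤ a) (hs1 : s ≤ 1) (hR : 0 < R) :
    radialProfile p (R * a) ≤ R⁻¹ ^ (2 * p) * radialProfile p (s * a) := by
  unfold radialProfile
  rw [← mul_pow, ← mul_inv]
  refine pow_le_pow_left₀ (inv_nonneg.2 (zero_le_one.trans (le_max_left _ _))) ?_ _
  refine inv_anti₀ (mul_pos hR (one_pos.trans_le (le_max_left _ _))) ?_
  refine le_trans ?_ (le_max_right _ _)
  exact mul_le_mul_of_nonneg_left (max_le ha (by nlinarith)) hR.le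

theorem integral_Ioi_radialProfile {d p : ℕ} (hd : 0 < d) (hp : d < 2 * p) :
    IntegrableOn (fun y : ℝ => y ^ (d - 1) • radialProfile p y) (Set.Ioi 0) ∧
    ∫ y in Set.Ioi (0 : ℝ), y ^ (d - 1) • radialProfile p y = 1 / d + 1 / (2 * p - d) := by
  have hd' : (1 : ℝ) ≤ d := by exact_mod_cast hd
  have hp' : (d : ℝ) < 2 * p := by exact_mod_cast hp
  have hsmall : Set.EqOn (fun y : ℝ => y ^ (d - 1)) (fun y : ℝ => y ^ (d - 1) • radialProfile p y)
      (Set.Ioc 0 1) := by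
    intro y hy
    simp [radialProfile, max_eq_left hy.2]
  have hlarge : Set.EqOn (fun y : ℝ => y ^ ((d : ℝ) - 1 - 2 * p))
      (fun y : ℝ => y ^ (d - 1) • radialProfile p y) (Set.Ioi 1) := by
    intro y hy
    have hy1 : (1 : ℝ) < y := hy
    have hy0 : 0 < y := one_pos.trans hy1
    simp only [radialProfile, max_eq_right hy1.le, smul_eq_mul]
    rw [Real.rpow_sub hy0, inv_pow, ← div_eq_mul_inv, ← Real.rpow_natCast, ← Real.rpow_natCast,
      Nat.cast_sub hd]
    push_cast
    rfl
  have hexp : (d : ℝ) - 1 - 2 * p < -1 := by linarith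
  have i₁ : IntegrableOn (fun y : ℝ => y ^ (d - 1) • radialProfile p y) (Set.Ioc 0 1) :=
    ((continuous_pow (d - 1)).integrableOn_Ioc).congr_fun hsmall measurableSet_Ioc
  have i₂ : IntegrableOn (fun y : ℝ => y ^ (d - 1) • radialProfile p y) (Set.Ioi 1) :=
    (integrableOn_Ioi_rpow_of_lt hexp one_pos).congr_fun hlarge measurableSet_Ioi
  have hunion : Set.Ioi (0 : ℝ) = Set.Ioc 0 1 ∪ Set.Ioi 1 :=
    (Set.Ioc_union_Ioi_eq_Ioi zero_le_one).symm
  rw [hunion]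
  refine ⟨i₁.union i₂, ?_⟩
  rw [setIntegral_union (Set.Ioc_disjoint_Ioi le_rfl) measurableSet_Ioi i₁ i₂,
    ← setIntegral_congr_fun measurableSet_Ioc hsmall,
    ← setIntegral_congr_fun measurableSet_Ioi hlarge, integral_Ioi_rpow_of_lt hexp one_pos,
    ← intervalIntegral.integral_of_le zero_le_one, integral_pow, Real.one_rpow]
  have e : ((d - 1 : ℕ) : ℝ) + 1 = d := by rw [Nat.cast_sub hd]; push_cast; ring
  rw [e, one_pow, zero_pow (by omega), sub_zero]
  have e2 : (d : ℝ) - 1 - 2 * p + 1 = -(2 * p - d) := by ring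
  rw [e2, neg_div_neg_eq]

theorem lintegral_radialProfile {d p : ℕ} (hd : 0 < d) (hp : d < 2 * p) {s : ℝ} (hs : 0 < s) :
    ∫⁻ w : EuclideanSpace ℝ (Fin d), ENNReal.ofReal (radialProfile p (s * ‖w‖)) =
      ENNReal.ofReal ((s ^ d)⁻¹ *
        (volume.real (Metric.ball (0 : EuclideanSpace ℝ (Fin d)) 1) * (1 + d / (2 * p - d)))) := by
  have : Nonempty (Fin d) := ⟨⟨0, hd⟩⟩
  obtain ⟨hi, hv⟩ := integral_Ioi_radialProfile hd hp
  have hfin : Module.finrank ℝ (EuclideanSpace ℝ (Fin d)) = d := by simp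
  have hradial : Integrable (fun w : EuclideanSpace ℝ (Fin d) => radialProfile p ‖w‖) := by
    rw [integrable_fun_norm_addHaar (volume : Measure (EuclideanSpace ℝ (Fin d))), hfin]
    exact hi
  have hscaled : Integrable (fun w : EuclideanSpace ℝ (Fin d) => radialProfile p (s * ‖w‖)) := by
    have := hradial.comp_smul hs.ne'
    simpa only [norm_smul, Real.norm_eq_abs, abs_of_pos hs] using this
  rw [← ofReal_integral_eq_lintegral_ofReal hscaled
    (Filter.Eventually.of_forall fun w => radialProfile_nonneg _ _)]
  congr 1
  have h1 := Measure.integral_comp_smul (volume : Measure (EuclideanSpace ℝ (Fin d)))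
    (fun w => radialProfile p ‖w‖) s
  simp only [norm_smul, Real.norm_eq_abs, abs_of_pos hs] at h1
  rw [h1, integral_fun_norm_addHaar (volume : Measure (EuclideanSpace ℝ (Fin d))), hfin, hv,
    abs_of_pos (by positivity)]
  have hd' : (d : ℝ) ≠ 0 := by positivity
  simp only [nsmul_eq_mul, smul_eq_mul]
  field_simp

/-- The point of `ℝ^d` with integer coordinates `z`. -/
noncomputable def intPoint {d : ℕ} (z : Fin d → ℤ) : EuclideanSpace ℝ (Fin d) :=
  WithLp.toLp 2 fun i => (z i : ℝ)

theorem volume_floor_cell {d : ℕ} (x : Fin d → ℤ) :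
    volume {w : EuclideanSpace ℝ (Fin d) | ∀ i, ⌊w i⌋ = x i} = 1 := by
  have h : {w : EuclideanSpace ℝ (Fin d) | ∀ i, ⌊w i⌋ = x i} =
      (MeasurableEquiv.toLp 2 (Fin d → ℝ)).symm ⁻¹'
        Set.univ.pi fun i => Set.Ico (x i : ℝ) (x i + 1) := by
    ext w
    simp [Int.floor_eq_iff]
  rw [h, (EuclideanSpace.volume_preserving_symm_measurableEquiv_toLp (Fin d)).measure_preimage
    (MeasurableSet.univ_pi fun i => measurableSet_Ico).nullMeasurableSet, volume_pi_pi]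
  simp

theorem tsum_radialProfile_le {d p : ℕ} (hd : 0 < d) (hp : d < 2 * p) {s η : ℝ} (hs : 0 < s)
    (hη1 : η < 1) (hsη : s * √d ≤ η) :
    ∑' x : Fin d → ℤ, ENNReal.ofReal (radialProfile p (s * ‖intPoint x‖)) ≤
      ENNReal.ofReal ((1 - η)⁻¹ ^ (2 * p) * ((s ^ d)⁻¹ *
        (volume.real (Metric.ball (0 : EuclideanSpace ℝ (Fin d)) 1) * (1 + d / (2 * p - d))))) := by
  have hη : 0 ≤ η := le_trans (by positivity) hsη
  have hc : 0 ≤ (1 - η)⁻¹ ^ (2 * p) := pow_nonneg (inv_nonneg.2 (by linarith)) _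
  let cell : (Fin d → ℤ) → Set (EuclideanSpace ℝ (Fin d)) := fun x => {w | ∀ i, ⌊w i⌋ = x i}
  have hmeas : ∀ x, MeasurableSet (cell x) := fun x => by
    have : cell x = ⋂ i, (fun w : EuclideanSpace ℝ (Fin d) => ⌊w i⌋) ⁻¹' {x i} := by
      ext w
      simp [cell]
    rw [this]
    exact MeasurableSet.iInter fun i => (Int.measurable_floor.comp (by fun_prop))
      (measurableSet_singleton _)
  have hdisj : Pairwise (Function.onFun Disjoint cell) := fun x y hxy => by
    refine Set.disjoint_left.2 fun w hx hy => hxy ?_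
    ext i
    rw [← hx i, hy i]
  have hclose : ∀ x, ∀ w ∈ cell x, s * ‖w‖ ≤ s * ‖intPoint x‖ + η := by
    intro x w hw
    have h1 : ‖w - intPoint x‖ ≤ √d := by
      rw [EuclideanSpace.norm_eq]
      refine Real.sqrt_le_sqrt ?_
      calc ∑ i, ‖(w - intPoint x) i‖ ^ 2 ≤ ∑ _i : Fin d, (1 : ℝ) := by
            refine Finset.sum_le_sum fun i _ => ?_
            have h2 := Int.floor_le (w i)
            have h3 := Int.lt_floor_add_one (w i)
            rw [hw i] at h2 h3
            have : (w - intPoint x) i = w i - x i := rfl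
            rw [this, Real.norm_eq_abs, sq_abs]
            nlinarith
        _ = d := by simp
    have h2 : ‖w‖ ≤ ‖intPoint x‖ + ‖w - intPoint x‖ := by
      have := norm_add_le (intPoint x) (w - intPoint x)
      rwa [add_sub_cancel] at this
    nlinarith
  rw [ENNReal.ofReal_mul hc, ← lintegral_radialProfile hd hp hs,
    ← lintegral_const_mul' _ _ ENNReal.ofReal_ne_top]
  calc ∑' x : Fin d → ℤ, ENNReal.ofReal (radialProfile p (s * ‖intPoint x‖))
      = ∑' x : Fin d → ℤ, ∫⁻ _w in cell x, ENNReal.ofReal (radialProfile p (s * ‖intPoint x‖)) := by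
        refine tsum_congr fun x => ?_
        rw [setLIntegral_const, volume_floor_cell, mul_one]
    _ ≤ ∑' x : Fin d → ℤ, ∫⁻ w in cell x, ENNReal.ofReal ((1 - η)⁻¹ ^ (2 * p)) *
          ENNReal.ofReal (radialProfile p (s * ‖w‖)) := by
        refine ENNReal.tsum_le_tsum fun x => setLIntegral_mono' (hmeas x) fun w hw => ?_
        rw [← ENNReal.ofReal_mul hc]
        exact ENNReal.ofReal_le_ofReal (radialProfile_le_of_le_add hη hη1 (hclose x w hw))
    _ = ∫⁻ w in ⋃ x, cell x, ENNReal.ofReal ((1 - η)⁻¹ ^ (2 * p)) *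
          ENNReal.ofReal (radialProfile p (s * ‖w‖)) := (lintegral_iUnion hmeas hdisj _).symm
    _ ≤ _ := setLIntegral_le_lintegral _ _

/-- Coordinates in `ℤ^(e+1)` of the points of the lattice generated by `(1, a)` and
`q e_2, …, q e_d`. -/
def shearMap {e : ℕ} (q : ℕ) (a : Fin e → Fin q) (z : Fin (e + 1) → ℤ) : Fin (e + 1) → ℤ :=
  Fin.cons (z 0) fun j => (a j : ℤ) * z 0 + q * z j.succ

/-- The matrix of `shearMap`. -/
def shearMatrix {e : ℕ} (q : ℕ) (a : Fin e → Fin q) : Matrix (Fin (e + 1)) (Fin (e + 1)) ℝ :=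
  Matrix.of fun i j => (Fin.cons (Pi.single 0 1)
    (fun i => Fin.cons ((a i : ℕ) : ℝ) (Pi.single i (q : ℝ))) :
      Fin (e + 1) → Fin (e + 1) → ℝ) i j

theorem shearMatrix_mulVec {e q : ℕ} (a : Fin e → Fin q) (z : Fin (e + 1) → ℤ) :
    (shearMatrix q a *ᵥ fun i => (z i : ℝ)) = fun i => (shearMap q a z i : ℝ) := by
  ext i
  refine Fin.cases ?_ (fun i => ?_) i
  · simp [shearMatrix, shearMap, mulVec, dotProduct, Pi.single_apply]
  · simp [shearMatrix, shearMap, mulVec, dotProduct, Fin.sum_univ_succ, Pi.single_apply]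

theorem det_shearMatrix {e q : ℕ} (a : Fin e → Fin q) : (shearMatrix q a).det = (q : ℝ) ^ e := by
  rw [det_of_isLowerTriangular]
  · simp [shearMatrix, Fin.prod_univ_succ]
  · intro i j hij
    have hij : i < j := hij
    revert hij
    refine Fin.cases (fun hij => ?_) (fun i hij => ?_) i
    · simp [shearMatrix, hij.ne']
    · obtain ⟨j, rfl⟩ := Fin.exists_succ_eq.2 (Fin.ne_zero_of_lt hij)
      have : j ≠ i := (Fin.succ_lt_succ_iff.1 hij).ne'
      simp [shearMatrix, this]

theorem shearMap_injective {e q : ℕ} (hq : 0 < q) (a : Fin e → Fin q) :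
    Function.Injective (shearMap q a) := by
  intro z z' h
  have h0 : z 0 = z' 0 := congrFun h 0
  ext i
  refine Fin.cases h0 (fun j => ?_) i
  have hj : (a j : ℤ) * z 0 + q * z j.succ = (a j : ℤ) * z' 0 + q * z' j.succ := congrFun h j.succ
  rw [h0, add_right_inj] at hj
  exact mul_left_cancel₀ (by exact_mod_cast hq.ne') hj

theorem shearMap_injOn {e q : ℕ} (hq : q.Prime) {a a' : Fin e → Fin q} {z z' : Fin (e + 1) → ℤ}
    (hz : ¬ (q : ℤ) ∣ z 0) (h : shearMap q a z = shearMap q a' z') : a = a' ∧ z = z' := by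
  have h0 : z 0 = z' 0 := congrFun h 0
  have ha : a = a' := by
    ext j
    have hj : (a j : ℤ) * z 0 + q * z j.succ = (a' j : ℤ) * z' 0 + q * z' j.succ :=
      congrFun h j.succ
    rw [← h0] at hj
    have hdvd : (q : ℤ) ∣ ((a j : ℤ) - a' j) * z 0 := ⟨z' j.succ - z j.succ, by linarith⟩
    have h1 := ((Nat.prime_iff_prime_int.1 hq).dvd_or_dvd hdvd).resolve_right hz
    have h2 := Int.eq_zero_of_abs_lt_dvd h1 (by
      have := (a j).2
      have := (a' j).2
      rw [abs_lt]
      omega)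
    omega
  exact ⟨ha, by subst ha; exact shearMap_injective hq.pos a h⟩

theorem sum_tsum_shearMap_le {e q : ℕ} (hq : q.Prime) (F : (Fin (e + 1) → ℤ) → ENNReal) :
    ∑ a : Fin e → Fin q, ∑' z : {z : Fin (e + 1) → ℤ // z ≠ 0}, F (shearMap q a z) ≤
      ∑' x, F x + q ^ e * ∑' y : {y : Fin (e + 1) → ℤ // y ≠ 0}, F ((q : ℤ) • (y : _ → ℤ)) := by
  classical
  have hq0 : (q : ℤ) ≠ 0 := by exact_mod_cast hq.ne_zero
  let P : Set {z : Fin (e + 1) → ℤ // z ≠ 0} := {z | (q : ℤ) ∣ z.1 0}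
  have hsplit : ∀ a : Fin e → Fin q,
      ∑' z : {z : Fin (e + 1) → ℤ // z ≠ 0}, F (shearMap q a z) =
        ∑' z : P, F (shearMap q a z) + ∑' z : ↥Pᶜ, F (shearMap q a z) := fun a =>
    (ENNReal.summable.tsum_add_tsum_compl (s := P) ENNReal.summable).symm
  have hP : ∀ a : Fin e → Fin q, ∑' z : P, F (shearMap q a z) ≤
      ∑' y : {y : Fin (e + 1) → ℤ // y ≠ 0}, F ((q : ℤ) • (y : _ → ℤ)) := by
    intro a
    have hdvd : ∀ z : P, ∃ y : {y : Fin (e + 1) → ℤ // y ≠ 0},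
        shearMap q a z = (q : ℤ) • (y : _ → ℤ) := by
      rintro ⟨⟨z, hz⟩, k, hk⟩
      have hk : z 0 = q * k := hk
      obtain ⟨y, hy⟩ : ∃ y : Fin (e + 1) → ℤ, shearMap q a z = (q : ℤ) • y := by
        refine ⟨Fin.cons k fun j => (a j : ℤ) * k + z j.succ, ?_⟩
        ext i
        refine Fin.cases ?_ (fun j => ?_) i
        · simp [shearMap, hk]
        · simp [shearMap, hk]
          ring
      refine ⟨⟨y, fun h0 => hz ?_⟩, hy⟩
      rw [h0, smul_zero] at hy
      refine shearMap_injective hq.pos a (hy.trans ?_)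
      ext i
      refine Fin.cases ?_ (fun j => ?_) i <;> simp [shearMap]
    choose f hf using hdvd
    have hinj : Function.Injective f := fun z z' h => by
      have : shearMap q a z = shearMap q a z' := by rw [hf, hf, h]
      exact Subtype.ext (Subtype.ext (shearMap_injective hq.pos a this))
    simp only [hf]
    exact ENNReal.tsum_comp_le_tsum_of_injective hinj
      fun y : {y : Fin (e + 1) → ℤ // y ≠ 0} => F ((q : ℤ) • (y : _ → ℤ))
  have hPc : ∑ a : Fin e → Fin q, ∑' z : ↥Pᶜ, F (shearMap q a z) ≤ ∑' x, F x := by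
    rw [← tsum_fintype (L := .unconditional _), ← ENNReal.tsum_prod
      (f := fun (a : Fin e → Fin q) (z : ↥Pᶜ) => F (shearMap q a z))]
    refine ENNReal.tsum_comp_le_tsum_of_injective
      (f := fun x : (Fin e → Fin q) × ↥Pᶜ => shearMap q x.1 x.2) ?_ F
    rintro ⟨a, z⟩ ⟨a', z'⟩ h
    obtain ⟨h1, h2⟩ := shearMap_injOn hq z.2 h
    exact Prod.ext h1 (Subtype.ext (Subtype.ext h2))
  calc _ = ∑ a : Fin e → Fin q, ∑' z : P, F (shearMap q a z) +
        ∑ a : Fin e → Fin q, ∑' z : ↥Pᶜ, F (shearMap q a z) := by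
        rw [← Finset.sum_add_distrib]
        exact Finset.sum_congr rfl fun a _ => hsplit a
    _ ≤ q ^ e * ∑' y : {y : Fin (e + 1) → ℤ // y ≠ 0}, F ((q : ℤ) • (y : _ → ℤ)) +
        ∑' x, F x := by
        refine add_le_add ((Finset.sum_le_sum fun a _ => hP a).trans_eq ?_) hPc
        simp
    _ = _ := add_comm _ _

theorem intPoint_smul {d : ℕ} (k : ℤ) (z : Fin d → ℤ) :
    intPoint (k • z) = (k : ℝ) • intPoint z := by
  ext i
  simp [intPoint]

theorem norm_intPoint_sq {d : ℕ} (z : Fin d → ℤ) : ‖intPoint z‖ ^ 2 = ∑ i, (z i : ℝ) ^ 2 := by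
  simp [EuclideanSpace.norm_sq_eq, intPoint]

theorem one_le_norm_intPoint {d : ℕ} {z : Fin d → ℤ} (hz : z ≠ 0) : 1 ≤ ‖intPoint z‖ := by
  obtain ⟨i, hi⟩ := Function.ne_iff.1 hz
  have h1 : (1 : ℝ) ≤ (z i : ℝ) ^ 2 := by
    have : 0 < z i ^ 2 := sq_pos_of_ne_zero hi
    exact_mod_cast this
  have h2 : (z i : ℝ) ^ 2 ≤ ‖intPoint z‖ ^ 2 := by
    rw [norm_intPoint_sq]
    exact Finset.single_le_sum (f := fun i => (z i : ℝ) ^ 2) (fun j _ => sq_nonneg _)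
      (Finset.mem_univ i)
  nlinarith [norm_nonneg (intPoint z)]

theorem sqLen_smul_shearMatrix {e q : ℕ} (s : ℝ) (a : Fin e → Fin q) (z : Fin (e + 1) → ℤ) :
    sqLen (s • shearMatrix q a) z = (s * ‖intPoint (shearMap q a z)‖) ^ 2 := by
  rw [sqLen, smul_mulVec, shearMatrix_mulVec, mul_pow, norm_intPoint_sq, smul_dotProduct,
    dotProduct_smul]
  simp only [dotProduct, smul_eq_mul, Finset.mul_sum]
  exact Finset.sum_congr rfl fun i _ => by ring

theorem isAdmissible_smul_shearMatrix {e q p : ℕ} (hq : 0 < q) {s : ℝ} (hs : 0 < s)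
    {a : Fin e → Fin q}
    (h : ∑' z : {z : Fin (e + 1) → ℤ // z ≠ 0},
      ENNReal.ofReal (radialProfile p (s * ‖intPoint (shearMap q a z)‖)) < 1) :
    IsAdmissible p (s • shearMatrix q a) ∧ epstein p (s • shearMatrix q a) ≤ 1 := by
  have hlt : ∀ z : {z : Fin (e + 1) → ℤ // z ≠ 0}, 1 < s * ‖intPoint (shearMap q a z)‖ := by
    intro z
    by_contra! hle
    have h1 := (ENNReal.le_tsum (f := fun z : {z : Fin (e + 1) → ℤ // z ≠ 0} =>
      ENNReal.ofReal (radialProfile p (s * ‖intPoint (shearMap q a z)‖))) z).trans_lt h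
    simp [radialProfile, max_eq_left hle] at h1
  have hval : ∀ z : {z : Fin (e + 1) → ℤ // z ≠ 0}, (sqLen (s • shearMatrix q a) z)⁻¹ ^ p =
      radialProfile p (s * ‖intPoint (shearMap q a z)‖) := fun z => by
    rw [sqLen_smul_shearMatrix, radialProfile, max_eq_right (hlt z).le, pow_mul,
      inv_pow (s * ‖_‖)]
  have hsum : Summable fun z : {z : Fin (e + 1) → ℤ // z ≠ 0} =>
      radialProfile p (s * ‖intPoint (shearMap q a z)‖) := by
    have := ENNReal.summable_toReal h.ne_top
    simpa only [ENNReal.toReal_ofReal (radialProfile_nonneg _ _)] using this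
  refine ⟨⟨?_, fun z => ?_, ?_⟩, ?_⟩
  · rw [det_smul, det_shearMatrix]
    positivity
  · rw [sqLen_smul_shearMatrix]
    exact one_le_pow₀ (hlt z).le
  · simpa only [hval] using hsum
  · rw [epstein]
    simp only [hval]
    rw [← ENNReal.ofReal_le_ofReal_iff zero_le_one,
      ENNReal.ofReal_tsum_of_nonneg (fun z => radialProfile_nonneg _ _) hsum, ENNReal.ofReal_one]
    exact h.le

theorem exists_tsum_shearMap_lt_one {e q : ℕ} (hq : q.Prime) {F : (Fin (e + 1) → ℤ) → ENNReal}
    {A B : ℝ} (hA : 0 ≤ A) (hB : 0 ≤ B) (hAB : A + q ^ e * B < q ^ e)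
    (hFA : ∑' x, F x ≤ ENNReal.ofReal A)
    (hFB : ∑' y : {y : Fin (e + 1) → ℤ // y ≠ 0}, F ((q : ℤ) • (y : _ → ℤ)) ≤ ENNReal.ofReal B) :
    ∃ a : Fin e → Fin q, ∑' z : {z : Fin (e + 1) → ℤ // z ≠ 0}, F (shearMap q a z) < 1 := by
  by_contra! hall
  have h1 : ENNReal.ofReal (q ^ e) ≤
      ∑ a : Fin e → Fin q, ∑' z : {z : Fin (e + 1) → ℤ // z ≠ 0}, F (shearMap q a z) := by
    calc ENNReal.ofReal (q ^ e) = ∑ _a : Fin e → Fin q, (1 : ENNReal) := by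
          simp [ENNReal.ofReal_pow]
      _ ≤ _ := Finset.sum_le_sum fun a _ => hall a
  have h2 : (q : ENNReal) ^ e = ENNReal.ofReal (q ^ e) := by simp [ENNReal.ofReal_pow]
  have h3 := h1.trans ((sum_tsum_shearMap_le hq F).trans
    (add_le_add hFA (mul_le_mul' h2.le hFB)))
  rw [← ENNReal.ofReal_mul (by positivity), ← ENNReal.ofReal_add hA (by positivity),
    ENNReal.ofReal_le_ofReal_iff (by positivity)] at h3
  linarith

theorem tsum_radialProfile_mul_norm_intPoint_le {d p : ℕ} {s R K : ℝ} (hs : s ≤ 1) (hR : 0 < R)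
    (hK : ∑' x : Fin d → ℤ, ENNReal.ofReal (radialProfile p (s * ‖intPoint x‖)) ≤
      ENNReal.ofReal K) :
    ∑' y : {y : Fin d → ℤ // y ≠ 0}, ENNReal.ofReal (radialProfile p (R * ‖intPoint y.1‖)) ≤
      ENNReal.ofReal (R⁻¹ ^ (2 * p) * K) := by
  have hR' : 0 ≤ R⁻¹ ^ (2 * p) := by positivity
  calc _ ≤ ∑' y : {y : Fin d → ℤ // y ≠ 0}, ENNReal.ofReal (R⁻¹ ^ (2 * p)) *
        ENNReal.ofReal (radialProfile p (s * ‖intPoint y.1‖)) := by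
        refine ENNReal.tsum_le_tsum fun y => ?_
        rw [← ENNReal.ofReal_mul hR']
        exact ENNReal.ofReal_le_ofReal (radialProfile_mul_le (one_le_norm_intPoint y.2) hs hR)
    _ ≤ ENNReal.ofReal (R⁻¹ ^ (2 * p)) * ENNReal.ofReal K := by
        rw [ENNReal.tsum_mul_left]
        exact mul_le_mul_right ((ENNReal.tsum_comp_le_tsum_of_injective Subtype.val_injective
          fun x : Fin d → ℤ => ENNReal.ofReal (radialProfile p (s * ‖intPoint x‖))).trans hK) _
    _ = _ := (ENNReal.ofReal_mul hR').symm

theorem exists_isAdmissible {d p : ℕ} (hd : 2 ≤ d) (hdp : 11 * d ≤ 20 * p) :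
    ∃ M : Matrix (Fin d) (Fin d) ℝ, IsAdmissible p M ∧ epstein p M ≤ 1 ∧
      M.det = 44 * volume.real (Metric.ball (0 : EuclideanSpace ℝ (Fin d)) 1) := by
  obtain ⟨e, rfl⟩ : ∃ e, d = e + 1 := ⟨d - 1, by omega⟩
  set V := volume.real (Metric.ball (0 : EuclideanSpace ℝ (Fin (e + 1))) 1) with hV
  have hV0 : 0 < V := ENNReal.toReal_pos (Metric.measure_ball_pos _ _ one_pos).ne'
    measure_ball_lt_top.ne
  have hp : 0 < p := by omega
  have hp' : (1 : ℝ) ≤ p := by exact_mod_cast hp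
  have hd2p : e + 1 < 2 * p := by omega
  have hratio : 1 + ((e + 1 : ℕ) : ℝ) / (2 * p - (e + 1 : ℕ)) ≤ 11 := by
    have h1 : (11 : ℝ) * (e + 1 : ℕ) ≤ 20 * p := by exact_mod_cast hdp
    have h2 : ((e + 1 : ℕ) : ℝ) < 2 * p := by exact_mod_cast hd2p
    have : ((e + 1 : ℕ) : ℝ) / (2 * p - (e + 1 : ℕ)) ≤ 10 := by
      rw [div_le_iff₀ (by linarith)]
      linarith
    linarith
  have hratio0 : 0 ≤ 1 + ((e + 1 : ℕ) : ℝ) / (2 * p - (e + 1 : ℕ)) := by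
    have h2 : ((e + 1 : ℕ) : ℝ) < 2 * p := by exact_mod_cast hd2p
    have : 0 ≤ ((e + 1 : ℕ) : ℝ) / (2 * p - (e + 1 : ℕ)) :=
      div_nonneg (by positivity) (by linarith)
    linarith
  set η : ℝ := 1 / (4 * p) with hη
  have hη0 : 0 < η := by positivity
  have hη1 : η < 1 := by
    rw [hη, div_lt_one (by positivity)]
    linarith
  have hη2 : (1 - η)⁻¹ ^ (2 * p) ≤ 2 := by
    have h1 := one_add_mul_le_pow (a := -η) (by linarith) (2 * p)
    have h2 : ((2 * p : ℕ) : ℝ) * η = 1 / 2 := by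
      rw [hη]
      push_cast
      field_simp
      norm_num
    rw [inv_pow, inv_le_comm₀ (pow_pos (by linarith) _) two_pos]
    have h3 : (1 + -η) = 1 - η := by ring
    rw [h3] at h1
    linarith
  have hsd : 0 < √((e + 1 : ℕ) : ℝ) := Real.sqrt_pos.2 (by positivity)
  have hsd1 : 1 ≤ √((e + 1 : ℕ) : ℝ) := Real.one_le_sqrt.2 (by
    push_cast
    linarith [e.cast_nonneg (α := ℝ)])
  set s₀ : ℝ := η / √((e + 1 : ℕ) : ℝ) with hs₀
  have hs₀pos : 0 < s₀ := by positivity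
  have hs₀1 : s₀ ≤ 1 := by
    rw [hs₀, div_le_one hsd]
    linarith
  obtain ⟨K, hK0, hK⟩ : ∃ K : ℝ, 0 ≤ K ∧ ∑' x : Fin (e + 1) → ℤ,
      ENNReal.ofReal (radialProfile p (s₀ * ‖intPoint x‖)) ≤ ENNReal.ofReal K :=
    ⟨_, by positivity, tsum_radialProfile_le e.succ_pos hd2p hs₀pos hη1
      (div_mul_cancel₀ _ hsd.ne').le⟩
  set T : ℝ := max 1 (4 * K) with hT
  have hT1 : 1 ≤ T := le_max_left _ _
  obtain ⟨N, hN⟩ := exists_nat_ge (max (44 * V / s₀ ^ (e + 1)) (T ^ (e + 1) / (44 * V)))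
  obtain ⟨q, hqN, hq⟩ := Nat.exists_infinite_primes N
  have hqN' : (N : ℝ) ≤ q := by exact_mod_cast hqN
  have hq1 : (1 : ℝ) ≤ q := by exact_mod_cast hq.one_le
  have hq0 : (0 : ℝ) < q := by linarith
  have hqA : 44 * V / s₀ ^ (e + 1) ≤ q := (le_max_left _ _).trans (hN.trans hqN')
  have hqB : T ^ (e + 1) / (44 * V) ≤ q := (le_max_right _ _).trans (hN.trans hqN')
  set s : ℝ := (44 * V / q ^ e) ^ ((e + 1 : ℕ) : ℝ)⁻¹ with hs
  have hs0 : 0 < s := by positivity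
  have hsd' : s ^ (e + 1) = 44 * V / q ^ e :=
    Real.rpow_inv_natCast_pow (by positivity) e.succ_ne_zero
  have hss₀ : s ≤ s₀ := by
    refine le_of_pow_le_pow_left₀ e.succ_ne_zero hs₀pos.le ?_
    rw [hsd', div_le_iff₀ (by positivity)]
    rw [div_le_iff₀ (by positivity)] at hqA
    have : (q : ℝ) ≤ q ^ e := le_self_pow₀ hq1 (by omega)
    calc 44 * V ≤ q * s₀ ^ (e + 1) := hqA
      _ ≤ q ^ e * s₀ ^ (e + 1) := by gcongr
      _ = _ := mul_comm _ _
  have hR : T ≤ s * q := by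
    refine le_of_pow_le_pow_left₀ e.succ_ne_zero (by positivity) ?_
    rw [mul_pow, hsd', pow_succ (q : ℝ), div_mul_eq_mul_div, ← mul_assoc, mul_right_comm,
      mul_div_assoc, div_self (by positivity), mul_one]
    rwa [div_le_iff₀ (by positivity), mul_comm] at hqB
  have hRpow : (s * q)⁻¹ ^ (2 * p) * K ≤ 1 / 4 := by
    rw [inv_pow, inv_mul_le_iff₀ (by positivity)]
    have h1 : s * q ≤ (s * q) ^ (2 * p) := le_self_pow₀ (hT1.trans hR) (by omega)
    have h2 : 4 * K ≤ T := le_max_right _ _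
    linarith
  let F : (Fin (e + 1) → ℤ) → ENNReal := fun x =>
    ENNReal.ofReal (radialProfile p (s * ‖intPoint x‖))
  have hF : ∑' x, F x ≤ ENNReal.ofReal (q ^ e / 2) := by
    refine (tsum_radialProfile_le e.succ_pos hd2p hs0 hη1 ?_).trans (ENNReal.ofReal_le_ofReal ?_)
    · rwa [hs₀, le_div_iff₀ hsd] at hss₀
    · rw [hsd', ← hV]
      calc _ ≤ 2 * ((44 * V / q ^ e)⁻¹ * (V * 11)) := by gcongr
        _ = q ^ e / 2 := by
          field_simp
          norm_num
  have hFq : ∑' y : {y : Fin (e + 1) → ℤ // y ≠ 0}, F ((q : ℤ) • y.1) ≤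
      ENNReal.ofReal (1 / 4) := by
    have h1 : ∀ y : Fin (e + 1) → ℤ, F ((q : ℤ) • y) =
        ENNReal.ofReal (radialProfile p (s * q * ‖intPoint y‖)) := fun y => by
      simp only [F]
      rw [intPoint_smul, norm_smul, ← mul_assoc, Real.norm_eq_abs, Int.cast_natCast,
        abs_of_pos hq0]
    simp only [h1]
    exact (tsum_radialProfile_mul_norm_intPoint_le hs₀1 (by positivity) hK).trans
      (ENNReal.ofReal_le_ofReal hRpow)
  have hqe : (0 : ℝ) < q ^ e := by positivity
  obtain ⟨a, ha⟩ := exists_tsum_shearMap_lt_one hq (by positivity) (by norm_num) (by linarith)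
    hF hFq
  obtain ⟨hadm, heps⟩ := isAdmissible_smul_shearMatrix hq.pos hs0 ha
  refine ⟨_, hadm, heps, ?_⟩
  rw [det_smul, det_shearMatrix, Fintype.card_fin, hsd', div_mul_cancel₀ _ (by positivity)]

theorem exists_lattice_of_matrix {d : ℕ} {A : Matrix (Fin d) (Fin d) ℝ} (hA : A.det ≠ 0) :
    ∃ (Λ : Submodule ℤ (EuclideanSpace ℝ (Fin d))) (_ : DiscreteTopology Λ) (_ : IsZLattice ℝ Λ),
      ZLattice.covolume Λ = |A.det| ∧
      ∀ v ∈ Λ, ∃ z : Fin d → ℤ, v = WithLp.toLp 2 (A *ᵥ fun i => (z i : ℝ)) := by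
  let b₀ := (EuclideanSpace.basisFun (Fin d) ℝ).toBasis
  let b := b₀.map (Matrix.toLinearEquiv b₀ A hA.isUnit)
  have hb : ∀ j, b j = WithLp.toLp 2 (A.col j) := fun j => by
    have : b j = Matrix.toLin b₀ b₀ A (b₀ j) := rfl
    rw [this, Matrix.toLin_self]
    ext i
    simp [b₀, Pi.single_apply]
  refine ⟨Submodule.span ℤ (Set.range b), inferInstance, inferInstance, ?_, fun v hv => ?_⟩
  · have hb₀ : volume.real (ZSpan.fundamentalDomain b₀) = 1 := by
      rw [measureReal_congr (ZSpan.fundamentalDomain_ae_parallelepiped b₀ volume), measureReal_def]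
      have : volume (parallelepiped b₀) = 1 := by
        simpa [b₀] using (EuclideanSpace.basisFun (Fin d) ℝ).volume_parallelepiped
      rw [this, ENNReal.toReal_one]
    have hmat : b₀.toMatrix b = A := by
      ext i j
      rw [Module.Basis.toMatrix_apply, hb]
      simp [b₀]
    rw [ZLattice.covolume_eq_measure_fundamentalDomain _ _ (ZSpan.isAddFundamentalDomain b volume),
      ZSpan.measureReal_fundamentalDomain b volume b₀, hb₀, mul_one, Module.Basis.det_apply, hmat]
  · obtain ⟨z, rfl⟩ := (Submodule.mem_span_range_iff_exists_fun ℤ).1 hv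
    refine ⟨z, ?_⟩
    ext i
    simp [hb, mulVec, dotProduct, mul_comm]

theorem exists_lattice_avoiding_closedBall {d : ℕ} (hd : 0 < d) {M : Matrix (Fin d) (Fin d) ℝ}
    (hM : M.det ≠ 0) (hone : ∀ z : {z : Fin d → ℤ // z ≠ 0}, 1 ≤ sqLen M z) {v : ℝ} (hv : 0 ≤ v)
    (hlt : v * |M.det| < volume.real (Metric.ball (0 : EuclideanSpace ℝ (Fin d)) 1)) :
    ∃ (Λ : Submodule ℤ (EuclideanSpace ℝ (Fin d))) (_ : DiscreteTopology Λ)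
      (_ : IsZLattice ℝ Λ) (R : ℝ), 0 ≤ R ∧ ZLattice.covolume Λ = 1 ∧
      v = (volume (Metric.closedBall (0 : EuclideanSpace ℝ (Fin d)) R)).toReal ∧
      ∀ x ∈ Λ, x ∈ Metric.closedBall (0 : EuclideanSpace ℝ (Fin d)) R → x = 0 := by
  set V := volume.real (Metric.ball (0 : EuclideanSpace ℝ (Fin d)) 1) with hV
  have hdet : 0 < |M.det| := abs_pos.2 hM
  have hV0 : 0 < V := lt_of_le_of_lt (by positivity) hlt
  set c : ℝ := |M.det|⁻¹ ^ ((d : ℕ) : ℝ)⁻¹ with hc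
  have hc0 : 0 < c := by positivity
  have hcd : c ^ d = |M.det|⁻¹ := Real.rpow_inv_natCast_pow (by positivity) hd.ne'
  set R : ℝ := (v / V) ^ ((d : ℕ) : ℝ)⁻¹ with hR
  have hR0 : 0 ≤ R := by positivity
  have hRd : R ^ d = v / V := Real.rpow_inv_natCast_pow (by positivity) hd.ne'
  have hRc : R < c := by
    refine lt_of_pow_lt_pow_left₀ d hc0.le ?_
    rw [hRd, hcd, div_lt_iff₀ hV0, inv_mul_eq_div, lt_div_iff₀ hdet]
    exact hlt
  have hdetc : (c • M).det = c ^ d * M.det := by rw [det_smul, Fintype.card_fin]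
  obtain ⟨Λ, h1, h2, hcov, hmem⟩ := exists_lattice_of_matrix (A := c • M)
    (by rw [hdetc]; positivity)
  refine ⟨Λ, h1, h2, R, hR0, ?_, ?_, fun x hx hxR => ?_⟩
  · rw [hcov, hdetc, abs_mul, hcd, abs_of_pos (inv_pos.2 hdet), inv_mul_cancel₀ hdet.ne']
  · have := Measure.addHaar_real_closedBall (volume : Measure (EuclideanSpace ℝ (Fin d))) 0 hR0
    rw [measureReal_def] at this
    rw [this, finrank_euclideanSpace_fin, hRd, ← hV, div_mul_cancel₀ _ hV0.ne']
  · obtain ⟨z, rfl⟩ := hmem x hx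
    by_contra hne
    have hz : z ≠ 0 := by
      rintro rfl
      refine hne ?_
      ext i
      simp [mulVec, dotProduct]
    have h3 := hone ⟨z, hz⟩
    have h4 : ‖WithLp.toLp 2 ((c • M) *ᵥ fun i => (z i : ℝ))‖ ^ 2 = c ^ 2 * sqLen M z := by
      rw [EuclideanSpace.norm_sq_eq, sqLen]
      simp [smul_mulVec, dotProduct, Finset.mul_sum, pow_two, mul_mul_mul_comm]
    have h5 : ‖WithLp.toLp 2 ((c • M) *ᵥ fun i => (z i : ℝ))‖ ≤ R :=
      mem_closedBall_zero_iff.1 hxR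
    have h6 : ‖WithLp.toLp 2 ((c • M) *ᵥ fun i => (z i : ℝ))‖ ^ 2 ≤ R ^ 2 :=
      pow_le_pow_left₀ (norm_nonneg _) h5 2
    rw [h4] at h6
    have h7 : R ^ 2 < c ^ 2 := pow_lt_pow_left₀ hRc hR0 two_ne_zero
    have h8 : c ^ 2 * 1 ≤ c ^ 2 * sqLen M z := by gcongr
    linarith

theorem bddAbove_latticePackingSup (d : ℕ) :
    BddAbove {V : ℝ | ∃ (Λ : Submodule ℤ (EuclideanSpace ℝ (Fin d))) (_ : DiscreteTopology Λ)
      (_ : IsZLattice ℝ Λ) (R : ℝ), 0 ≤ R ∧ ZLattice.covolume Λ = 1 ∧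
      V = (volume (Metric.closedBall (0 : EuclideanSpace ℝ (Fin d)) R)).toReal ∧
      ∀ v ∈ Λ, v ∈ Metric.closedBall (0 : EuclideanSpace ℝ (Fin d)) R → v = 0} := by
  refine ⟨2 ^ d, ?_⟩
  rintro _ ⟨Λ, _, _, R, -, hcov, rfl, hball⟩
  by_contra! hlt
  have hfund := ZLattice.isAddFundamentalDomain (Module.Free.chooseBasis ℤ Λ)
    (volume : Measure (EuclideanSpace ℝ (Fin d)))
  have hF := ZLattice.covolume_eq_measure_fundamentalDomain Λ volume hfund
  rw [hcov, measureReal_def, eq_comm, ENNReal.toReal_eq_one_iff] at hF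
  have : Countable Λ.toAddSubgroup := inferInstanceAs (Countable Λ)
  obtain ⟨x, hx0, hx⟩ := exists_ne_zero_mem_lattice_of_measure_mul_two_pow_lt_measure
    (L := Λ.toAddSubgroup) (s := Metric.closedBall (0 : EuclideanSpace ℝ (Fin d)) R) hfund
    (fun x hx => by simpa using hx) (convex_closedBall _ _) (by
      rw [hF, one_mul, finrank_euclideanSpace_fin]
      refine (ENNReal.toReal_lt_toReal (by finiteness) measure_closedBall_lt_top.ne).1 ?_
      simpa using hlt)
  exact hx0 (Subtype.ext (hball x x.2 hx))

theorem exists_matrix_det_lt {d : ℕ} (hd : 300 ≤ d) {v : ℝ} (hv : 0 < v)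
    (hvd : v * 44 < ((d : ℝ) / 20) ^ (6 / 5 : ℝ)) :
    ∃ M : Matrix (Fin d) (Fin d) ℝ, M.det ≠ 0 ∧
      (∀ z : {z : Fin d → ℤ // z ≠ 0}, 1 ≤ sqLen M z) ∧
      v * |M.det| < volume.real (Metric.ball (0 : EuclideanSpace ℝ (Fin d)) 1) := by
  set V := volume.real (Metric.ball (0 : EuclideanSpace ℝ (Fin d)) 1) with hV
  have hV0 : 0 < V := ENNReal.toReal_pos (Metric.measure_ball_pos _ _ one_pos).ne'
    measure_ball_lt_top.ne
  have hdR : (300 : ℝ) ≤ d := by exact_mod_cast hd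
  obtain ⟨p, hp⟩ : ∃ p, p = 3 * d / 5 := ⟨_, rfl⟩
  obtain ⟨k, hk⟩ : ∃ k, k = d * d / 100 := ⟨_, rfl⟩
  obtain ⟨m, hm⟩ : ∃ m, m = 47 * (d * d) / 100 := ⟨_, rfl⟩
  have hdd : 300 * d ≤ d * d := Nat.mul_le_mul_right d hd
  have hpu : (5 : ℝ) * p ≤ 3 * d := by exact_mod_cast (by omega : 5 * p ≤ 3 * d)
  have hmu : (47 : ℝ) * (d * d) < 100 * m + 100 := by
    exact_mod_cast (by omega : 47 * (d * d) < 100 * m + 100)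
  have hku : (d : ℝ) * d < 100 * k + 100 := by
    exact_mod_cast (by omega : d * d < 100 * k + 100)
  have hcard : m + k + d * (d - 1) / 2 ≤ d * d := by
    have : d * (d - 1) ≤ d * d := Nat.mul_le_mul_left d (Nat.sub_le d 1)
    omega
  obtain ⟨M₀, h₀, he₀, hdet₀⟩ := exists_isAdmissible (d := d) (p := p) (by omega) (by omega)
  obtain ⟨M, hM, hlog⟩ := h₀.exists_log_det_sq_le (by omega) (by omega) he₀ (m := m) (k := k)
    (by omega) (by omega) hcard (l := 6 / 5) (by norm_num) (by linarith) (by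
      have hp0 : (0 : ℝ) ≤ p := p.cast_nonneg
      nlinarith)
  refine ⟨M, hM.det_ne_zero, hM.one_le, ?_⟩
  have hdet : 0 < |M.det| := abs_pos.2 hM.det_ne_zero
  have hk2 : ((d : ℝ) / 20) ^ 2 ≤ k / 2 := by nlinarith
  have hd20 : (0 : ℝ) < d / 20 := by positivity
  have hlogk : 2 * Real.log (d / 20) ≤ Real.log (k / 2) := by
    have := Real.log_le_log (by positivity) hk2
    rwa [Real.log_pow, Nat.cast_two] at this
  have hlogv : Real.log v + Real.log 44 < 6 / 5 * Real.log (d / 20) := by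
    have := Real.log_lt_log (by positivity) hvd
    rwa [Real.log_mul hv.ne' (by norm_num), Real.log_rpow hd20] at this
  rw [hdet₀, ← hV, Real.log_pow, Real.log_pow, Real.log_mul (by norm_num) hV0.ne', Nat.cast_two,
    ← Real.log_abs M.det] at hlog
  refine (Real.log_lt_log_iff (by positivity) hV0).1 ?_
  rw [Real.log_mul hv.ne' hdet.ne']
  linarith

theorem inv_card_add_one_le_prod_one_sub_inv (S : Finset ℕ) (hS : ∀ x ∈ S, 2 ≤ x) :
    ((S.card : ℝ) + 1)⁻¹ ≤ ∏ x ∈ S, (1 - (x : ℝ)⁻¹) := by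
  induction S using Finset.induction_on_max with
  | empty => simp
  | insert a S hmax ih =>
    have ha : a ∉ S := fun h => (hmax a h).false
    have hcard : S.card + 2 ≤ a := by
      have h1 : S ⊆ Finset.Ico 2 a := fun x hx =>
        Finset.mem_Ico.2 ⟨hS x (Finset.mem_insert_of_mem hx), hmax x hx⟩
      have h2 := Finset.card_le_card h1
      have h3 := hS a (Finset.mem_insert_self a S)
      rw [Nat.card_Ico] at h2
      omega
    have hcard' : (S.card : ℝ) + 2 ≤ a := by exact_mod_cast hcard
    have h1 := ih fun x hx => hS x (Finset.mem_insert_of_mem hx)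
    have h2 : 1 - ((S.card : ℝ) + 2)⁻¹ ≤ 1 - (a : ℝ)⁻¹ := by gcongr
    rw [Finset.prod_insert ha, Finset.card_insert_of_notMem ha]
    calc (((S.card + 1 : ℕ) : ℝ) + 1)⁻¹ = (1 - ((S.card : ℝ) + 2)⁻¹) * ((S.card : ℝ) + 1)⁻¹ := by
          push_cast
          field_simp
          ring
      _ ≤ _ := by
          have : 0 ≤ 1 - (a : ℝ)⁻¹ := by
            have : (a : ℝ)⁻¹ ≤ 1 := inv_le_one_of_one_le₀
              (by linarith [S.card.cast_nonneg (α := ℝ)])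
            linarith
          gcongr

theorem le_totient_mul_log_add_one {n : ℕ} (hn : n ≠ 0) :
    (n : ℝ) ≤ Nat.totient n * (Nat.log 2 n + 1) := by
  have h1 : (Nat.totient n : ℝ) = n * ∏ x ∈ n.primeFactors, (1 - (x : ℝ)⁻¹) := by
    have := congrArg (Rat.cast : ℚ → ℝ) (Nat.totient_eq_mul_prod_factors n)
    push_cast at this
    exact this
  have h2 := inv_card_add_one_le_prod_one_sub_inv n.primeFactors
    fun x hx => (Nat.prime_of_mem_primeFactors hx).two_le
  have h3 : n.primeFactors.card ≤ Nat.log 2 n := by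
    refine Nat.le_log_of_pow_le one_lt_two ?_
    calc 2 ^ n.primeFactors.card ≤ ∏ x ∈ n.primeFactors, x :=
          Finset.pow_card_le_prod _ _ _ fun x hx => (Nat.prime_of_mem_primeFactors hx).two_le
      _ ≤ n := Nat.le_of_dvd (Nat.pos_of_ne_zero hn) (Nat.prod_primeFactors_dvd n)
  have h4 : (n.primeFactors.card : ℝ) ≤ Nat.log 2 n := by exact_mod_cast h3
  have h5 : ((Nat.log 2 n : ℝ) + 1)⁻¹ ≤ ∏ x ∈ n.primeFactors, (1 - (x : ℝ)⁻¹) :=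
    le_trans (by gcongr) h2
  have h6 : (0 : ℝ) < (Nat.log 2 n : ℝ) + 1 := by positivity
  rw [h1, mul_assoc]
  refine le_mul_of_one_le_right n.cast_nonneg ?_
  rwa [inv_le_iff_one_le_mul₀ h6] at h5

theorem eventually_rpow_le_totient :
    ∀ᶠ n : ℕ in Filter.atTop, (n : ℝ) ^ (9 / 10 : ℝ) ≤ Nat.totient n := by
  have h1 := ((isLittleO_log_rpow_atTop (r := 1 / 10) (by norm_num)).bound
    (c := 1 / 4) (by norm_num)).and (Filter.eventually_ge_atTop (2 : ℝ))
  have h1' := (tendsto_natCast_atTop_atTop (R := ℝ)).eventually h1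
  have h2 := (tendsto_natCast_atTop_atTop (R := ℝ)).eventually
    ((tendsto_rpow_atTop (y := 1 / 10) (by norm_num)).eventually_ge_atTop 2)
  filter_upwards [h1', h2] with n ⟨hn, hn2⟩ hn3
  have hn0 : (0 : ℝ) < n := by linarith
  have hlog : (Nat.log 2 n : ℝ) ≤ 2 * Real.log n := by
    have h3 := Real.natLog_le_logb n 2
    rw [Real.logb, le_div_iff₀ (Real.log_pos (by norm_num))] at h3
    have h4 := Real.log_two_gt_d9
    push_cast at h3
    have : (0 : ℝ) ≤ Nat.log 2 n := Nat.cast_nonneg _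
    nlinarith
  rw [Real.norm_of_nonneg (Real.log_nonneg (by linarith)),
    Real.norm_of_nonneg (by positivity)] at hn
  have h5 := le_totient_mul_log_add_one (n := n) (by exact_mod_cast hn0.ne')
  have h6 : (n : ℝ) ≤ Nat.totient n * (n : ℝ) ^ (1 / 10 : ℝ) :=
    h5.trans (mul_le_mul_of_nonneg_left (by linarith) (Nat.cast_nonneg _))
  have h7 : (n : ℝ) = (n : ℝ) ^ (9 / 10 : ℝ) * (n : ℝ) ^ (1 / 10 : ℝ) := by
    rw [← Real.rpow_add hn0]
    norm_num
  exact le_of_mul_le_mul_right (h7.symm.trans_le h6) (by positivity)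

theorem eventually_totient_large :
    ∀ᶠ n : ℕ in Filter.atTop, 300 ≤ Nat.totient n ∧
      (n : ℝ) * 44 < ((Nat.totient n : ℝ) / 20) ^ (6 / 5 : ℝ) := by
  have h1 := (tendsto_natCast_atTop_atTop (R := ℝ)).eventually
    ((tendsto_rpow_atTop (y := 9 / 10) (by norm_num)).eventually_ge_atTop 300)
  have h2 := (tendsto_natCast_atTop_atTop (R := ℝ)).eventually
    ((tendsto_rpow_atTop (y := 2 / 25) (by norm_num)).eventually_gt_atTop
      (44 * 20 ^ (6 / 5 : ℝ)))
  filter_upwards [eventually_rpow_le_totient, h1, h2, Filter.eventually_gt_atTop 0]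
    with n hn h300 hbig hn0
  have hn0 : (0 : ℝ) < n := by exact_mod_cast hn0
  refine ⟨by exact_mod_cast h300.trans hn, ?_⟩
  refine lt_of_lt_of_le ?_ (Real.rpow_le_rpow (by positivity)
    (div_le_div_of_nonneg_right hn (by norm_num)) (by norm_num))
  rw [Real.div_rpow (by positivity) (by norm_num), ← Real.rpow_mul hn0.le,
    lt_div_iff₀ (by positivity), mul_assoc]
  calc (n : ℝ) * (44 * 20 ^ (6 / 5 : ℝ)) < n * (n : ℝ) ^ (2 / 25 : ℝ) := by gcongr
    _ = _ := by
      rw [← Real.rpow_one_add' hn0.le (by norm_num)]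
      norm_num

end LatticePacking

/-- There is a `c > 0` such that for all large `n` there is a full-rank covolume-one lattice
`Λ ⊆ ℝ^{φ(n)}` and an origin-centered ball of volume at least `n - e^{-c φ(n) log n}` meeting
`Λ` only in `0`; in particular `c_{φ(n)} ≥ n - e^{-c φ(n) log n}` for all large `n`. -/
theorem stmt18 : ∃ c : ℝ, 0 < c ∧ ∃ N : ℕ, ∀ n : ℕ, N ≤ n →
    (∃ (Λ : Submodule ℤ (EuclideanSpace ℝ (Fin (Nat.totient n)))) (_ : DiscreteTopology Λ)
        (_ : IsZLattice ℝ Λ) (R : ℝ), 0 ≤ R ∧ ZLattice.covolume Λ = 1 ∧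
      (n : ℝ) - Real.exp (-c * (Nat.totient n) * Real.log n)
        ≤ (volume (Metric.closedBall (0 : EuclideanSpace ℝ (Fin (Nat.totient n))) R)).toReal ∧
      ∀ v ∈ Λ, v ∈ Metric.closedBall (0 : EuclideanSpace ℝ (Fin (Nat.totient n))) R → v = 0) ∧
    (n : ℝ) - Real.exp (-c * (Nat.totient n) * Real.log n)
      ≤ latticePackingSup (Nat.totient n) := by
  obtain ⟨N, hN⟩ := Filter.eventually_atTop.1 LatticePacking.eventually_totient_large
  refine ⟨1, one_pos, max N 1, fun n hn => ?_⟩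
  obtain ⟨h300, hlarge⟩ := hN n ((le_max_left _ _).trans hn)
  have hn0 : (0 : ℝ) < n := by exact_mod_cast (le_max_right _ _).trans hn
  obtain ⟨M, hM, hone, hlt⟩ := LatticePacking.exists_matrix_det_lt h300 hn0 hlarge
  obtain ⟨Λ, hdisc, hlat, R, hR, hcov, hvol, hball⟩ :=
    LatticePacking.exists_lattice_avoiding_closedBall (by omega) hM hone hn0.le hlt
  have hle : (n : ℝ) - Real.exp (-1 * (Nat.totient n) * Real.log n) ≤ n :=
    sub_le_self _ (Real.exp_pos _).le
  exact ⟨⟨Λ, hdisc, hlat, R, hR, hcov, hle.trans hvol.le, hball⟩,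
    hle.trans (le_csSup (LatticePacking.bddAbove_latticePackingSup _)
      ⟨Λ, hdisc, hlat, R, hR, hcov, hvol, hball⟩)⟩
end

section
/- There exist constants c > 0 and C > 0 such that for infinitely many positive integers d there is a full-rank lattice Λ ⊆ ℝ^d of covolume 1 and an origin-centered Euclidean ball B ⊆ ℝ^d of volume at least d · log(log d) − e^{−c·d·log d + C·d} with Λ ∩ B = {0}; equivalently, the lattice packing quantity c_d = sup{ vol(B) : B an origin-centered ball in ℝ^d such that gℤ^d ∩ B = {0} for some g ∈ SL_d(ℝ) } satisfies c_d ≥ d log log d − e^{−c d log d + C d} for infinitely many d. -/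
open MeasureTheory

open scoped Matrix

/-- The value at `x` of the quadratic form with matrix `Q`. -/
noncomputable def quadVal {ι : Type*} [Fintype ι] (Q : Matrix ι ι ℝ) (x : ι → ℝ) : ℝ :=
  x ⬝ᵥ Q *ᵥ x

/-- An integer vector, regarded as a real vector. -/
def intVec {ι : Type*} (z : ι → ℤ) : ι → ℝ := fun i => z i

/-- Positive semidefinite forms of trace `t` taking values at least one at nonzero integer
vectors. -/
def admissibleForms (ι : Type*) [Fintype ι] (t : ℝ) : Set (Matrix ι ι ℝ) :=
  {Q | Q.IsSymm ∧ (∀ x, 0 ≤ quadVal Q x) ∧ Q.trace = t ∧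
    ∀ z : ι → ℤ, z ≠ 0 → 1 ≤ quadVal Q (intVec z)}

theorem intVec_ne_zero {ι : Type*} {z : ι → ℤ} (hz : z ≠ 0) : intVec z ≠ 0 := by
  intro h
  apply hz
  funext i
  have := congrFun h i
  simpa [intVec] using this

section Forms

variable {ι : Type*} [Fintype ι]

theorem quadVal_add (Q R : Matrix ι ι ℝ) (x : ι → ℝ) :
    quadVal (Q + R) x = quadVal Q x + quadVal R x := by
  simp [quadVal, Matrix.add_mulVec, dotProduct_add]

theorem quadVal_smul (a : ℝ) (Q : Matrix ι ι ℝ) (x : ι → ℝ) :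
    quadVal (a • Q) x = a * quadVal Q x := by
  simp [quadVal, Matrix.smul_mulVec]

theorem quadVal_smul_vec (a : ℝ) (Q : Matrix ι ι ℝ) (x : ι → ℝ) :
    quadVal Q (a • x) = a ^ 2 * quadVal Q x := by
  simp [quadVal, Matrix.mulVec_smul]
  ring

theorem quadVal_transpose_mul_mul (B M : Matrix ι ι ℝ) (x : ι → ℝ) :
    quadVal (Bᵀ * M * B) x = quadVal M (B *ᵥ x) := by
  simp only [quadVal, ← Matrix.mulVec_mulVec, Matrix.dotProduct_mulVec, Matrix.vecMul_transpose]

theorem continuous_quadVal :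
    Continuous fun p : Matrix ι ι ℝ × (ι → ℝ) => quadVal p.1 p.2 := by
  unfold quadVal
  fun_prop

theorem posSemidef_of_quadVal_nonneg {Q : Matrix ι ι ℝ} (hs : Q.IsSymm)
    (h : ∀ x, 0 ≤ quadVal Q x) : Q.PosSemidef := by
  refine Matrix.PosSemidef.of_dotProduct_mulVec_nonneg ?_ fun x => by simpa [quadVal] using h x
  rw [Matrix.IsHermitian, Matrix.conjTranspose_eq_transpose_of_trivial]
  exact hs

/-- Some multiple of a vector is close to a nonzero integer vector. -/
theorem exists_int_near_multiple {v : ι → ℝ} (hv : v ≠ 0) {ε : ℝ} (hε : 0 < ε) :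
    ∃ (a : ℝ) (z : ι → ℤ), z ≠ 0 ∧ ‖intVec z - a • v‖ < ε := by
  obtain ⟨i, hi⟩ := Function.ne_iff.mp hv
  have hi' : 0 < |v i| := abs_pos.mpr hi
  set w : ι → ℝ := (2 / |v i|) • v with hw
  have hwi : |w i| = 2 := by
    simp [hw, abs_mul, abs_div, hi'.ne']
  set f : ℕ → ι → ℝ := fun k j => Int.fract (k * w j) with hf
  obtain ⟨a, -, φ, hφ, hlim⟩ :=
    (isCompact_univ_pi fun _ : ι => isCompact_Icc (a := (0 : ℝ)) (b := 1)).tendsto_subseq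
      (x := f) (fun k => by
        intro j _
        exact ⟨Int.fract_nonneg _, (Int.fract_lt_one _).le⟩)
  obtain ⟨N, hN⟩ := Metric.cauchySeq_iff'.mp hlim.cauchySeq (min ε 1) (by positivity)
  have hlt := hN (N + 1) (by omega)
  have hmono : φ N < φ (N + 1) := hφ (by omega)
  rw [dist_eq_norm] at hlt
  set k := φ N
  set l := φ (N + 1)
  refine ⟨((l : ℝ) - k) * (2 / |v i|), fun j => ⌊l * w j⌋ - ⌊k * w j⌋, ?_, ?_⟩
  · intro h0
    have h1 := congrFun h0 i
    have h2 : ((⌊l * w i⌋ : ℤ) : ℝ) - ⌊k * w i⌋ = 0 := by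
      have := congrArg (Int.cast : ℤ → ℝ) h1
      simpa using this
    have h3 : f l i - f k i = (l - k) * w i := by
      simp only [hf, Int.fract]
      linarith
    have h4 : |f l i - f k i| < 1 :=
      lt_of_le_of_lt (norm_le_pi_norm (f l - f k) i) (hlt.trans_le (min_le_right _ _))
    rw [h3, abs_mul, hwi] at h4
    have h5 : (1 : ℝ) ≤ (l : ℝ) - k := by
      have : (k : ℝ) + 1 ≤ l := by exact_mod_cast hmono
      linarith
    rw [abs_of_pos (by linarith)] at h4
    linarith
  · have : intVec (fun j => ⌊l * w j⌋ - ⌊k * w j⌋) - (((l : ℝ) - k) * (2 / |v i|)) • v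
        = -(f l - f k) := by
      funext j
      simp only [intVec, hf, hw, Int.fract, Pi.sub_apply, Pi.neg_apply, Pi.smul_apply, smul_eq_mul,
        Int.cast_sub]
      ring
    rw [this, norm_neg]
    exact hlt.trans_le (min_le_left _ _)

theorem quadVal_pos_of_one_le {Q : Matrix ι ι ℝ} (hs : Q.IsSymm) (h0 : ∀ x, 0 ≤ quadVal Q x)
    (h1 : ∀ z : ι → ℤ, z ≠ 0 → 1 ≤ quadVal Q (intVec z)) {v : ι → ℝ} (hv : v ≠ 0) :
    0 < quadVal Q v := by
  refine lt_of_le_of_ne (h0 v) fun h => ?_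
  have hps := posSemidef_of_quadVal_nonneg hs h0
  have hker : Q *ᵥ v = 0 := (hps.dotProduct_mulVec_zero_iff v).mp (by simpa [quadVal] using h.symm)
  have hcont : Continuous (quadVal Q) :=
    continuous_quadVal.comp (Continuous.prodMk continuous_const continuous_id)
  have hz : quadVal Q 0 = 0 := by simp [quadVal]
  obtain ⟨ε, hε, hball⟩ := Metric.continuousAt_iff.mp (hcont.continuousAt (x := 0)) 1 one_pos
  obtain ⟨a, z, hz0, hz1⟩ := exists_int_near_multiple hv hε
  have h2 := hball (x := intVec z - a • v) (by simpa using hz1)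
  have h3 : quadVal Q (intVec z - a • v) = quadVal Q (intVec z) := by
    have h4 : Q *ᵥ (a • v) = 0 := by rw [Matrix.mulVec_smul, hker, smul_zero]
    have h5 : (a • v) ⬝ᵥ Q *ᵥ intVec z = 0 := by
      rw [Matrix.dotProduct_mulVec, ← Matrix.mulVec_transpose, hs.eq, h4, zero_dotProduct]
    simp only [quadVal, Matrix.mulVec_sub, h4, sub_zero, sub_dotProduct, h5]
  rw [h3, hz, Real.dist_eq, sub_zero, abs_of_nonneg (h0 _)] at h2
  exact absurd (h1 z hz0) (not_le.mpr h2)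

theorem finite_norm_sq_le (C : ℝ) : {z : ι → ℤ | ‖intVec z‖ ^ 2 ≤ C}.Finite := by
  refine (Set.Finite.pi' fun _ : ι => Set.finite_Icc (-⌈|C| + 1⌉) ⌈|C| + 1⌉).subset fun z hz i => ?_
  have h1 : |(z i : ℝ)| ≤ ‖intVec z‖ := norm_le_pi_norm (intVec z) i
  have h2 : ‖intVec z‖ ≤ |C| + 1 := by
    have hz' : ‖intVec z‖ ^ 2 ≤ C := hz
    nlinarith [le_abs_self C, abs_nonneg C, norm_nonneg (intVec z)]
  have h3 := abs_le.mp ((h1.trans h2).trans (Int.le_ceil _))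
  exact ⟨by exact_mod_cast h3.1, by exact_mod_cast h3.2⟩

variable [DecidableEq ι]

theorem quadVal_one (x : ι → ℝ) : quadVal 1 x = x ⬝ᵥ x := by simp [quadVal]

theorem abs_apply_le_trace {Q : Matrix ι ι ℝ} (hs : Q.IsSymm) (h0 : ∀ x, 0 ≤ quadVal Q x)
    (i j : ι) : |Q i j| ≤ Q.trace := by
  have hd : ∀ i, 0 ≤ Q i i := fun i => by
    simpa [quadVal] using h0 (Pi.single i 1)
  have htr : ∀ i, Q i i ≤ Q.trace := fun i =>
    Finset.single_le_sum (f := fun i => Q i i) (fun i _ => hd i) (Finset.mem_univ i)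
  have hp := h0 (Pi.single i 1 + Pi.single j 1)
  have hm := h0 (Pi.single i 1 - Pi.single j 1)
  have hsym : Q j i = Q i j := hs.apply i j
  simp [quadVal, Matrix.mulVec_add, Matrix.mulVec_sub, hsym] at hp hm
  rw [abs_le]
  constructor <;> linarith [htr i, htr j]

theorem isCompact_admissibleForms (t : ℝ) : IsCompact (admissibleForms ι t) := by
  have hq : ∀ x : ι → ℝ, Continuous fun Q : Matrix ι ι ℝ => quadVal Q x := fun x =>
    continuous_quadVal.comp (Continuous.prodMk continuous_id continuous_const)
  have hclosed : IsClosed (admissibleForms ι t) := by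
    have : admissibleForms ι t = {Q | Qᵀ = Q} ∩ ((⋂ x, {Q | 0 ≤ quadVal Q x}) ∩ ({Q | Q.trace = t} ∩
        ⋂ z : ι → ℤ, ⋂ _ : z ≠ 0, {Q | 1 ≤ quadVal Q (intVec z)})) := by
      ext Q
      simp [admissibleForms, Matrix.IsSymm]
    rw [this]
    refine (isClosed_eq (by fun_prop) continuous_id).inter ((isClosed_iInter fun x =>
      isClosed_le continuous_const (hq x)).inter ((isClosed_eq (by fun_prop) continuous_const).inter
      (isClosed_iInter fun z => isClosed_iInter fun _ => isClosed_le continuous_const (hq _))))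
  have hK : IsCompact (Set.univ.pi fun _ : ι => Set.univ.pi fun _ : ι => Set.Icc (-t) t) :=
    isCompact_univ_pi fun _ => isCompact_univ_pi fun _ => isCompact_Icc
  refine hK.of_isClosed_subset hclosed ?_
  rintro Q ⟨hs, h0, ht, -⟩ i - j -
  have := abs_apply_le_trace hs h0 i j
  rw [ht] at this
  exact abs_le.mp this

/-- Admissible forms of bounded trace are uniformly positive definite. -/
theorem exists_uniform_lower_bound [Nonempty ι] {t : ℝ} (hne : (admissibleForms ι t).Nonempty) :
    ∃ c : ℝ, 0 < c ∧ ∀ Q ∈ admissibleForms ι t, ∀ x, c * ‖x‖ ^ 2 ≤ quadVal Q x := by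
  have hK := (isCompact_admissibleForms (ι := ι) t).prod (isCompact_sphere (0 : ι → ℝ) 1)
  have hK' : (admissibleForms ι t ×ˢ Metric.sphere (0 : ι → ℝ) 1).Nonempty :=
    hne.prod (NormedSpace.sphere_nonempty.mpr zero_le_one)
  obtain ⟨⟨Q₀, x₀⟩, ⟨hQ₀, hx₀⟩, hmin⟩ := hK.exists_isMinOn hK' continuous_quadVal.continuousOn
  have hx₀' : x₀ ≠ 0 := by
    rintro rfl
    simp at hx₀
  refine ⟨quadVal Q₀ x₀, quadVal_pos_of_one_le hQ₀.1 hQ₀.2.1 hQ₀.2.2.2 hx₀', fun Q hQ x => ?_⟩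
  rcases eq_or_ne x 0 with rfl | hx
  · simp [quadVal]
  have hn : 0 < ‖x‖ := norm_pos_iff.mpr hx
  have h1 : quadVal Q₀ x₀ ≤ quadVal Q (‖x‖⁻¹ • x) :=
    hmin (show (Q, ‖x‖⁻¹ • x) ∈ _ from ⟨hQ, by simp [norm_smul, hn.ne']⟩)
  rw [quadVal_smul_vec] at h1
  calc quadVal Q₀ x₀ * ‖x‖ ^ 2 ≤ (‖x‖⁻¹ ^ 2 * quadVal Q x) * ‖x‖ ^ 2 := by gcongr
    _ = quadVal Q x := by field_simp

end Forms

theorem Matrix.PosSemidef.exists_eq_transpose_mul_self {ι : Type*} [Fintype ι] [DecidableEq ι]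
    {Q : Matrix ι ι ℝ} (hQ : Q.PosSemidef) : ∃ B : Matrix ι ι ℝ, Q = Bᵀ * B := by
  open scoped MatrixOrder Matrix.Norms.L2Operator in
  obtain ⟨B, hB⟩ := CStarAlgebra.nonneg_iff_eq_star_mul_self.mp hQ.nonneg
  exact ⟨B, by rw [hB, Matrix.star_eq_conjTranspose, Matrix.conjTranspose_eq_transpose_of_trivial]⟩

theorem Matrix.PosSemidef.det_le_exp_trace_sub_card {ι : Type*} [Fintype ι] [DecidableEq ι]
    {Q : Matrix ι ι ℝ} (hQ : Q.PosSemidef) : Q.det ≤ Real.exp (Q.trace - Fintype.card ι) := by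
  have h1 := hQ.isHermitian.det_eq_prod_eigenvalues
  have h2 := hQ.isHermitian.trace_eq_sum_eigenvalues
  simp only [RCLike.ofReal_real_eq_id, id_eq] at h1 h2
  rw [h1, h2, show ∑ i, hQ.isHermitian.eigenvalues i - (Fintype.card ι : ℝ) =
    ∑ i, (hQ.isHermitian.eigenvalues i - 1) by simp, Real.exp_sum]
  refine Finset.prod_le_prod (fun i _ => hQ.eigenvalues_nonneg i) fun i _ => ?_
  linarith [Real.add_one_le_exp (hQ.isHermitian.eigenvalues i - 1)]

section

variable {ι : Type*} [Fintype ι]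

theorem dotProduct_mulVec_self_le (M : Matrix ι ι ℝ) (x : ι → ℝ) :
    (M *ᵥ x) ⬝ᵥ (M *ᵥ x) ≤ (∑ i, ∑ j, M i j ^ 2) * (x ⬝ᵥ x) := by
  rw [Finset.sum_mul]
  refine Finset.sum_le_sum fun i _ => ?_
  have := Finset.sum_mul_sq_le_sq_mul_sq Finset.univ (fun j => M i j) x
  simp only [Matrix.mulVec, dotProduct, ← sq]
  exact this

theorem abs_quadVal_le {M : Matrix ι ι ℝ} (hM : ∑ i, ∑ j, M i j ^ 2 ≤ 1) (x : ι → ℝ) :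
    |quadVal M x| ≤ x ⬝ᵥ x := by
  have h1 := dotProduct_mulVec_self_le M x
  have h0 : 0 ≤ x ⬝ᵥ x := Finset.sum_nonneg fun i _ => mul_self_nonneg _
  have h2 : quadVal M x ^ 2 ≤ (x ⬝ᵥ x) * ((M *ᵥ x) ⬝ᵥ (M *ᵥ x)) := by
    have := Finset.sum_mul_sq_le_sq_mul_sq Finset.univ x (M *ᵥ x)
    simpa only [quadVal, dotProduct, ← sq] using this
  refine abs_le_of_sq_le_sq ?_ h0
  nlinarith

variable [DecidableEq ι]

theorem det_one_add_mul_det_one_sub_le {M : Matrix ι ι ℝ} (hs : M.IsSymm)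
    (hM : ∑ i, ∑ j, M i j ^ 2 = 1) {s : ℝ} (hs1 : |s| ≤ 1) :
    (1 + s • M).det * (1 - s • M).det ≤ Real.exp (-s ^ 2) := by
  have hX : (1 + s • M) * (1 - s • M) = 1 - s ^ 2 • (M * M) := by
    simp only [mul_sub, add_mul, one_mul, mul_one, smul_mul_assoc, mul_smul_comm, smul_add, smul_smul, sq]
    abel
  have hsymm : (1 - s ^ 2 • (M * M)).IsSymm := by
    simp [Matrix.IsSymm, Matrix.transpose_sub, Matrix.transpose_smul, Matrix.transpose_mul, hs.eq]
  have hpos : (1 - s ^ 2 • (M * M)).PosSemidef := by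
    refine posSemidef_of_quadVal_nonneg hsymm fun x => ?_
    have h1 : quadVal (1 - s ^ 2 • (M * M)) x = x ⬝ᵥ x - s ^ 2 * ((M *ᵥ x) ⬝ᵥ (M *ᵥ x)) := by
      rw [sub_eq_add_neg, ← neg_smul, quadVal_add, quadVal_smul, quadVal_one]
      have : quadVal (M * M) x = (M *ᵥ x) ⬝ᵥ (M *ᵥ x) := by
        rw [quadVal, ← Matrix.mulVec_mulVec, Matrix.dotProduct_mulVec, ← Matrix.mulVec_transpose,
          hs.eq]
      rw [this]
      ring
    have h2 := dotProduct_mulVec_self_le M x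
    rw [hM, one_mul] at h2
    have h3 : s ^ 2 ≤ 1 := by simpa using (sq_le_one_iff_abs_le_one s).mpr hs1
    have h4 : 0 ≤ (M *ᵥ x) ⬝ᵥ (M *ᵥ x) := Finset.sum_nonneg fun i _ => mul_self_nonneg _
    rw [h1]
    nlinarith
  have htr : (M * M).trace = 1 := by
    rw [← hM]
    simp only [Matrix.trace, Matrix.diag, Matrix.mul_apply]
    exact Finset.sum_congr rfl fun i _ => Finset.sum_congr rfl fun j _ => by
      rw [hs.apply i j, sq]
  rw [← Matrix.det_mul, hX]
  refine hpos.det_le_exp_trace_sub_card.trans_eq ?_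
  rw [Matrix.trace_sub, Matrix.trace_smul, htr, Matrix.trace_one]
  congr 1
  simp

end

/-- Many orthonormal symmetric matrices satisfy a given system of linear conditions. -/
theorem exists_orthonormal_symm {ι κ : Type*} [Fintype ι] [LinearOrder ι] [Fintype κ]
    (L : EuclideanSpace ℝ (ι × ι) →ₗ[ℝ] (κ → ℝ)) :
    ∃ (k : ℕ) (v : Fin k → EuclideanSpace ℝ (ι × ι)),
      Fintype.card ι * (Fintype.card ι + 1) ≤ 2 * (k + Fintype.card κ) ∧ Orthonormal ℝ v ∧
      ∀ j, L (v j) = 0 ∧ ∀ a b, v j (a, b) = v j (b, a) := by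
  let P := {p : ι × ι // p.1 < p.2}
  let A : EuclideanSpace ℝ (ι × ι) →ₗ[ℝ] (P → ℝ) :=
    { toFun := fun v p => v (p.1.1, p.1.2) - v (p.1.2, p.1.1)
      map_add' := fun v w => by funext p; simp; ring
      map_smul' := fun a v => by funext p; simp; ring }
  let T := A.prod L
  let U := LinearMap.ker T
  have hP : 2 * Fintype.card P + Fintype.card ι = Fintype.card ι * Fintype.card ι := by
    have h1 : Fintype.card P = (Finset.univ.filter fun p : ι × ι => p.1 < p.2).card :=
      Fintype.card_subtype _
    have h2 : (Finset.univ.filter fun p : ι × ι => p.2 < p.1).card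
        = (Finset.univ.filter fun p : ι × ι => p.1 < p.2).card :=
      Finset.card_equiv (Equiv.prodComm ι ι) (by simp)
    have h3 : (Finset.univ.filter fun p : ι × ι => p.1 = p.2).card = Fintype.card ι := by
      rw [← Finset.card_univ]
      symm
      refine Finset.card_bij (fun i _ => (i, i)) (by simp) (by simp) ?_
      rintro ⟨a, b⟩ h
      simp at h
      exact ⟨a, by simp [h]⟩
    have h4 := Finset.card_filter_add_card_filter_not (s := (Finset.univ : Finset (ι × ι)))
      (fun p => p.1 < p.2)
    have h5 := Finset.card_filter_add_card_filter_not
      (s := (Finset.univ.filter fun p : ι × ι => ¬ p.1 < p.2)) (fun p => p.1 = p.2)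
    rw [Finset.filter_filter, Finset.filter_filter] at h5
    have h6 : (Finset.univ.filter fun p : ι × ι => ¬ p.1 < p.2 ∧ p.1 = p.2)
        = Finset.univ.filter fun p : ι × ι => p.1 = p.2 := by
      ext p
      simp +contextual
    have h7 : (Finset.univ.filter fun p : ι × ι => ¬ p.1 < p.2 ∧ ¬ p.1 = p.2)
        = Finset.univ.filter fun p : ι × ι => p.2 < p.1 := by
      ext p
      simp only [Finset.mem_filter, Finset.mem_univ, true_and, not_lt]
      exact ⟨fun h => lt_of_le_of_ne h.1 (Ne.symm h.2), fun h => ⟨h.le, h.ne'⟩⟩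
    rw [h6, h7, h2, h3] at h5
    rw [Finset.card_univ, Fintype.card_prod] at h4
    omega
  have hdim : Fintype.card ι * Fintype.card ι ≤
      Fintype.card P + Fintype.card κ + Module.finrank ℝ U := by
    have h1 := LinearMap.finrank_range_add_finrank_ker T
    have h2 : Module.finrank ℝ (LinearMap.range T) ≤ Fintype.card P + Fintype.card κ := by
      refine (Submodule.finrank_le _).trans ?_
      simp
    rw [finrank_euclideanSpace, Fintype.card_prod] at h1
    change _ + Module.finrank ℝ U = _ at h1
    omega
  let b := stdOrthonormalBasis ℝ U
  refine ⟨Module.finrank ℝ U, fun j => (b j : EuclideanSpace ℝ (ι × ι)), ?_, ?_, fun j => ?_⟩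
  · nlinarith
  · exact b.orthonormal.comp_linearIsometry U.subtypeₗᵢ
  · have h : T (b j) = 0 := LinearMap.mem_ker.mp (b j).2
    have hA : A (b j) = 0 := congrArg Prod.fst h
    have hs : ∀ a c, a < c →
        (b j : EuclideanSpace ℝ (ι × ι)) (a, c) = (b j : EuclideanSpace ℝ (ι × ι)) (c, a) := by
      intro a c hac
      have := congrFun hA ⟨(a, c), hac⟩
      exact sub_eq_zero.mp this
    refine ⟨congrArg Prod.snd h, fun a c => ?_⟩
    rcases lt_trichotomy a c with h | rfl | h
    · exact hs a c h
    · rfl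
    · exact (hs c a h).symm

/-- The second-order upper bound for the even part of an inverse power. -/
theorem exists_inv_pow_add_inv_pow_le (n : ℕ) : ∃ δ : ℝ, 0 < δ ∧ δ < 1 ∧ ∀ w : ℝ, |w| ≤ δ →
    ((1 + w) ^ n)⁻¹ + ((1 - w) ^ n)⁻¹ ≤ 2 + ((n : ℝ) * (n + 1) + 1) * w ^ 2 := by
  have key : ∀ n : ℕ, ∃ C : ℝ, 0 ≤ C ∧ ∀ w : ℝ, |w| ≤ 1 / 2 →
      ((1 + w) ^ n)⁻¹ ≤ 1 - n * w + (n * (n + 1) / 2 : ℝ) * w ^ 2 + C * |w| ^ 3 := by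
    intro n
    induction n with
    | zero => exact ⟨0, le_rfl, fun w _ => by simp⟩
    | succ n ih =>
      obtain ⟨C, hC, h⟩ := ih
      refine ⟨2 * C + (n * (n + 1) / 2 + n + 2) * 4, by positivity, fun w hw => ?_⟩
      have hw' := abs_le.mp hw
      have hp : 0 < 1 + w := by linarith
      rw [pow_succ, mul_inv, ← div_eq_mul_inv, div_le_iff₀ hp]
      refine (h w hw).trans ?_
      have h3 : |w| ^ 3 = |w| * w ^ 2 := by rw [pow_succ', sq_abs]
      have h4 : w * w ^ 2 ≤ |w| ^ 3 := by
        rw [h3]; exact mul_le_mul_of_nonneg_right (le_abs_self w) (sq_nonneg w)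
      have h5 : -(w * w ^ 2) ≤ |w| ^ 3 := by
        rw [h3, ← neg_mul]; exact mul_le_mul_of_nonneg_right (neg_le_abs w) (sq_nonneg w)
      have h6 : 0 ≤ |w| ^ 3 := by positivity
      have h7 : 0 ≤ (n : ℝ) := by positivity
      push_cast
      set t := |w| ^ 3
      set m : ℝ := (n : ℝ)
      have e : (1 - (m + 1) * w + ((m + 1) * (m + 1 + 1) / 2) * w ^ 2
          + (2 * C + (m * (m + 1) / 2 + m + 2) * 4) * t) * (1 + w)
          - (1 - m * w + (m * (m + 1) / 2) * w ^ 2 + C * t)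
          = ((m + 1) * (m + 2) / 2) * (w * w ^ 2)
            + C * t * (1 + 2 * w) + (m * (m + 1) / 2 + m + 2) * 4 * t * (1 + w) := by
        ring
      have e1 : 0 ≤ C * t * (1 + 2 * w) := by
        have : 0 ≤ 1 + 2 * w := by linarith
        positivity
      have e2 : (m * (m + 1) / 2 + m + 2) * 2 * t ≤ (m * (m + 1) / 2 + m + 2) * 4 * t * (1 + w) := by
        have : 0 ≤ (m * (m + 1) / 2 + m + 2) * t := by positivity
        nlinarith
      have e3 : -(((m + 1) * (m + 2) / 2) * (w * w ^ 2)) ≤ ((m + 1) * (m + 2) / 2) * t := by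
        rw [← mul_neg]
        exact mul_le_mul_of_nonneg_left h5 (by positivity)
      have e4 : ((m + 1) * (m + 2) / 2) * t ≤ (m * (m + 1) / 2 + m + 2) * 2 * t := by
        refine mul_le_mul_of_nonneg_right ?_ h6
        nlinarith
      linarith
  obtain ⟨C, hC, h⟩ := key n
  refine ⟨1 / (2 * C + 2), by positivity, ?_, fun w hw => ?_⟩
  · rw [div_lt_one (by positivity)]; linarith
  have hw2 : |w| ≤ 1 / 2 := hw.trans (by
    rw [div_le_div_iff₀ (by positivity) (by positivity)]; linarith)
  have h1 := h w hw2
  have h2 := h (-w) (by rwa [abs_neg])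
  rw [abs_neg, ← sub_eq_add_neg, neg_sq] at h2
  have h3 : 2 * C * |w| ^ 3 ≤ w ^ 2 := by
    have h4 : 2 * C * |w| ≤ 1 := by
      rw [le_div_iff₀ (by positivity)] at hw
      nlinarith [abs_nonneg w]
    calc 2 * C * |w| ^ 3 = (2 * C * |w|) * w ^ 2 := by rw [pow_succ', sq_abs]; ring
      _ ≤ 1 * w ^ 2 := by gcongr
      _ = w ^ 2 := one_mul _
  linarith

section Optimization

variable {ι : Type*} [Fintype ι]

/-- The energy of a form: a finite sum of inverse powers of its values. -/
noncomputable def formEnergy (F : Finset (ι → ℤ)) (n : ℕ) (Q : Matrix ι ι ℝ) : ℝ :=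
  ∑ z ∈ F, (quadVal Q (intVec z) ^ n)⁻¹

theorem formEnergy_pos {F : Finset (ι → ℤ)} (hF : F.Nonempty) {n : ℕ} {Q : Matrix ι ι ℝ}
    (h : ∀ z ∈ F, 0 < quadVal Q (intVec z)) : 0 < formEnergy F n Q :=
  Finset.sum_pos (fun z hz => inv_pos.mpr (pow_pos (h z hz) n)) hF

/-- Perturbing an admissible form in a direction orthogonal to its minimal vectors. -/
theorem add_smul_mem_admissibleForms {t : ℝ} {B M : Matrix ι ι ℝ}
    (hQ : Bᵀ * B ∈ admissibleForms ι t) (hs : M.IsSymm) (hM : ∑ i, ∑ j, M i j ^ 2 ≤ 1)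
    (htr : (Bᵀ * M * B).trace = 0)
    (hcontact : ∀ z : ι → ℤ, z ≠ 0 → quadVal (Bᵀ * B) (intVec z) = 1 →
      quadVal M (B *ᵥ intVec z) = 0)
    {s : ℝ} (hs1 : |s| ≤ 1)
    (hgap : ∀ z : ι → ℤ, z ≠ 0 → quadVal (Bᵀ * B) (intVec z) ≠ 1 →
      1 ≤ (1 - |s|) * quadVal (Bᵀ * B) (intVec z)) :
    Bᵀ * B + s • (Bᵀ * M * B) ∈ admissibleForms ι t := by
  have hBB : ∀ x, quadVal (Bᵀ * B) x = (B *ᵥ x) ⬝ᵥ (B *ᵥ x) := fun x => by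
    simp only [quadVal, ← Matrix.mulVec_mulVec, Matrix.dotProduct_mulVec, Matrix.vecMul_transpose]
  have hlow : ∀ x, (1 - |s|) * quadVal (Bᵀ * B) x ≤ quadVal (Bᵀ * B + s • (Bᵀ * M * B)) x := by
    intro x
    rw [quadVal_add, quadVal_smul, quadVal_transpose_mul_mul]
    have h1 := abs_quadVal_le hM (B *ᵥ x)
    rw [← hBB] at h1
    have h2 : |s * quadVal M (B *ᵥ x)| ≤ |s| * quadVal (Bᵀ * B) x := by
      rw [abs_mul]; gcongr
    linarith [neg_abs_le (s * quadVal M (B *ᵥ x))]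
  refine ⟨?_, fun x => ?_, ?_, fun z hz => ?_⟩
  · simp [Matrix.IsSymm, Matrix.transpose_add, Matrix.transpose_mul, hs.eq, Matrix.mul_assoc]
  · exact (mul_nonneg (by linarith) (hQ.2.1 x)).trans (hlow x)
  · rw [Matrix.trace_add, Matrix.trace_smul, htr, smul_zero, add_zero, hQ.2.2.1]
  · by_cases h : quadVal (Bᵀ * B) (intVec z) = 1
    · rw [quadVal_add, quadVal_smul, quadVal_transpose_mul_mul, hcontact z hz h, h]
      simp
    · exact (hgap z hz h).trans (hlow _)

variable [DecidableEq ι]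

theorem det_pos_of_mem_admissibleForms {t : ℝ} {Q : Matrix ι ι ℝ} (hQ : Q ∈ admissibleForms ι t) :
    0 < Q.det := by
  refine Matrix.PosDef.det_pos (Matrix.PosDef.of_dotProduct_mulVec_pos
    (posSemidef_of_quadVal_nonneg hQ.1 hQ.2.1).isHermitian fun x hx => ?_)
  simpa [quadVal] using quadVal_pos_of_one_le hQ.1 hQ.2.1 hQ.2.2.2 hx

theorem exists_min_energy (F : Finset (ι → ℤ)) (hF0 : ∀ z ∈ F, z ≠ 0) (n : ℕ) {t : ℝ}
    (hne : (admissibleForms ι t).Nonempty) :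
    ∃ Q ∈ admissibleForms ι t, ∀ R ∈ admissibleForms ι t,
      formEnergy F n Q ^ 5 * Q.det ^ 4 ≤ formEnergy F n R ^ 5 * R.det ^ 4 := by
  have hq : ∀ x : ι → ℝ, Continuous fun Q : Matrix ι ι ℝ => quadVal Q x := fun x =>
    continuous_quadVal.comp (Continuous.prodMk continuous_id continuous_const)
  have hc : ContinuousOn (fun Q : Matrix ι ι ℝ => formEnergy F n Q ^ 5 * Q.det ^ 4)
      (admissibleForms ι t) := by
    refine ContinuousOn.mul (ContinuousOn.pow ?_ 5)
      ((Continuous.matrix_det continuous_id).pow 4).continuousOn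
    refine continuousOn_finsetSum _ fun z hz => ?_
    refine ContinuousOn.inv₀ ((hq _).pow n).continuousOn fun Q hQ => ?_
    exact pow_ne_zero _ (zero_lt_one.trans_le (hQ.2.2.2 z (hF0 z hz))).ne'
  obtain ⟨Q, hQ, hmin⟩ := (isCompact_admissibleForms t).exists_isMinOn hne hc
  exact ⟨Q, hQ, fun R hR => hmin hR⟩

/-- At an energy minimizer, the mean energy of two opposite perturbations is large. -/
theorem energy_add_energy_sub_ge {t : ℝ} {B M : Matrix ι ι ℝ} {F : Finset (ι → ℤ)} {n : ℕ}
    (hFne : F.Nonempty) (hF0 : ∀ z ∈ F, z ≠ 0)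
    (hQ : Bᵀ * B ∈ admissibleForms ι t)
    (hmin : ∀ R ∈ admissibleForms ι t,
      formEnergy F n (Bᵀ * B) ^ 5 * (Bᵀ * B).det ^ 4 ≤ formEnergy F n R ^ 5 * R.det ^ 4)
    (hs : M.IsSymm) (hM : ∑ i, ∑ j, M i j ^ 2 = 1) {s : ℝ} (hs1 : |s| ≤ 1)
    (hp : Bᵀ * B + s • (Bᵀ * M * B) ∈ admissibleForms ι t)
    (hm : Bᵀ * B + (-s) • (Bᵀ * M * B) ∈ admissibleForms ι t) :
    formEnergy F n (Bᵀ * B) * (2 + 4 / 5 * s ^ 2) ≤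
      formEnergy F n (Bᵀ * B + s • (Bᵀ * M * B)) +
        formEnergy F n (Bᵀ * B + (-s) • (Bᵀ * M * B)) := by
  have hen : ∀ R ∈ admissibleForms ι t, 0 < formEnergy F n R := fun R hR =>
    formEnergy_pos hFne fun z hz => zero_lt_one.trans_le (hR.2.2.2 z (hF0 z hz))
  have h1 := hmin _ hp
  have h2 := hmin _ hm
  have d0 := det_pos_of_mem_admissibleForms hQ
  have d1 := det_pos_of_mem_admissibleForms hp
  have d2 := det_pos_of_mem_admissibleForms hm
  have e0 := hen _ hQ
  have e1 := hen _ hp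
  have e2 := hen _ hm
  have hd : (Bᵀ * B + s • (Bᵀ * M * B)).det * (Bᵀ * B + (-s) • (Bᵀ * M * B)).det
      ≤ (Bᵀ * B).det ^ 2 * Real.exp (-s ^ 2) := by
    have f1 : Bᵀ * B + s • (Bᵀ * M * B) = Bᵀ * (1 + s • M) * B := by
      simp [mul_add, add_mul]
    have f2 : Bᵀ * B + (-s) • (Bᵀ * M * B) = Bᵀ * (1 - s • M) * B := by
      simp [sub_eq_add_neg, mul_add, add_mul]
    rw [f1, f2]
    simp only [Matrix.det_mul, Matrix.det_transpose]
    have := det_one_add_mul_det_one_sub_le hs hM hs1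
    calc _ = (B.det * B.det) ^ 2 * ((1 + s • M).det * (1 - s • M).det) := by ring
      _ ≤ _ := by gcongr
  set E0 := formEnergy F n (Bᵀ * B)
  set E1 := formEnergy F n (Bᵀ * B + s • (Bᵀ * M * B))
  set E2 := formEnergy F n (Bᵀ * B + (-s) • (Bᵀ * M * B))
  set D0 := (Bᵀ * B).det
  set D1 := (Bᵀ * B + s • (Bᵀ * M * B)).det
  set D2 := (Bᵀ * B + (-s) • (Bᵀ * M * B)).det
  have h3 : E0 ^ 10 * D0 ^ 8 ≤ (((E1 + E2) / 2) ^ 10 * Real.exp (-s ^ 2) ^ 4) * D0 ^ 8 := by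
    calc E0 ^ 10 * D0 ^ 8 = (E0 ^ 5 * D0 ^ 4) * (E0 ^ 5 * D0 ^ 4) := by ring
      _ ≤ (E1 ^ 5 * D1 ^ 4) * (E2 ^ 5 * D2 ^ 4) := by gcongr
      _ = (E1 * E2) ^ 5 * (D1 * D2) ^ 4 := by ring
      _ ≤ (((E1 + E2) / 2) ^ 2) ^ 5 * (D0 ^ 2 * Real.exp (-s ^ 2)) ^ 4 := by
        gcongr
        nlinarith [sq_nonneg (E1 - E2)]
      _ = _ := by ring
  have h4 := le_of_mul_le_mul_right h3 (by positivity)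
  have h5 : (E0 * Real.exp (2 / 5 * s ^ 2)) ^ 10 ≤ ((E1 + E2) / 2) ^ 10 := by
    rw [mul_pow, ← Real.exp_nat_mul]
    calc _ ≤ (((E1 + E2) / 2) ^ 10 * Real.exp (-s ^ 2) ^ 4) * Real.exp (↑(10 : ℕ) * (2 / 5 * s ^ 2)) := by
          gcongr
      _ = ((E1 + E2) / 2) ^ 10 * (Real.exp (-s ^ 2) ^ 4 * Real.exp (↑(10 : ℕ) * (2 / 5 * s ^ 2))) := by
          ring
      _ = _ := by
          rw [← Real.exp_nat_mul, ← Real.exp_add]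
          norm_num
          ring_nf
          simp
  have h6 := le_of_pow_le_pow_left₀ (by norm_num) (by positivity) h5
  have h7 : E0 * (1 + 2 / 5 * s ^ 2) ≤ E0 * Real.exp (2 / 5 * s ^ 2) := by
    gcongr
    linarith [Real.add_one_le_exp (2 / 5 * s ^ 2)]
  linarith

end Optimization

/-- An admissible form can be deformed to one with small determinant: an energy minimizer has many
minimal vectors. -/
theorem exists_admissible_small_det {ι : Type*} [Fintype ι] [LinearOrder ι] [Nonempty ι]
    {t : ℝ} {Q₀ : Matrix ι ι ℝ} (hQ₀ : Q₀ ∈ admissibleForms ι t) (n : ℕ)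
    (hE : ∀ F : Finset (ι → ℤ), (∀ z ∈ F, z ≠ 0) → formEnergy F n Q₀ ≤ 1) :
    ∃ Q ∈ admissibleForms ι t, ∃ N : ℕ, (N : ℝ) ^ 5 * Q.det ^ 4 ≤ Q₀.det ^ 4 ∧
      (Fintype.card ι : ℝ) * (Fintype.card ι + 1) ≤
        2 * (N + 1) + 5 / 2 * ((n : ℝ) * (n + 1) + 1) := by
  obtain ⟨c₀, hc₀, hlow₀⟩ := exists_uniform_lower_bound ⟨Q₀, hQ₀⟩
  obtain ⟨c, hc, hc1, hlow⟩ : ∃ c : ℝ, 0 < c ∧ c ≤ 1 ∧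
      ∀ Q ∈ admissibleForms ι t, ∀ x, c * ‖x‖ ^ 2 ≤ quadVal Q x :=
    ⟨min c₀ 1, by positivity, min_le_right _ _, fun Q hQ x =>
      (mul_le_mul_of_nonneg_right (min_le_left _ _) (sq_nonneg _)).trans (hlow₀ Q hQ x)⟩
  have hfin : {z : ι → ℤ | z ≠ 0 ∧ ‖intVec z‖ ^ 2 ≤ 2 / c}.Finite :=
    (finite_norm_sq_le (2 / c)).subset fun z hz => hz.2
  set F := hfin.toFinset with hFdef
  have hF : ∀ z, z ∈ F ↔ z ≠ 0 ∧ ‖intVec z‖ ^ 2 ≤ 2 / c := fun z => by simp [hFdef]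
  have hF0 : ∀ z ∈ F, z ≠ 0 := fun z hz => ((hF z).mp hz).1
  have hFne : F.Nonempty := by
    obtain ⟨i⟩ := ‹Nonempty ι›
    refine ⟨Pi.single i 1, (hF _).mpr ⟨by simp, ?_⟩⟩
    have h1 : ‖intVec (Pi.single i (1 : ℤ))‖ ≤ 1 := by
      refine (pi_norm_le_iff_of_nonneg zero_le_one).mpr fun j => ?_
      by_cases h : j = i
      · subst h; simp [intVec]
      · simp [intVec, h]
    rw [le_div_iff₀ hc]
    nlinarith [norm_nonneg (intVec (Pi.single i (1 : ℤ)))]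
  obtain ⟨Q, hQ, hmin⟩ := exists_min_energy F hF0 n ⟨Q₀, hQ₀⟩
  obtain ⟨B, rfl⟩ := (posSemidef_of_quadVal_nonneg hQ.1 hQ.2.1).exists_eq_transpose_mul_self
  have hBB : ∀ x, quadVal (Bᵀ * B) x = (B *ᵥ x) ⬝ᵥ (B *ᵥ x) := fun x => by
    simp only [quadVal, ← Matrix.mulVec_mulVec, Matrix.dotProduct_mulVec, Matrix.vecMul_transpose]
  set q : (ι → ℤ) → ℝ := fun z => quadVal (Bᵀ * B) (intVec z) with hq
  have hq1 : ∀ z, z ≠ 0 → 1 ≤ q z := hQ.2.2.2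
  have hq2 : ∀ z, z ≠ 0 → z ∉ F → 2 ≤ q z := by
    intro z hz hzF
    have h1 : 2 / c < ‖intVec z‖ ^ 2 := by
      by_contra h
      exact hzF ((hF z).mpr ⟨hz, not_lt.mp h⟩)
    rw [div_lt_iff₀ hc] at h1
    have h2 := hlow _ hQ (intVec z)
    simp only [hq]
    linarith
  set K := F.filter fun z => q z = 1 with hK
  -- a gap above the minimum
  obtain ⟨μ, hμ1, hμ2, hμ⟩ : ∃ μ : ℝ, 1 < μ ∧ μ ≤ 2 ∧ ∀ z, z ≠ 0 → q z ≠ 1 → μ ≤ q z := by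
    by_cases hne : (F.filter fun z => q z ≠ 1).Nonempty
    · obtain ⟨z₀, hz₀, hz₀min⟩ := Finset.exists_min_image _ q hne
      rw [Finset.mem_filter] at hz₀
      have h1 : 1 < q z₀ := lt_of_le_of_ne (hq1 _ (hF0 _ hz₀.1)) (Ne.symm hz₀.2)
      refine ⟨min (q z₀) 2, lt_min h1 one_lt_two, min_le_right _ _, fun z hz hz1 => ?_⟩
      by_cases hzF : z ∈ F
      · exact (min_le_left _ _).trans (hz₀min z (Finset.mem_filter.mpr ⟨hzF, hz1⟩))
      · exact (min_le_right _ _).trans (hq2 z hz hzF)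
    · refine ⟨2, one_lt_two, le_rfl, fun z hz hz1 => ?_⟩
      by_cases hzF : z ∈ F
      · exact absurd ⟨z, Finset.mem_filter.mpr ⟨hzF, hz1⟩⟩ hne
      · exact hq2 z hz hzF
  obtain ⟨δ, hδ, hδ1, hpow⟩ := exists_inv_pow_add_inv_pow_le n
  obtain ⟨s, hs0, hsδ, hsμ⟩ : ∃ s : ℝ, 0 < s ∧ s ≤ δ ∧ 1 ≤ (1 - s) * μ := by
    refine ⟨min δ ((μ - 1) / μ), lt_min hδ (div_pos (by linarith) (by linarith)),
      min_le_left _ _, ?_⟩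
    have h1 : min δ ((μ - 1) / μ) * μ ≤ μ - 1 := by
      calc _ ≤ (μ - 1) / μ * μ := by gcongr; exact min_le_right _ _
        _ = μ - 1 := by field_simp
    linarith
  -- the linear conditions on perturbations
  let L : EuclideanSpace ℝ (ι × ι) →ₗ[ℝ] (Option K → ℝ) :=
    { toFun := fun v o => match o with
        | none => (Bᵀ * Matrix.of (fun a b => v (a, b)) * B).trace
        | some z => quadVal (Matrix.of fun a b => v (a, b)) (B *ᵥ intVec z.1)
      map_add' := fun v w => by
        have h : (Matrix.of fun a b => (v + w) (a, b)) =
          Matrix.of (fun a b => v (a, b)) + Matrix.of fun a b => w (a, b) := by ext; simp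
        funext o
        rcases o with _ | z
        · simp only [h, Pi.add_apply, mul_add, add_mul, Matrix.trace_add]
        · simp only [h, Pi.add_apply, quadVal_add]
      map_smul' := fun r v => by
        have h : (Matrix.of fun a b => (r • v) (a, b)) = r • Matrix.of fun a b => v (a, b) := by
          ext; simp
        funext o
        rcases o with _ | z
        · simp only [h, Pi.smul_apply, smul_eq_mul, RingHom.id_apply, Matrix.mul_smul,
            Matrix.smul_mul, Matrix.trace_smul]
        · simp only [h, Pi.smul_apply, smul_eq_mul, RingHom.id_apply, quadVal_smul] }
  obtain ⟨k, v, hk, hv, hvL⟩ := exists_orthonormal_symm L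
  set M : Fin k → Matrix ι ι ℝ := fun j => Matrix.of fun a b => v j (a, b) with hMdef
  have hMs : ∀ j, (M j).IsSymm := fun j => Matrix.IsSymm.ext fun a b => (hvL j).2 b a
  have hM1 : ∀ j, ∑ a, ∑ b, M j a b ^ 2 = 1 := by
    intro j
    have h1 : ‖v j‖ ^ 2 = 1 := by rw [hv.1 j, one_pow]
    rw [EuclideanSpace.real_norm_sq_eq, Fintype.sum_prod_type] at h1
    exact h1
  have hMtr : ∀ j, (Bᵀ * M j * B).trace = 0 := fun j => congrFun (hvL j).1 none
  have hMK : ∀ j, ∀ z : ι → ℤ, z ≠ 0 → q z = 1 → quadVal (M j) (B *ᵥ intVec z) = 0 := by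
    intro j z hz hz1
    have hzF : z ∈ F := by
      by_contra h
      linarith [hq2 z hz h]
    exact congrFun (hvL j).1 (some ⟨z, Finset.mem_filter.mpr ⟨hzF, hz1⟩⟩)
  have hbessel : ∀ y : ι → ℝ, ∑ j, quadVal (M j) y ^ 2 ≤ (y ⬝ᵥ y) ^ 2 := by
    intro y
    let Y : EuclideanSpace ℝ (ι × ι) := WithLp.toLp 2 fun p => y p.1 * y p.2
    have h1 := hv.sum_inner_products_le Y (s := Finset.univ)
    have h2 : ∀ j, inner ℝ (v j) Y = quadVal (M j) y := by
      intro j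
      simp only [PiLp.inner_apply, Fintype.sum_prod_type, quadVal, dotProduct, Matrix.mulVec,
        Finset.mul_sum]
      refine Finset.sum_congr rfl fun a _ => Finset.sum_congr rfl fun b _ => ?_
      simp [Y, hMdef]
      ring
    have h3 : ‖Y‖ ^ 2 = (y ⬝ᵥ y) ^ 2 := by
      rw [EuclideanSpace.real_norm_sq_eq, Fintype.sum_prod_type, sq (y ⬝ᵥ y), dotProduct,
        Finset.sum_mul_sum]
      refine Finset.sum_congr rfl fun a _ => Finset.sum_congr rfl fun b _ => ?_
      simp [Y]
      ring
    rw [h3] at h1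
    simpa [h2] using h1
  have hmem : ∀ j, ∀ σ : ℝ, |σ| = s → Bᵀ * B + σ • (Bᵀ * M j * B) ∈ admissibleForms ι t := by
    intro j σ hσ
    refine add_smul_mem_admissibleForms hQ (hMs j) (hM1 j).le (hMtr j) (hMK j)
      (by rw [hσ]; linarith) fun z hz hz1 => ?_
    rw [hσ]
    exact hsμ.trans (mul_le_mul_of_nonneg_left (hμ z hz hz1) (by linarith))
  have habs : |s| = s := abs_of_pos hs0
  set E := formEnergy F n (Bᵀ * B) with hEdef
  have hEpos : 0 < E := formEnergy_pos hFne fun z hz => zero_lt_one.trans_le (hq1 z (hF0 z hz))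
  have hlower : ∀ j, E * (2 + 4 / 5 * s ^ 2) ≤
      formEnergy F n (Bᵀ * B + s • (Bᵀ * M j * B)) +
        formEnergy F n (Bᵀ * B + (-s) • (Bᵀ * M j * B)) := fun j =>
    energy_add_energy_sub_ge hFne hF0 hQ hmin (hMs j) (hM1 j) (by rw [habs]; linarith)
      (hmem j s habs) (hmem j (-s) (by rw [abs_neg, habs]))
  set C : ℝ := (n : ℝ) * (n + 1) + 1 with hC
  have hupper : ∀ j, formEnergy F n (Bᵀ * B + s • (Bᵀ * M j * B)) +
        formEnergy F n (Bᵀ * B + (-s) • (Bᵀ * M j * B)) ≤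
      ∑ z ∈ F, (q z ^ n)⁻¹ * (2 + C * (s * (quadVal (M j) (B *ᵥ intVec z) / q z)) ^ 2) := by
    intro j
    rw [formEnergy, formEnergy, ← Finset.sum_add_distrib]
    refine Finset.sum_le_sum fun z hz => ?_
    have hqz : 0 < q z := zero_lt_one.trans_le (hq1 z (hF0 z hz))
    set w := s * (quadVal (M j) (B *ᵥ intVec z) / q z) with hw
    have hsplit : ∀ σ : ℝ, quadVal (Bᵀ * B + σ • (Bᵀ * M j * B)) (intVec z) =
        q z * (1 + σ * (quadVal (M j) (B *ᵥ intVec z) / q z)) := by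
      intro σ
      rw [quadVal_add, quadVal_smul, quadVal_transpose_mul_mul]
      simp only [hq] at hqz ⊢
      field_simp
    have hwb : |w| ≤ δ := by
      rw [hw, abs_mul, habs, abs_div, abs_of_pos hqz]
      have h1 := abs_quadVal_le (hM1 j).le (B *ᵥ intVec z)
      rw [← hBB] at h1
      have h2 : |quadVal (M j) (B *ᵥ intVec z)| / q z ≤ 1 := (div_le_one hqz).mpr h1
      calc _ ≤ s * 1 := by gcongr
        _ ≤ δ := by linarith
    rw [hsplit, hsplit, neg_mul, ← hw, ← sub_eq_add_neg, mul_pow, mul_pow, mul_inv, mul_inv,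
      ← mul_add]
    exact mul_le_mul_of_nonneg_left (hpow w hwb) (by positivity)
  have hsum : (k : ℝ) * (E * (2 + 4 / 5 * s ^ 2)) ≤ E * (2 * k + C * s ^ 2) := by
    calc (k : ℝ) * (E * (2 + 4 / 5 * s ^ 2)) = ∑ _j : Fin k, E * (2 + 4 / 5 * s ^ 2) := by simp
      _ ≤ ∑ j, ∑ z ∈ F, (q z ^ n)⁻¹ * (2 + C * (s * (quadVal (M j) (B *ᵥ intVec z) / q z)) ^ 2) :=
        Finset.sum_le_sum fun j _ => (hlower j).trans (hupper j)
      _ = ∑ z ∈ F, (q z ^ n)⁻¹ * (2 * k + C * s ^ 2 *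
            ((∑ j, quadVal (M j) (B *ᵥ intVec z) ^ 2) / q z ^ 2)) := by
        rw [Finset.sum_comm]
        refine Finset.sum_congr rfl fun z _ => ?_
        rw [← Finset.mul_sum, Finset.sum_add_distrib, Finset.sum_div, Finset.mul_sum]
        congr 2
        · simp [mul_comm]
        · exact Finset.sum_congr rfl fun j _ => by ring
      _ ≤ ∑ z ∈ F, (q z ^ n)⁻¹ * (2 * k + C * s ^ 2 * 1) := by
        refine Finset.sum_le_sum fun z hz => ?_
        have hqz : 0 < q z := zero_lt_one.trans_le (hq1 z (hF0 z hz))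
        have h1 := hbessel (B *ᵥ intVec z)
        rw [← hBB] at h1
        have h2 : (∑ j, quadVal (M j) (B *ᵥ intVec z) ^ 2) / q z ^ 2 ≤ 1 :=
          (div_le_one (by positivity)).mpr h1
        gcongr
      _ = E * (2 * k + C * s ^ 2) := by
        rw [← Finset.sum_mul, mul_one]
        rfl
  have hkC : 4 / 5 * (k : ℝ) ≤ C := by
    have h1 : (E * s ^ 2) * (4 / 5 * (k : ℝ)) ≤ (E * s ^ 2) * C := by nlinarith
    exact le_of_mul_le_mul_left h1 (by positivity)
  refine ⟨Bᵀ * B, hQ, K.card, ?_, ?_⟩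
  · have h1 : (K.card : ℝ) ≤ E := by
      calc (K.card : ℝ) = ∑ z ∈ K, (q z ^ n)⁻¹ := by
            rw [Finset.card_eq_sum_ones, Nat.cast_sum]
            refine Finset.sum_congr rfl fun z hz => ?_
            rw [(Finset.mem_filter.mp hz).2]
            simp
        _ ≤ E := Finset.sum_le_sum_of_subset_of_nonneg (Finset.filter_subset _ _) fun z hz _ =>
            inv_nonneg.mpr (pow_nonneg (zero_le_one.trans (hq1 z (hF0 z hz))) n)
    have h2 := hmin Q₀ hQ₀
    have h3 : 0 ≤ formEnergy F n Q₀ := (formEnergy_pos hFne fun z hz =>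
      zero_lt_one.trans_le (hQ₀.2.2.2 z (hF0 z hz))).le
    calc (K.card : ℝ) ^ 5 * (Bᵀ * B).det ^ 4 ≤ E ^ 5 * (Bᵀ * B).det ^ 4 := by gcongr
      _ ≤ formEnergy F n Q₀ ^ 5 * Q₀.det ^ 4 := h2
      _ ≤ 1 ^ 5 * Q₀.det ^ 4 := by gcongr; exact hE F hF0
      _ = Q₀.det ^ 4 := by ring
  · have h1 : (Fintype.card ι : ℝ) * (Fintype.card ι + 1) ≤ 2 * (k + Fintype.card (Option K)) := by
      exact_mod_cast hk
    rw [Fintype.card_option, Fintype.card_coe] at h1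
    push_cast at h1
    linarith

section Counting

open scoped Pointwise

variable (ι : Type*) [Fintype ι]

/-- The volume of the Euclidean unit ball, as a subset of a product space. -/
noncomputable def unitBallVolume : ℝ := volume.real {x : ι → ℝ | x ⬝ᵥ x ≤ 1}

theorem preimage_toLp_closedBall :
    {x : ι → ℝ | x ⬝ᵥ x ≤ 1} =
      WithLp.toLp 2 ⁻¹' Metric.closedBall (0 : EuclideanSpace ℝ ι) 1 := by
  ext x
  rw [Set.mem_preimage, mem_closedBall_zero_iff, ← abs_norm, ← sq_le_one_iff_abs_le_one,
    EuclideanSpace.real_norm_sq_eq]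
  simp [dotProduct, sq]

theorem volume_real_closedBall_one :
    volume.real (Metric.closedBall (0 : EuclideanSpace ℝ ι) 1) = unitBallVolume ι := by
  rw [unitBallVolume, preimage_toLp_closedBall, (PiLp.volume_preserving_toLp ι).measureReal_preimage
    measurableSet_closedBall.nullMeasurableSet]

theorem unitBallVolume_pos : 0 < unitBallVolume ι := by
  rw [← volume_real_closedBall_one]
  exact ENNReal.toReal_pos (Metric.measure_closedBall_pos _ _ one_pos).ne' measure_closedBall_lt_top.ne

theorem exists_card_le_unitBallVolume [Nonempty ι] : ∃ ρ : ℝ, 1 ≤ ρ ∧ ∀ r : ℝ, ρ ≤ r →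
    ∀ F : Finset (ι → ℤ), (∀ y ∈ F, intVec y ⬝ᵥ intVec y ≤ r ^ 2) →
      (F.card : ℝ) ≤ 2 * unitBallVolume ι * r ^ Fintype.card ι := by
  set s : Set (ι → ℝ) := {x : ι → ℝ | x ⬝ᵥ x ≤ 1} with hs
  have hclosed : IsClosed s := isClosed_le (by unfold dotProduct; fun_prop) continuous_const
  have hbdd : Bornology.IsBounded s := by
    refine (Metric.isBounded_closedBall (x := (0 : ι → ℝ)) (r := 1)).subset fun x hx => ?_
    rw [mem_closedBall_zero_iff]
    refine (pi_norm_le_iff_of_nonneg zero_le_one).mpr fun i => ?_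
    rw [Real.norm_eq_abs, ← sq_le_one_iff_abs_le_one]
    refine le_trans ?_ (show x ⬝ᵥ x ≤ 1 from hx)
    rw [sq]
    exact Finset.single_le_sum (f := fun i => x i * x i) (fun j _ => mul_self_nonneg _)
      (Finset.mem_univ i)
  have hconv : Convex ℝ s := by
    rw [hs, preimage_toLp_closedBall]
    exact (convex_closedBall _ _).linear_preimage
      (WithLp.linearEquiv 2 ℝ (ι → ℝ)).symm.toLinearMap
  have hscale : ∀ ⦃x y : ℝ⦄, 0 < x → x ≤ y → x • s ⊆ y • s := by
    intro x y hx hxy a ha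
    have hy := hx.trans_le hxy
    rw [Set.mem_smul_set_iff_inv_smul_mem₀ hx.ne'] at ha
    rw [Set.mem_smul_set_iff_inv_smul_mem₀ hy.ne']
    simp only [hs, Set.mem_ofPred_eq, dotProduct_smul, smul_dotProduct, smul_eq_mul] at ha ⊢
    have h0 : 0 ≤ a ⬝ᵥ a := Finset.sum_nonneg fun i _ => mul_self_nonneg _
    refine le_trans ?_ ha
    gcongr
  have h := tendsto_card_div_pow_atTop_volume' s hbdd hclosed.measurableSet
    (hconv.addHaar_frontier volume) hscale
  have hv : volume.real s < 2 * unitBallVolume ι := by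
    have := unitBallVolume_pos ι
    change unitBallVolume ι < _
    linarith
  obtain ⟨ρ, hρ⟩ := Filter.eventually_atTop.mp (h.eventually_lt_const hv)
  refine ⟨max ρ 1, le_max_right _ _, fun r hr F hF => ?_⟩
  have hr0 : 0 < r := zero_lt_one.trans_le ((le_max_right _ _).trans hr)
  have h1 := (hρ r ((le_max_left _ _).trans hr)).le
  rw [div_le_iff₀ (by positivity)] at h1
  refine le_trans ?_ h1
  have hfin : (s ∩ r⁻¹ • (Submodule.span ℤ (Set.range (Pi.basisFun ℝ ι)) : Set (ι → ℝ))).Finite := by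
    have := ZSpan.setFinite_inter (Pi.basisFun ℝ ι) (hbdd.smul₀ r)
    refine (this.smul_set (a := r⁻¹)).subset ?_
    rw [Set.smul_set_inter₀ (inv_ne_zero hr0.ne'), inv_smul_smul₀ hr0.ne']
  have := hfin.to_subtype
  have hmem : ∀ y ∈ F, r⁻¹ • intVec y ∈
      s ∩ r⁻¹ • (Submodule.span ℤ (Set.range (Pi.basisFun ℝ ι)) : Set (ι → ℝ)) := by
    refine fun y hy => ⟨?_, Set.smul_mem_smul_set ?_⟩
    · simp only [hs, Set.mem_ofPred_eq, dotProduct_smul, smul_dotProduct, smul_eq_mul]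
      have h2 := hF y hy
      rw [← mul_assoc, ← mul_inv, inv_mul_le_iff₀ (by positivity), mul_one, ← sq]
      exact h2
    · rw [SetLike.mem_coe, Module.Basis.mem_span_iff_repr_mem]
      exact fun i => ⟨y i, by simp [intVec]⟩
  rw [← Fintype.card_coe, ← Nat.card_eq_fintype_card]
  refine Nat.cast_le.mpr (Nat.card_le_card_of_injective (fun y : F => ⟨_, hmem y.1 y.2⟩) ?_)
  intro y y' h
  have h3 : r⁻¹ • intVec y.1 = r⁻¹ • intVec y'.1 := congrArg Subtype.val h
  have h4 := smul_right_injective _ (inv_ne_zero hr0.ne') h3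
  ext i
  have h5 := congrFun h4 i
  simpa [intVec] using h5

/-- The sum of a truncated inverse power over integer points is controlled by the volume. -/
theorem exists_sum_min_inv_pow_le [Nonempty ι] {e : ℕ} (he : 0 < e)
    (hι : Fintype.card ι = 5 * e) : ∃ ρ : ℝ, 1 ≤ ρ ∧ ∀ r : ℝ, ρ ≤ r → ∀ F : Finset (ι → ℤ),
      ∑ y ∈ F, min 1 (((intVec y ⬝ᵥ intVec y) / r ^ 2) ^ (3 * e))⁻¹ ≤
        256 * unitBallVolume ι * r ^ Fintype.card ι := by
  obtain ⟨ρ, hρ1, hρ⟩ := exists_card_le_unitBallVolume ι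
  refine ⟨ρ, hρ1, fun r hr F => ?_⟩
  have hr0 : 0 < r := zero_lt_one.trans_le (hρ1.trans hr)
  obtain ⟨w, hw1, hwe⟩ : ∃ w : ℝ, 1 < w ∧ w ^ e = 2 := by
    refine ⟨2 ^ (e : ℝ)⁻¹, Real.one_lt_rpow one_lt_two (by positivity), ?_⟩
    rw [Real.rpow_inv_natCast_pow zero_le_two he.ne']
  have hw0 : 0 < w := zero_lt_one.trans hw1
  have hwpow : ∀ y : ι → ℤ, ∃ i : ℕ, intVec y ⬝ᵥ intVec y ≤ (r * w ^ i) ^ 2 := by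
    intro y
    obtain ⟨i, hi⟩ := pow_unbounded_of_one_lt ((intVec y ⬝ᵥ intVec y) / r ^ 2) hw1
    refine ⟨i, ?_⟩
    rw [div_lt_iff₀ (by positivity)] at hi
    have h1 : 1 ≤ w ^ i := one_le_pow₀ hw1.le
    nlinarith [sq_nonneg r, mul_nonneg (sq_nonneg r) (zero_le_one.trans h1)]
  classical
  have hlevel : ∀ y : ι → ℤ, ∃ i : ℕ, intVec y ⬝ᵥ intVec y ≤ (r * w ^ i) ^ 2 ∧
      ∀ j < i, ¬ intVec y ⬝ᵥ intVec y ≤ (r * w ^ j) ^ 2 := fun y =>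
    ⟨Nat.find (hwpow y), Nat.find_spec (hwpow y), fun j hj => Nat.find_min (hwpow y) hj⟩
  choose lev hlev hlevmin using hlevel
  set I := F.sup lev with hI
  have hterm : ∀ y ∈ F, min 1 (((intVec y ⬝ᵥ intVec y) / r ^ 2) ^ (3 * e))⁻¹ ≤
      ∑ i ∈ Finset.range (I + 1),
        if intVec y ⬝ᵥ intVec y ≤ (r * w ^ i) ^ 2 then 64 * ((64 : ℝ) ^ i)⁻¹ else 0 := by
    intro y hy
    have hmem : lev y ∈ Finset.range (I + 1) :=
      Finset.mem_range.mpr (Nat.lt_succ_of_le (Finset.le_sup hy))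
    refine le_trans ?_ (Finset.single_le_sum (fun i _ => ?_) hmem)
    · rw [if_pos (hlev y)]
      rcases h : lev y with _ | j
      · exact (min_le_left _ _).trans (by norm_num)
      · have h1 : ¬ intVec y ⬝ᵥ intVec y ≤ (r * w ^ j) ^ 2 := hlevmin y j (by omega)
        rw [not_le] at h1
        refine (min_le_right _ _).trans ?_
        have h2 : (w ^ j) ^ 2 ≤ (intVec y ⬝ᵥ intVec y) / r ^ 2 := by
          rw [le_div_iff₀ (by positivity)]
          linarith [mul_pow r (w ^ j) 2]
        have h3 : (64 : ℝ) ^ j ≤ ((intVec y ⬝ᵥ intVec y) / r ^ 2) ^ (3 * e) := by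
          calc (64 : ℝ) ^ j = ((w ^ e) ^ 6) ^ j := by rw [hwe]; norm_num
            _ = ((w ^ j) ^ 2) ^ (3 * e) := by ring
            _ ≤ _ := by gcongr
        calc _ ≤ ((64 : ℝ) ^ j)⁻¹ := by gcongr
          _ = _ := by rw [pow_succ]; field_simp
    · split_ifs
      · positivity
      · exact le_rfl
  calc _ ≤ ∑ y ∈ F, ∑ i ∈ Finset.range (I + 1),
        (if intVec y ⬝ᵥ intVec y ≤ (r * w ^ i) ^ 2 then 64 * ((64 : ℝ) ^ i)⁻¹ else 0) :=
        Finset.sum_le_sum hterm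
    _ = ∑ i ∈ Finset.range (I + 1),
        ((F.filter fun y => intVec y ⬝ᵥ intVec y ≤ (r * w ^ i) ^ 2).card : ℝ) *
          (64 * ((64 : ℝ) ^ i)⁻¹) := by
        rw [Finset.sum_comm]
        refine Finset.sum_congr rfl fun i _ => ?_
        rw [← Finset.sum_filter, Finset.sum_const, nsmul_eq_mul]
    _ ≤ ∑ i ∈ Finset.range (I + 1), 128 * unitBallVolume ι * r ^ Fintype.card ι * (1 / 2) ^ i := by
        refine Finset.sum_le_sum fun i _ => ?_
        have h1 : ρ ≤ r * w ^ i := hr.trans (le_mul_of_one_le_right hr0.le (one_le_pow₀ hw1.le))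
        have h2 := hρ _ h1 (F.filter fun y => intVec y ⬝ᵥ intVec y ≤ (r * w ^ i) ^ 2)
          fun y hy => (Finset.mem_filter.mp hy).2
        have h3 : (r * w ^ i) ^ Fintype.card ι = r ^ Fintype.card ι * 32 ^ i := by
          rw [mul_pow, hι]
          congr 1
          calc (w ^ i) ^ (5 * e) = ((w ^ e) ^ 5) ^ i := by ring
            _ = 32 ^ i := by rw [hwe]; norm_num
        rw [h3] at h2
        calc _ ≤ 2 * unitBallVolume ι * (r ^ Fintype.card ι * 32 ^ i) *
              (64 * ((64 : ℝ) ^ i)⁻¹) := by gcongr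
          _ = 128 * unitBallVolume ι * r ^ Fintype.card ι * (32 ^ i * ((64 : ℝ) ^ i)⁻¹) := by ring
          _ = _ := by
            rw [← inv_pow, ← mul_pow]
            norm_num
    _ ≤ 128 * unitBallVolume ι * r ^ Fintype.card ι * 2 := by
        rw [← Finset.mul_sum]
        have hv := unitBallVolume_pos ι
        gcongr
        have := (summable_geometric_two).sum_le_tsum (Finset.range (I + 1))
          (fun i _ => by positivity)
        rwa [tsum_geometric_two] at this
    _ = _ := by ring

end Counting

theorem one_le_intVec_dotProduct_self {ι : Type*} [Fintype ι] {y : ι → ℤ} (hy : y ≠ 0) :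
    1 ≤ intVec y ⬝ᵥ intVec y := by
  obtain ⟨i, hi⟩ := Function.ne_iff.mp hy
  have h1 : (1 : ℝ) ≤ intVec y i * intVec y i := by
    have : 1 ≤ y i * y i := by
      have := mul_self_pos.mpr hi
      omega
    simp only [intVec]
    exact_mod_cast this
  exact h1.trans (Finset.single_le_sum (f := fun i => intVec y i * intVec y i)
    (fun j _ => mul_self_nonneg _) (Finset.mem_univ i))

section ModularLattices

variable {m : ℕ}

/-- A triangular integer matrix whose image is the lattice of integer vectors congruent modulo `p`
to a multiple of `(1, u)`. -/
def modMatrix (p : ℕ) (u : Fin m → Fin p) : Matrix (Fin (m + 1)) (Fin (m + 1)) ℤ :=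
  Matrix.of <| Fin.cons (Pi.single 0 1)
    fun i => Fin.cons (u i : ℤ) (Pi.single i (p : ℤ))

theorem modMatrix_mulVec_zero (p : ℕ) (u : Fin m → Fin p) (z : Fin (m + 1) → ℤ) :
    (modMatrix p u *ᵥ z) 0 = z 0 := by
  simp [modMatrix, Matrix.mulVec]

theorem modMatrix_mulVec_succ (p : ℕ) (u : Fin m → Fin p) (z : Fin (m + 1) → ℤ) (i : Fin m) :
    (modMatrix p u *ᵥ z) i.succ = u i * z 0 + p * z i.succ := by
  simp [modMatrix, Matrix.mulVec, dotProduct, Fin.sum_univ_succ, Pi.single_apply]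

theorem det_modMatrix (p : ℕ) (u : Fin m → Fin p) : (modMatrix p u).det = (p : ℤ) ^ m := by
  have h : (modMatrix p u).submatrix Fin.succ Fin.succ = Matrix.diagonal fun _ => (p : ℤ) := by
    ext i j
    simp [modMatrix, Matrix.diagonal_apply, Pi.single_apply, eq_comm]
  rw [Matrix.det_succ_row_zero, Fin.sum_univ_succ]
  simp [modMatrix] at h ⊢
  simp [h]

theorem modMatrix_mulVec_ne_zero {p : ℕ} (hp : 0 < p) (u : Fin m → Fin p) {z : Fin (m + 1) → ℤ}
    (hz : z ≠ 0) : modMatrix p u *ᵥ z ≠ 0 := by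
  have h : (modMatrix p u).det ≠ 0 := by
    rw [det_modMatrix]
    positivity
  exact fun h0 => hz (Matrix.eq_zero_of_mulVec_eq_zero h h0)

theorem modMatrix_mulVec_injOn {p : ℕ} (hp : p.Prime) {u u' : Fin m → Fin p}
    {z z' : Fin (m + 1) → ℤ} (hz : ¬ (p : ℤ) ∣ z 0)
    (h : modMatrix p u *ᵥ z = modMatrix p u' *ᵥ z') : u = u' ∧ z = z' := by
  have h0 : z 0 = z' 0 := by
    have := congrFun h 0
    rwa [modMatrix_mulVec_zero, modMatrix_mulVec_zero] at this
  have hs : ∀ i : Fin m, (u i : ℤ) * z 0 + p * z i.succ = u' i * z 0 + p * z' i.succ := by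
    intro i
    have := congrFun h i.succ
    rwa [modMatrix_mulVec_succ, modMatrix_mulVec_succ, ← h0] at this
  have hu : u = u' := by
    funext i
    have h1 : (p : ℤ) ∣ ((u i : ℤ) - u' i) * z 0 := ⟨z' i.succ - z i.succ, by linarith [hs i]⟩
    have h2 := ((Nat.prime_iff_prime_int.mp hp).dvd_or_dvd h1).resolve_right hz
    have h3 : (u i : ℤ) - u' i = 0 := by
      refine Int.eq_zero_of_abs_lt_dvd h2 ?_
      have := (u i).isLt
      have := (u' i).isLt
      rw [abs_lt]
      omega
    exact Fin.ext (by omega)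
  refine ⟨hu, funext fun j => ?_⟩
  subst hu
  refine Fin.cases h0 (fun i => ?_) j
  have h1 : (p : ℤ) * z i.succ = p * z' i.succ := by linarith [hs i]
  exact mul_left_cancel₀ (by exact_mod_cast hp.ne_zero) h1

theorem exists_modMatrix_mulVec_eq_smul (p : ℕ) (u : Fin m → Fin p)
    {z : Fin (m + 1) → ℤ} (hz : (p : ℤ) ∣ z 0) :
    ∃ y : Fin (m + 1) → ℤ, modMatrix p u *ᵥ z = (p : ℤ) • y := by
  obtain ⟨k, hk⟩ := hz
  refine ⟨Fin.cons k fun i => u i * k + z i.succ, funext fun j => Fin.cases ?_ (fun i => ?_) j⟩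
  · simp [modMatrix_mulVec_zero, hk]
  · simp [modMatrix_mulVec_succ, hk]
    ring

/-- There is a lattice of large density all of whose nonzero vectors have norm at least one, with
small inverse power sum. -/
theorem exists_matrix_sum_inv_pow_le {e : ℕ} (he : 0 < e) (hm : m + 1 = 5 * e) :
    ∃ G : Matrix (Fin (m + 1)) (Fin (m + 1)) ℝ,
      |G.det| = 1024 * unitBallVolume (Fin (m + 1)) ∧
      ∀ F : Finset (Fin (m + 1) → ℤ), (∀ z ∈ F, z ≠ 0) →
        ∑ z ∈ F, min 1 (((G *ᵥ intVec z) ⬝ᵥ (G *ᵥ intVec z)) ^ (3 * e))⁻¹ ≤ 1 / 2 := by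
  obtain ⟨ρ, hρ1, hρ⟩ := exists_sum_min_inv_pow_le (Fin (m + 1)) he (by simpa using hm)
  set v := unitBallVolume (Fin (m + 1)) with hv
  have hv0 : 0 < v := unitBallVolume_pos _
  have hρ0 : 0 < ρ := zero_lt_one.trans_le hρ1
  rw [Fintype.card_fin] at hρ
  set Z : ℝ := 256 * v * ρ ^ (m + 1) with hZdef
  -- the sum of inverse powers over nonzero integer points is bounded
  have hZ : ∀ F : Finset (Fin (m + 1) → ℤ), (∀ y ∈ F, y ≠ 0) →
      ∑ y ∈ F, ((intVec y ⬝ᵥ intVec y) ^ (3 * e))⁻¹ ≤ Z := by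
    intro F hF
    refine (Finset.sum_le_sum fun y hy => ?_).trans (hρ ρ le_rfl F)
    have h1 := one_le_intVec_dotProduct_self (hF y hy)
    refine le_min (inv_le_one_of_one_le₀ (one_le_pow₀ h1)) ?_
    gcongr
    exact div_le_self (by positivity) (one_le_pow₀ hρ1)
  obtain ⟨p, hpge, hp⟩ := Nat.exists_infinite_primes
    (⌈1024 * v * ρ ^ (m + 1)⌉₊ + ⌈Z / (256 * v)⌉₊ + ⌈1 / (1024 * v)⌉₊)
  have hp1 : 1024 * v * ρ ^ (m + 1) ≤ p := (Nat.le_ceil _).trans (by exact_mod_cast by omega)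
  have hp2 : Z / (256 * v) ≤ p := (Nat.le_ceil _).trans (by exact_mod_cast by omega)
  have hp3 : 1 / (1024 * v) ≤ p := (Nat.le_ceil _).trans (by exact_mod_cast by omega)
  have hp0 : (0 : ℝ) < p := by exact_mod_cast hp.pos
  obtain ⟨r, hr0, hr⟩ : ∃ r : ℝ, 0 < r ∧ r ^ (m + 1) = (p : ℝ) ^ m / (1024 * v) :=
    ⟨((p : ℝ) ^ m / (1024 * v)) ^ (((m + 1 : ℕ) : ℝ)⁻¹), by positivity,
      Real.rpow_inv_natCast_pow (by positivity) (by omega)⟩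
  have hρr : ρ ≤ r := by
    refine le_of_pow_le_pow_left₀ (n := m + 1) (by omega) hr0.le ?_
    rw [hr, le_div_iff₀ (by positivity)]
    calc ρ ^ (m + 1) * (1024 * v) = 1024 * v * ρ ^ (m + 1) := by ring
      _ ≤ (p : ℝ) ^ 1 := by simpa using hp1
      _ ≤ (p : ℝ) ^ m := pow_le_pow_right₀ (by exact_mod_cast hp.one_lt.le) (by omega)
  have hrp : ((r / p) ^ 2) ^ (3 * e) * Z ≤ 1 / 4 := by
    have h1 : (r / p) ^ (m + 1) = 1 / (1024 * v * p) := by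
      rw [div_pow, hr]
      field_simp
      ring
    have h2 : r / p ≤ 1 := by
      refine le_of_pow_le_pow_left₀ (n := m + 1) (by omega) zero_le_one ?_
      rw [h1, one_pow, div_le_one (by positivity)]
      rw [div_le_iff₀ (by positivity)] at hp3
      linarith
    rw [div_le_iff₀ (by positivity)] at hp2
    calc ((r / p) ^ 2) ^ (3 * e) * Z = (r / p) ^ (m + 1 + e) * Z := by
          rw [← pow_mul]; congr 2; omega
      _ ≤ (r / p) ^ (m + 1) * Z := by
          exact mul_le_mul_of_nonneg_right
            (pow_le_pow_of_le_one (by positivity) h2 (by omega)) (by positivity)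
      _ ≤ 1 / 4 := by
          rw [h1, div_mul_eq_mul_div, div_le_iff₀ (by positivity)]
          linarith
  set f : (Fin (m + 1) → ℤ) → ℝ :=
    fun y => min 1 (((intVec y ⬝ᵥ intVec y) / r ^ 2) ^ (3 * e))⁻¹ with hf
  have hf0 : ∀ y, 0 ≤ f y := by
    intro y
    have : 0 ≤ intVec y ⬝ᵥ intVec y := Finset.sum_nonneg fun i _ => mul_self_nonneg _
    exact le_min zero_le_one (by positivity)
  have hmean : ∀ F : Finset (Fin (m + 1) → ℤ), (∀ z ∈ F, z ≠ 0) →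
      ∑ u : Fin m → Fin p, ∑ z ∈ F, f (modMatrix p u *ᵥ z) ≤ (p : ℝ) ^ m * (1 / 2) := by
    classical
    intro F hF
    have hsplit : ∀ u : Fin m → Fin p, ∑ z ∈ F, f (modMatrix p u *ᵥ z) =
        ∑ z ∈ F with (p : ℤ) ∣ z 0, f (modMatrix p u *ᵥ z) +
          ∑ z ∈ F with ¬ (p : ℤ) ∣ z 0, f (modMatrix p u *ᵥ z) := fun u =>
      (Finset.sum_filter_add_sum_filter_not _ _ _).symm
    simp only [hsplit, Finset.sum_add_distrib]
    have hA : ∀ u : Fin m → Fin p,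
        ∑ z ∈ F with (p : ℤ) ∣ z 0, f (modMatrix p u *ᵥ z) ≤ 1 / 4 := by
      intro u
      choose! y hy using fun z (hz : z ∈ F.filter fun z => (p : ℤ) ∣ z 0) =>
        exists_modMatrix_mulVec_eq_smul p u (Finset.mem_filter.mp hz).2
      have hinj : Set.InjOn y (F.filter fun z => (p : ℤ) ∣ z 0) := by
        intro z hz z' hz' hzz
        by_contra hne
        refine modMatrix_mulVec_ne_zero hp.pos u (sub_ne_zero.mpr hne) ?_
        rw [Matrix.mulVec_sub, hy z hz, hy z' hz', hzz, sub_self]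
      have hy0 : ∀ w ∈ (F.filter fun z => (p : ℤ) ∣ z 0).image y, w ≠ 0 := by
        intro w hw
        obtain ⟨z, hz, rfl⟩ := Finset.mem_image.mp hw
        intro h0
        refine modMatrix_mulVec_ne_zero hp.pos u (hF z (Finset.mem_filter.mp hz).1) ?_
        rw [hy z hz, h0, smul_zero]
      calc _ ≤ ∑ z ∈ F with (p : ℤ) ∣ z 0,
            ((r / p) ^ 2) ^ (3 * e) * ((intVec (y z) ⬝ᵥ intVec (y z)) ^ (3 * e))⁻¹ := by
            refine Finset.sum_le_sum fun z hz => (min_le_right _ _).trans (le_of_eq ?_)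
            have h1 : intVec (modMatrix p u *ᵥ z) = (p : ℝ) • intVec (y z) := by
              rw [hy z hz]
              ext i
              simp [intVec]
            rw [h1, smul_dotProduct, dotProduct_smul, smul_eq_mul, smul_eq_mul, ← inv_pow,
              ← inv_pow, ← mul_pow, inv_div]
            congr 1
            field_simp
        _ = ((r / p) ^ 2) ^ (3 * e) * ∑ w ∈ (F.filter fun z => (p : ℤ) ∣ z 0).image y,
              ((intVec w ⬝ᵥ intVec w) ^ (3 * e))⁻¹ := by
            rw [Finset.sum_image hinj, Finset.mul_sum]
        _ ≤ ((r / p) ^ 2) ^ (3 * e) * Z := by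
            gcongr
            exact hZ _ hy0
        _ ≤ 1 / 4 := hrp
    have hB : ∑ u : Fin m → Fin p, ∑ z ∈ F with ¬ (p : ℤ) ∣ z 0, f (modMatrix p u *ᵥ z) ≤
        (p : ℝ) ^ m * (1 / 4) := by
      set S := (Finset.univ : Finset (Fin m → Fin p)) ×ˢ (F.filter fun z => ¬ (p : ℤ) ∣ z 0)
      have hinj : Set.InjOn (fun q : (Fin m → Fin p) × (Fin (m + 1) → ℤ) =>
          modMatrix p q.1 *ᵥ q.2) S := by
        rintro ⟨u, z⟩ hz ⟨u', z'⟩ _ h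
        have h1 := modMatrix_mulVec_injOn hp
          (Finset.mem_filter.mp (Finset.mem_product.mp hz).2).2 h
        exact Prod.ext h1.1 h1.2
      rw [← Finset.sum_product', ← Finset.sum_image (f := f) hinj]
      refine (hρ r hρr _).trans (le_of_eq ?_)
      rw [hr]
      field_simp
      norm_num
    calc _ ≤ ∑ _u : Fin m → Fin p, (1 / 4 : ℝ) + (p : ℝ) ^ m * (1 / 4) := by
          gcongr with u
          exact hA u
      _ = _ := by
          simp
          ring
  obtain ⟨u, hu⟩ : ∃ u : Fin m → Fin p, ∀ F : Finset (Fin (m + 1) → ℤ), (∀ z ∈ F, z ≠ 0) →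
      ∑ z ∈ F, f (modMatrix p u *ᵥ z) ≤ 1 / 2 := by
    classical
    by_contra! hcon
    choose F hF0 hF using hcon
    have h1 := hmean (Finset.univ.biUnion F) fun z hz => by
      obtain ⟨u, _, hu⟩ := Finset.mem_biUnion.mp hz
      exact hF0 u z hu
    have : Nonempty (Fin m → Fin p) := ⟨fun _ => ⟨0, hp.pos⟩⟩
    have h2 : ∑ _u : Fin m → Fin p, (1 / 2 : ℝ) <
        ∑ u : Fin m → Fin p, ∑ z ∈ Finset.univ.biUnion F, f (modMatrix p u *ᵥ z) :=
      Finset.sum_lt_sum_of_nonempty Finset.univ_nonempty fun u _ => (hF u).trans_le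
        (Finset.sum_le_sum_of_subset_of_nonneg (Finset.subset_biUnion_of_mem F (Finset.mem_univ u))
          fun z _ _ => hf0 _)
    simp at h2
    linarith
  refine ⟨r⁻¹ • (modMatrix p u).map (Int.cast : ℤ → ℝ), ?_, fun F hF => ?_⟩
  · have h1 : ((modMatrix p u).map (Int.cast : ℤ → ℝ)).det = (p : ℝ) ^ m := by
      have := (Int.castRingHom ℝ).map_det (modMatrix p u)
      rw [det_modMatrix] at this
      simpa using this.symm
    rw [Matrix.det_smul, h1, Fintype.card_fin, inv_pow, hr, abs_of_pos (by positivity)]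
    field_simp
  · refine le_trans (le_of_eq (Finset.sum_congr rfl fun z _ => ?_)) (hu F hF)
    have h1 : (modMatrix p u).map (Int.cast : ℤ → ℝ) *ᵥ intVec z =
        intVec (modMatrix p u *ᵥ z) := by
      ext i
      simp [intVec, Matrix.mulVec, dotProduct]
    rw [hf, Matrix.smul_mulVec, h1, smul_dotProduct, dotProduct_smul, smul_eq_mul, smul_eq_mul]
    congr 3
    field_simp

end ModularLattices

/-- The lattice generated by the columns of a matrix, rescaled to covolume one, and a ball it
avoids. -/
theorem exists_lattice_of_matrix {d : ℕ} (hd : 0 < d) {B : Matrix (Fin d) (Fin d) ℝ}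
    (hdet : B.det ≠ 0) (hB : ∀ z : Fin d → ℤ, z ≠ 0 → 1 ≤ quadVal (Bᵀ * B) (intVec z)) :
    ∃ (Λ : Submodule ℤ (EuclideanSpace ℝ (Fin d))) (_ : DiscreteTopology Λ)
      (_ : IsZLattice ℝ Λ) (R : ℝ), 0 ≤ R ∧ ZLattice.covolume Λ = 1 ∧
      (volume (Metric.closedBall (0 : EuclideanSpace ℝ (Fin d)) R)).toReal =
        unitBallVolume (Fin d) / (2 * |B.det|) ∧
      ∀ v ∈ Λ, v ∈ Metric.closedBall (0 : EuclideanSpace ℝ (Fin d)) R → v = 0 := by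
  have hdet' : 0 < |B.det| := abs_pos.mpr hdet
  obtain ⟨c, hc0, hc⟩ : ∃ c : ℝ, 0 < c ∧ c ^ d = |B.det|⁻¹ :=
    ⟨|B.det|⁻¹ ^ (d : ℝ)⁻¹, by positivity, Real.rpow_inv_natCast_pow (by positivity) hd.ne'⟩
  obtain ⟨R, hR0, hR⟩ : ∃ R : ℝ, 0 < R ∧ R ^ d = (2 * |B.det|)⁻¹ :=
    ⟨(2 * |B.det|)⁻¹ ^ (d : ℝ)⁻¹, by positivity, Real.rpow_inv_natCast_pow (by positivity) hd.ne'⟩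
  have hRc : R < c := by
    refine lt_of_pow_lt_pow_left₀ d hc0.le ?_
    rw [hR, hc]
    gcongr
    linarith
  have hdetc : |(c • B).det| = 1 := by
    rw [Matrix.det_smul, Fintype.card_fin, hc, abs_mul, abs_inv, abs_abs,
      inv_mul_cancel₀ hdet'.ne']
  have hunit : IsUnit (c • B).det := by
    rw [isUnit_iff_ne_zero, ← abs_pos, hdetc]
    exact one_pos
  let b₀ := EuclideanSpace.basisFun (Fin d) ℝ
  let b := b₀.toBasis.map (Matrix.toLinearEquiv b₀.toBasis (c • B) hunit)
  have hcov : ZLattice.covolume (Submodule.span ℤ (Set.range b)) = 1 := by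
    rw [ZLattice.covolume_eq_measure_fundamentalDomain _ volume (ZSpan.isAddFundamentalDomain b _),
      ZSpan.measureReal_fundamentalDomain b volume b₀.toBasis,
      measureReal_congr (ZSpan.fundamentalDomain_ae_parallelepiped b₀.toBasis volume)]
    have h1 : b₀.toBasis.det b = (c • B).det := by
      have : (b : Fin d → EuclideanSpace ℝ (Fin d)) =
          Matrix.toLin b₀.toBasis b₀.toBasis (c • B) ∘ b₀.toBasis := by
        ext i; simp [b]
      rw [this, Module.Basis.det_comp_basis]
      exact LinearMap.det_toLin _ _
    rw [h1, hdetc, measureReal_def, OrthonormalBasis.coe_toBasis,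
      OrthonormalBasis.volume_parallelepiped]
    simp
  refine ⟨Submodule.span ℤ (Set.range b), inferInstance, inferInstance, R, hR0.le, hcov, ?_, ?_⟩
  · rw [Measure.addHaar_closedBall' _ _ hR0.le, finrank_euclideanSpace, Fintype.card_fin, hR,
      ENNReal.toReal_mul, ENNReal.toReal_ofReal (by positivity), ← measureReal_def,
      volume_real_closedBall_one, div_eq_inv_mul]
  · intro v hv hvR
    by_contra hv0
    rw [Module.Basis.mem_span_iff_repr_mem] at hv
    choose z hz using hv
    have hz' : ∀ i, (z i : ℝ) = b.repr v i := hz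
    have hvz : (v : Fin d → ℝ) = (c • B) *ᵥ intVec z := by
      have hb : ∀ j i, b j i = (c • B) i j := fun j i => by
        have h : b j = ∑ i, (c • B) i j • b₀.toBasis i := by
          rw [← Matrix.toLin_self b₀.toBasis b₀.toBasis]
          rfl
        rw [h]
        simp [b₀, Finset.sum_apply, Pi.single_apply]
      ext i
      conv_lhs => rw [← b.sum_repr v]
      simp only [WithLp.ofLp_sum, WithLp.ofLp_smul, Finset.sum_apply, Pi.smul_apply, hb, ← hz',
        smul_eq_mul, Matrix.mulVec, dotProduct, intVec]
      exact Finset.sum_congr rfl fun j _ => mul_comm _ _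
    have hz0 : z ≠ 0 := by
      rintro rfl
      apply hv0
      ext i
      have h0 : intVec (0 : Fin d → ℤ) = 0 := by ext i; simp [intVec]
      rw [hvz, h0, Matrix.mulVec_zero]
      rfl
    have h1 := hB z hz0
    have h2 : ‖v‖ ^ 2 = c ^ 2 * quadVal (Bᵀ * B) (intVec z) := by
      have h3 : ‖v‖ ^ 2 = (v : Fin d → ℝ) ⬝ᵥ (v : Fin d → ℝ) := by
        rw [EuclideanSpace.real_norm_sq_eq]
        simp [dotProduct, sq]
      have h4 := quadVal_transpose_mul_mul B 1 (intVec z)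
      rw [Matrix.mul_one, quadVal_one] at h4
      rw [h3, hvz, h4, Matrix.smul_mulVec, smul_dotProduct, dotProduct_smul, smul_eq_mul,
        smul_eq_mul]
      ring
    rw [mem_closedBall_zero_iff] at hvR
    have h5 : c ^ 2 ≤ ‖v‖ ^ 2 := by
      rw [h2]
      exact le_mul_of_one_le_right (by positivity) h1
    have h6 := le_of_pow_le_pow_left₀ two_ne_zero (norm_nonneg v) h5
    linarith

theorem bddAbove_latticePackingSup (d : ℕ) :
    BddAbove {V : ℝ | ∃ (Λ : Submodule ℤ (EuclideanSpace ℝ (Fin d))) (_ : DiscreteTopology Λ)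
      (_ : IsZLattice ℝ Λ) (R : ℝ), 0 ≤ R ∧ ZLattice.covolume Λ = 1 ∧
      V = (volume (Metric.closedBall (0 : EuclideanSpace ℝ (Fin d)) R)).toReal ∧
      ∀ v ∈ Λ, v ∈ Metric.closedBall (0 : EuclideanSpace ℝ (Fin d)) R → v = 0} := by
  refine ⟨2 ^ d, ?_⟩
  rintro V ⟨Λ, hΛ, hΛ', R, hR, hcov, rfl, hball⟩
  by_contra! hlt
  let b := (Module.Free.chooseBasis ℤ Λ).ofZLatticeBasis ℝ
  have hfund := ZLattice.isAddFundamentalDomain (Module.Free.chooseBasis ℤ Λ)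
    (volume : Measure (EuclideanSpace ℝ (Fin d)))
  rw [ZLattice.covolume_eq_measure_fundamentalDomain _ _ hfund, measureReal_def,
    ENNReal.toReal_eq_one_iff] at hcov
  have : Countable Λ.toAddSubgroup := inferInstanceAs (Countable Λ)
  obtain ⟨x, hx0, hx⟩ := exists_ne_zero_mem_lattice_of_measure_mul_two_pow_lt_measure
    (L := Λ.toAddSubgroup) (s := Metric.closedBall (0 : EuclideanSpace ℝ (Fin d)) R)
    (μ := volume) hfund (fun x hx => by simpa using hx) (convex_closedBall _ _) (by
      rw [hcov, one_mul, finrank_euclideanSpace, Fintype.card_fin]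
      rw [← ENNReal.toReal_lt_toReal (by finiteness) measure_closedBall_lt_top.ne]
      simpa using hlt)
  exact hx0 (Subtype.ext (hball x x.2 hx))

theorem exists_matrix_det_le {e : ℕ} (he : 10 ≤ e) :
    ∃ B : Matrix (Fin (5 * e)) (Fin (5 * e)) ℝ, B.det ≠ 0 ∧
      (∀ z : Fin (5 * e) → ℤ, z ≠ 0 → 1 ≤ quadVal (Bᵀ * B) (intVec z)) ∧
      (e : ℝ) ^ 10 * |B.det| ^ 8 ≤ (1024 * unitBallVolume (Fin (5 * e))) ^ 8 := by
  obtain ⟨m, hm⟩ : ∃ m, 5 * e = m + 1 := ⟨5 * e - 1, by omega⟩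
  have hcard : Fintype.card (Fin (5 * e)) = 5 * e := Fintype.card_fin _
  obtain ⟨G, hG, hGF⟩ : ∃ G : Matrix (Fin (5 * e)) (Fin (5 * e)) ℝ,
      |G.det| = 1024 * unitBallVolume (Fin (5 * e)) ∧
      ∀ F : Finset (Fin (5 * e) → ℤ), (∀ z ∈ F, z ≠ 0) →
        ∑ z ∈ F, min 1 (((G *ᵥ intVec z) ⬝ᵥ (G *ᵥ intVec z)) ^ (3 * e))⁻¹ ≤ 1 / 2 := by
    rw [hm]
    exact exists_matrix_sum_inv_pow_le (by omega) hm.symm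
  have hGpos := unitBallVolume_pos (Fin (5 * e))
  have hGdet : G.det ≠ 0 := by
    rw [← abs_pos, hG]
    positivity
  have hq : ∀ x, quadVal (Gᵀ * G) x = (G *ᵥ x) ⬝ᵥ (G *ᵥ x) := fun x => by
    simp only [quadVal, ← Matrix.mulVec_mulVec, Matrix.dotProduct_mulVec, Matrix.vecMul_transpose]
  have hq0 : ∀ x, 0 ≤ quadVal (Gᵀ * G) x := fun x => by
    rw [hq]
    exact Finset.sum_nonneg fun i _ => mul_self_nonneg _
  have hq1 : ∀ z : Fin (5 * e) → ℤ, z ≠ 0 → 1 ≤ quadVal (Gᵀ * G) (intVec z) := by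
    intro z hz
    by_contra! hlt
    have h1 := hGF {z} (by simpa using hz)
    rw [Finset.sum_singleton, ← hq] at h1
    have h2 : quadVal (Gᵀ * G) (intVec z) ≠ 0 := by
      rw [hq, Ne, dotProduct_self_eq_zero]
      exact fun h => intVec_ne_zero hz (Matrix.eq_zero_of_mulVec_eq_zero hGdet h)
    have h3 : 0 < quadVal (Gᵀ * G) (intVec z) := lt_of_le_of_ne (hq0 _) h2.symm
    have h4 : 1 ≤ (quadVal (Gᵀ * G) (intVec z) ^ (3 * e))⁻¹ :=
      (one_le_inv₀ (by positivity)).mpr (pow_le_one₀ h3.le hlt.le)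
    rw [min_eq_left h4] at h1
    norm_num at h1
  have hmem : Gᵀ * G ∈ admissibleForms (Fin (5 * e)) (Gᵀ * G).trace :=
    ⟨by simp [Matrix.IsSymm, Matrix.transpose_mul], hq0, rfl, hq1⟩
  have : Nonempty (Fin (5 * e)) := ⟨⟨0, by omega⟩⟩
  obtain ⟨Q, hQ, N, hN, hcontact⟩ := exists_admissible_small_det hmem (3 * e) fun F hF => by
    have h1 := hGF F hF
    refine le_trans (Finset.sum_le_sum fun z hz => ?_) (h1.trans (by norm_num))
    rw [← hq]
    exact le_min (inv_le_one_of_one_le₀ (one_le_pow₀ (hq1 z (hF z hz)))) le_rfl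
  obtain ⟨B, rfl⟩ := (posSemidef_of_quadVal_nonneg hQ.1 hQ.2.1).exists_eq_transpose_mul_self
  have hdet := det_pos_of_mem_admissibleForms hQ
  simp only [Matrix.det_mul, Matrix.det_transpose] at hdet hN
  refine ⟨B, fun h => by simp [h] at hdet, hQ.2.2.2, ?_⟩
  have he' : (10 : ℝ) ≤ e := by exact_mod_cast he
  have hNe : (e : ℝ) ^ 2 ≤ N := by
    rw [hcard] at hcontact
    push_cast at hcontact
    nlinarith
  calc (e : ℝ) ^ 10 * |B.det| ^ 8 = ((e : ℝ) ^ 2) ^ 5 * (|B.det| * |B.det|) ^ 4 := by ring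
    _ ≤ (N : ℝ) ^ 5 * (|B.det| * |B.det|) ^ 4 := by gcongr
    _ = (N : ℝ) ^ 5 * (B.det * B.det) ^ 4 := by rw [abs_mul_abs_self]
    _ ≤ (G.det * G.det) ^ 4 := hN
    _ = (|G.det| * |G.det|) ^ 4 := by rw [abs_mul_abs_self]
    _ = _ := by rw [hG]; ring

theorem exists_mul_log_log_pow_le (N : ℕ) : ∃ e : ℕ, N ≤ e ∧ 10 ≤ e ∧
    0 ≤ Real.log (Real.log (5 * e)) ∧
    (2 * (5 * e * Real.log (Real.log (5 * e)))) ^ 8 * 1024 ^ 8 ≤ (e : ℝ) ^ 10 := by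
  have h := (Real.isLittleO_pow_log_id_atTop (n := 8)).bound
    (c := 1 / (10240 ^ 8)) (by positivity)
  have htend : Filter.Tendsto (fun e : ℕ => 5 * (e : ℝ)) Filter.atTop Filter.atTop :=
    tendsto_natCast_atTop_atTop.const_mul_atTop (by norm_num)
  obtain ⟨e, h1, hNe, h10⟩ := ((htend.eventually h).and
    ((Filter.eventually_ge_atTop N).and (Filter.eventually_ge_atTop 10))).exists
  have he : (10 : ℝ) ≤ e := by exact_mod_cast h10
  have hlog : 1 ≤ Real.log (5 * e) := by
    rw [Real.le_log_iff_exp_le (by positivity)]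
    linarith [Real.exp_one_lt_d9]
  have hlog2 : Real.log (Real.log (5 * e)) ≤ Real.log (5 * e) :=
    (Real.log_le_sub_one_of_pos (by linarith)).trans (by linarith)
  have hll := Real.log_nonneg hlog
  refine ⟨e, hNe, h10, hll, ?_⟩
  rw [Real.norm_of_nonneg (by positivity), id, Real.norm_of_nonneg (by positivity)] at h1
  calc (2 * (5 * e * Real.log (Real.log (5 * e)))) ^ 8 * 1024 ^ 8
      ≤ (2 * (5 * e * Real.log (5 * e))) ^ 8 * 1024 ^ 8 := by gcongr
    _ = 10240 ^ 8 * (e : ℝ) ^ 8 * Real.log (5 * e) ^ 8 := by ring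
    _ ≤ 10240 ^ 8 * (e : ℝ) ^ 8 * (1 / 10240 ^ 8 * (5 * e)) := by gcongr
    _ = (e : ℝ) ^ 8 * (5 * e) := by ring
    _ ≤ (e : ℝ) ^ 8 * (e * e) := by gcongr; linarith
    _ = (e : ℝ) ^ 10 := by ring

/-- There are constants `c, C > 0` such that for infinitely many dimensions `d` there is a
full-rank covolume-one lattice `Λ ⊆ ℝ^d` and an origin-centered ball of volume at least
`d log log d - e^{-c d log d + C d}` meeting `Λ` only in `0`; equivalently, the lattice packing
quantity satisfies `c_d ≥ d log log d - e^{-c d log d + C d}` for infinitely many `d`. -/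
theorem stmt19 : ∃ c C : ℝ, 0 < c ∧ 0 < C ∧ ∀ N : ℕ, ∃ d : ℕ, N ≤ d ∧
    (∃ (Λ : Submodule ℤ (EuclideanSpace ℝ (Fin d))) (_ : DiscreteTopology Λ)
        (_ : IsZLattice ℝ Λ) (R : ℝ), 0 ≤ R ∧ ZLattice.covolume Λ = 1 ∧
      (d : ℝ) * Real.log (Real.log d) - Real.exp (-c * d * Real.log d + C * d)
        ≤ (volume (Metric.closedBall (0 : EuclideanSpace ℝ (Fin d)) R)).toReal ∧
      ∀ v ∈ Λ, v ∈ Metric.closedBall (0 : EuclideanSpace ℝ (Fin d)) R → v = 0) ∧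
    (d : ℝ) * Real.log (Real.log d) - Real.exp (-c * d * Real.log d + C * d)
      ≤ latticePackingSup d := by
  refine ⟨1, 1, one_pos, one_pos, fun N => ?_⟩
  obtain ⟨e, hNe, he, hll, hbound⟩ := exists_mul_log_log_pow_le N
  obtain ⟨B, hdet, hB, hBdet⟩ := exists_matrix_det_le he
  obtain ⟨Λ, hΛ, hΛ', R, hR, hcov, hvol, hball⟩ :=
    exists_lattice_of_matrix (by omega) hdet hB
  have hv := unitBallVolume_pos (Fin (5 * e))
  have hdet' : 0 < |B.det| := abs_pos.mpr hdet
  have he0 : (0 : ℝ) < e := by exact_mod_cast (by omega : 0 < e)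
  have hmain : ((5 * e : ℕ) : ℝ) * Real.log (Real.log (5 * e : ℕ)) -
      Real.exp (-1 * (5 * e : ℕ) * Real.log (5 * e : ℕ) + 1 * (5 * e : ℕ)) ≤
        (volume (Metric.closedBall (0 : EuclideanSpace ℝ (Fin (5 * e))) R)).toReal := by
    refine (sub_le_self _ (Real.exp_pos _).le).trans ?_
    rw [hvol, le_div_iff₀ (by positivity)]
    push_cast
    set W := 5 * (e : ℝ) * Real.log (Real.log (5 * e)) with hW
    have hW0 : 0 ≤ W := by positivity
    have h1 : (2 * W * |B.det|) ^ 8 * 1024 ^ 8 ≤ unitBallVolume (Fin (5 * e)) ^ 8 * 1024 ^ 8 := by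
      calc (2 * W * |B.det|) ^ 8 * 1024 ^ 8 = (2 * W) ^ 8 * 1024 ^ 8 * |B.det| ^ 8 := by ring
        _ ≤ (e : ℝ) ^ 10 * |B.det| ^ 8 := by gcongr
        _ ≤ (1024 * unitBallVolume (Fin (5 * e))) ^ 8 := hBdet
        _ = _ := by ring
    have h2 := le_of_pow_le_pow_left₀ (by norm_num) hv.le
      (le_of_mul_le_mul_right h1 (by positivity))
    linarith
  refine ⟨5 * e, by omega, ⟨Λ, hΛ, hΛ', R, hR, hcov, hmain, hball⟩, hmain.trans ?_⟩
  exact le_csSup (bddAbove_latticePackingSup _) ⟨Λ, hΛ, hΛ', R, hR, hcov, rfl, hball⟩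
end
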